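/- In the branching setup, suppose that π₁(∂W) is amenable and that ‖M,∂M‖ = 0. Then for every d ∈ ℕ_{≥1} the cyclic branched covering satisfies ‖W^(d)‖ ≤ d · ‖W,∂W‖. In particular, if ‖W,∂W‖ = 0, then ‖W^(d)‖ = 0. -/

import Mathlib

open scoped Topology
open CategoryTheory

noncomputable section

/-- The closed unit disk `Dⁿ ⊆ ℝⁿ`. -/
def UnitDisk (n : ℕ) : Set (EuclideanSpace ℝ (Fin n)) := Metric.closedBall 0 1

/-- The unit sphere `Sⁿ⁻¹ ⊆ ℝⁿ` (the boundary of `Dⁿ`). -/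
def UnitSphere (n : ℕ) : Set (EuclideanSpace ℝ (Fin n)) := Metric.sphere 0 1

/-- A CW-structure on a topological space (the non-equivariant case of a `G`-CW-structure). -/
structure CWStructure (X : Type) [TopologicalSpace X] : Type 1 where
  t2 : T2Space X
  cells : ℕ → Type
  charMap : ∀ n, cells n → UnitDisk n → X
  charMap_continuous : ∀ n i, Continuous (charMap n i)
  sphere_le : ∀ n i (z : UnitDisk n), ‖(z : EuclideanSpace ℝ (Fin n))‖ = 1 →
    ∃ (m : ℕ) (_ : m < n) (j : cells m) (w : UnitDisk m),
      ‖(w : EuclideanSpace ℝ (Fin m))‖ < 1 ∧ charMap m j w = charMap n i z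
  partition : ∀ x : X, ∃! p : Σ (n : ℕ) (_ : cells n), UnitDisk n,
      ‖(p.2.2 : EuclideanSpace ℝ (Fin p.1))‖ < 1 ∧ charMap p.1 p.2.1 p.2.2 = x
  weak_topology : ∀ A : Set X, IsClosed A ↔ ∀ n i, IsClosed (charMap n i ⁻¹' A)

/-- The CW-complex has dimension at most `c`. -/
def CWStructure.DimLE {X : Type} [TopologicalSpace X] (C : CWStructure X) (c : ℕ∞) : Prop :=
  ∀ n : ℕ, c < (n : ℕ∞) → IsEmpty (C.cells n)

/-- A CW-model of the classifying space `BG`: an aspherical path-connected CW-complex with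
fundamental group isomorphic to `G`. -/
structure ClassifyingModel (G : Type) [Group G] : Type 1 where
  space : Type
  [topology : TopologicalSpace space]
  cw : CWStructure space
  pathConnected : PathConnectedSpace space
  basepoint : space
  /-- all higher homotopy groups vanish -/
  aspherical : ∀ n : ℕ, 2 ≤ n → Subsingleton (HomotopyGroup.Pi n space basepoint)
  iso : FundamentalGroup space basepoint ≃* G

attribute [instance] ClassifyingModel.topology

/-- The geometric dimension of `G`: the infimum of the dimensions of CW-models of `BG`. -/
def gd (G : Type) [Group G] : ℕ∞ :=
  sInf {c : ℕ∞ | ∃ Y : ClassifyingModel G, Y.cw.DimLE c}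

attribute [local instance] Path.Homotopic.setoid

/-- The element of the fundamental group determined by a homotopy class of loops. -/
def pathToPi1 {Y : Type} [TopologicalSpace Y] {y : Y} (p : Path.Homotopic.Quotient y y) :
    FundamentalGroup Y y :=
  FundamentalGroup.fromPath (X := TopCat.of Y) p

/-- A left-invariant finitely additive probability measure defined on all subsets of `G`. -/
structure InvariantMean (G : Type) [Group G] where
  meas : Set G → ℝ
  nonneg : ∀ A : Set G, 0 ≤ meas A
  total : meas Set.univ = 1
  additive : ∀ A B : Set G, Disjoint A B → meas (A ∪ B) = meas A + meas B
  invariant : ∀ (g : G) (A : Set G), meas ((g * ·) '' A) = meas A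

/-- A group is amenable if it admits a left-invariant mean. -/
def IsAmenable (G : Type) [Group G] : Prop := Nonempty (InvariantMean G)

/-- The condition on a member `U` of an amenable open cover: for every `y ∈ U`, the image of
`π₁(U, y) → π₁(Y, y)` is contained in an amenable subgroup. -/
def AmenableCoverCondition {Y : Type} [TopologicalSpace Y] (U : Set Y) : Prop :=
  ∀ y ∈ U, ∃ H : Subgroup (FundamentalGroup Y y), IsAmenable H ∧
    ∀ p : Path y y, (∀ t, p t ∈ U) → pathToPi1 ⟦p⟧ ∈ H

/-- The amenable category `cat_Am(Y)` of a space `Y`: the infimum of all `n` such that `Y`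
admits a cover by `n + 1` amenable open subsets. -/
def amCat (Y : Type) [TopologicalSpace Y] : ℕ∞ :=
  sInf {c : ℕ∞ | ∃ n : ℕ, c = (n : ℕ∞) ∧ ∃ U : Fin (n + 1) → Set Y,
    (∀ i, IsOpen (U i)) ∧ (∀ y : Y, ∃ i, y ∈ U i) ∧ ∀ i, AmenableCoverCondition (U i)}

/-- The amenable category of a group: `cat_Am(G) := cat_Am(BG)`. -/
def amCatGroup (G : Type) [Group G] : ℕ∞ :=
  sInf {c : ℕ∞ | ∃ Y : ClassifyingModel G, c = amCat Y.space}

/-- A subspace `S ⊆ X` is `π₁`-injective if for every basepoint in `S` the inclusion induces an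
injective map on fundamental groups, i.e. loops in `S` that are homotopic in `X` are already
homotopic in `S`. -/
def Pi1Injective {X : Type} [TopologicalSpace X] (S : Set X) : Prop :=
  ∀ (x : S) (p q : Path x x),
    (p.map continuous_subtype_val).Homotopic (q.map continuous_subtype_val) → p.Homotopic q

/-- The image of `π₁(S, x) → π₁(X, x)` (as a subset of the fundamental group of `X`). -/
def loopImageSet {X : Type} [TopologicalSpace X] (S : Set X) (x : X) :
    Set (FundamentalGroup X x) :=
  {g | ∃ p : Path x x, (∀ t, p t ∈ S) ∧ g = pathToPi1 ⟦p⟧}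

/-- The standard topological `n`-simplex. -/
def TopSimplex (n : ℕ) : Set (Fin (n + 1) → ℝ) := stdSimplex ℝ (Fin (n + 1))

/-- Singular `n`-chains on `X` with coefficients in `R`: finitely supported functions on the
set of singular `n`-simplices. -/
abbrev SingularChain (R : Type) [CommRing R] (X : Type) [TopologicalSpace X] (n : ℕ) :=
  C(TopSimplex n, X) →₀ R

/-- The `i`-th face inclusion of standard simplices. -/
def faceMap (n : ℕ) (i : Fin (n + 2)) : C(TopSimplex n, TopSimplex (n + 1)) where
  toFun x := ⟨fun j => ∑ k : Fin (n + 1), if i.succAbove k = j then (x : Fin (n + 1) → ℝ) k else 0,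
    by
      refine ⟨fun j => Finset.sum_nonneg fun k _ => ?_, ?_⟩
      · by_cases h : i.succAbove k = j
        · simpa [h] using x.2.1 k
        · simp [h]
      · rw [Finset.sum_comm]
        simp only [Finset.sum_ite_eq, Finset.mem_univ, if_true]
        exact x.2.2⟩
  continuous_toFun := by
    apply Continuous.subtype_mk
    apply continuous_pi
    intro j
    apply continuous_finset_sum
    intro k _
    by_cases h : i.succAbove k = j
    · simp only [h, if_true]
      exact (continuous_apply k).comp continuous_subtype_val
    · simpa [h] using continuous_const

variable {R : Type} [CommRing R] {X Y : Type} [TopologicalSpace X] [TopologicalSpace Y]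

/-- The boundary operator on singular chains. -/
def chainBoundary {n : ℕ} (c : SingularChain R X (n + 1)) : SingularChain R X n :=
  c.sum fun σ r =>
    ∑ i : Fin (n + 2), (r * (-1) ^ (i : ℕ)) • Finsupp.single (σ.comp (faceMap n i)) (1 : R)

/-- The boundary operator, lowering the degree by one (with `∂ = 0` in degree `0`). -/
def chainBoundaryFrom : ∀ n, SingularChain R X n → SingularChain R X (n - 1)
  | 0, _ => 0
  | _ + 1, c => chainBoundary c

/-- The pushforward of singular chains along a continuous map. -/
def chainMap (f : C(X, Y)) {n : ℕ} (c : SingularChain R X n) : SingularChain R Y n :=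
  c.sum fun σ r => Finsupp.single (f.comp σ) r

/-- The inclusion of a subspace as a continuous map. -/
def subInc {X : Type} [TopologicalSpace X] (A : Set X) : C(A, X) :=
  ⟨Subtype.val, continuous_subtype_val⟩

/-- The chains on `X` supported on the subspace `A`. -/
def chainsOn (A : Set X) (n : ℕ) : Set (SingularChain R X n) :=
  Set.range fun c : SingularChain R A n => chainMap (subInc A) c

/-- A relative `n`-cycle of `(X, A)`. -/
def IsRelCycle (A : Set X) : ∀ n, SingularChain R X n → Prop
  | 0, _ => True
  | n + 1, c => chainBoundary c ∈ chainsOn A n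

/-- Two relative `n`-cycles define the same class in `H_n(X, A; R)`. -/
def RelHomologous (A : Set X) (n : ℕ) (c d : SingularChain R X n) : Prop :=
  ∃ b : SingularChain R X (n + 1), ∃ a ∈ chainsOn (R := R) A n, c - d = chainBoundary b + a

/-- The `ℓ¹`-norm `|c|₁ = ∑_σ |a_σ|` of a real singular chain `c = ∑_σ a_σ · σ`. -/
def chainNorm {n : ℕ} (c : SingularChain ℝ X n) : ℝ :=
  c.sum fun _ r => |r|

/-- Extension of coefficients `ℤ → ℝ` on singular chains. -/
def chainExt {n : ℕ} (c : SingularChain ℤ X n) : SingularChain ℝ X n :=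
  Finsupp.mapRange (fun k : ℤ => (k : ℝ)) (by norm_num) c

/-- The halfspace `{x : ℝⁿ | x₀ ≥ 0}` (all of `ℝ⁰` for `n = 0`). -/
def HalfSpace (n : ℕ) : Set (Fin n → ℝ) := {x | ∀ h : 0 < n, 0 ≤ x ⟨0, h⟩}

/-- The boundary `{x₀ = 0}` of the halfspace. -/
def HalfSpaceBoundary (n : ℕ) : Set (Fin n → ℝ) := {x | ∃ h : 0 < n, x ⟨0, h⟩ = 0}

/-- An oriented compact connected topological `n`-manifold with (possibly empty) boundary.
The orientation is recorded by an integral relative fundamental cycle `fundClass`, i.e. a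
relative cycle whose class generates `H_n(M, ∂M; ℤ) ≅ ℤ` (for a compact connected `n`-manifold,
such a generator exists if and only if the manifold is orientable, and the choice of generator
is exactly the choice of orientation). -/
structure OCCManifold (n : ℕ) : Type 1 where
  carrier : Type
  [topology : TopologicalSpace carrier]
  boundary : Set carrier
  t2 : T2Space carrier
  compact : CompactSpace carrier
  connected : ConnectedSpace carrier
  /-- every point has a halfspace chart, which detects the boundary -/
  charts : ∀ x : carrier, ∃ (U : Set carrier) (V : Set (HalfSpace n)) (φ : U ≃ₜ V),
    x ∈ U ∧ IsOpen U ∧ IsOpen V ∧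
    ∀ y : U, ((y : carrier) ∈ boundary ↔
      ((φ y : HalfSpace n) : Fin n → ℝ) ∈ HalfSpaceBoundary n)
  fundClass : SingularChain ℤ carrier n
  fundClass_cycle : IsRelCycle boundary n fundClass
  fundClass_gen : ∀ c : SingularChain ℤ carrier n, IsRelCycle boundary n c →
    ∃ k : ℤ, RelHomologous boundary n c (k • fundClass)
  fundClass_ord : ∀ k : ℤ, RelHomologous boundary n (k • fundClass) 0 → k = 0

attribute [instance] OCCManifold.topology

/-- A real relative fundamental cycle of `(M, ∂M)`: a real relative cycle representing the image
of the integral fundamental class under the change of coefficients `ℤ → ℝ`. -/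
def IsFundamentalCycle {n : ℕ} (M : OCCManifold n) (c : SingularChain ℝ M.carrier n) : Prop :=
  IsRelCycle M.boundary n c ∧ RelHomologous M.boundary n c (chainExt M.fundClass)

/-- The (relative) simplicial volume `‖M, ∂M‖`: the infimum of the `ℓ¹`-norms of the real
relative fundamental cycles of `(M, ∂M)`.  For closed `M` this is the simplicial volume `‖M‖`. -/
def simVol {n : ℕ} (M : OCCManifold n) : ℝ :=
  sInf {r : ℝ | ∃ c : SingularChain ℝ M.carrier n, IsFundamentalCycle M c ∧ r = chainNorm c}

/-- `S` is a boundary component of `M`, i.e. a connected component of `∂M`. -/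
def IsBoundaryComponent {n : ℕ} (M : OCCManifold n) (S : Set M.carrier) : Prop :=
  ∃ x ∈ M.boundary, S = connectedComponentIn M.boundary x

open scoped Classical in
/-- `z` is a fundamental cycle for the induced orientation on the part `S` of the boundary of
`M`: a cycle on `S` which, pushed into `M`, is the part of `∂(fundClass)` supported on `S`. -/
def IsInducedBoundaryCycle {n : ℕ} (M : OCCManifold n) (S : Set M.carrier)
    (z : SingularChain ℤ S (n - 1)) : Prop :=
  IsRelCycle (∅ : Set S) (n - 1) z ∧
    chainMap (subInc S) z =
      (chainBoundaryFrom n M.fundClass).filter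
        (fun σ : C(TopSimplex (n - 1), M.carrier) => ∀ t, σ t ∈ S)

/-- `h` carries the induced orientation of `S ⊆ ∂M` to `sign` times the induced orientation of
`T ⊆ ∂N`: with `sign = 1` this says that `h` is orientation-preserving, and with `sign = -1`
that `h` is orientation-reversing. -/
def OrientationCompatible {n : ℕ} (sign : ℤ) (M N : OCCManifold n)
    {S : Set M.carrier} {T : Set N.carrier} (h : S ≃ₜ T) : Prop :=
  ∀ z w, IsInducedBoundaryCycle M S z → IsInducedBoundaryCycle N T w →
    RelHomologous (∅ : Set T) (n - 1)
      (chainMap ⟨h, h.continuous_toFun⟩ z) (sign • w)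

/-- The twisted double `D_f(M) = M ∪_f (−M)`, presented as a closed manifold together with the
two copies of `M` and the quotient description of the gluing along `f`. -/
structure TwistedDouble {n : ℕ} (M : OCCManifold n) (f : M.boundary ≃ₜ M.boundary) : Type 1 where
  double : OCCManifold n
  closed : double.boundary = ∅
  /-- the copy of `M` -/
  embp : C(M.carrier, double.carrier)
  /-- the copy of `−M` -/
  embm : C(M.carrier, double.carrier)
  quotient : Topology.IsQuotientMap (Sum.elim embp embm : M.carrier ⊕ M.carrier → double.carrier)
  identifications : ∀ a b : M.carrier ⊕ M.carrier,
    Sum.elim embp embm a = Sum.elim embp embm b ↔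
      Relation.EqvGen (fun p q : M.carrier ⊕ M.carrier =>
        ∃ z : M.boundary, p = Sum.inl (z : M.carrier) ∧
          q = Sum.inr ((f z : M.boundary) : M.carrier)) a b

/-- The branching setup: an oriented compact connected `(n-1)`-manifold `M` with non-empty
connected boundary, and an oriented compact connected `n`-manifold `W` whose boundary is the
untwisted double `D_id(M) = M ∪_id (−M)`, presented by the two copies `embp`, `embm` of `M`
inside `∂W` and the quotient description of the untwisted gluing. -/
structure BranchSetup (n : ℕ) : Type 1 where
  n_ge : 3 ≤ n
  M : OCCManifold (n - 1)
  bd_nonempty : M.boundary.Nonempty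
  bd_connected : IsConnected M.boundary
  W : OCCManifold n
  embp : C(M.carrier, W.boundary)
  embm : C(M.carrier, W.boundary)
  quotient : Topology.IsQuotientMap (Sum.elim embp embm : M.carrier ⊕ M.carrier → W.boundary)
  identifications : ∀ a b : M.carrier ⊕ M.carrier,
    Sum.elim embp embm a = Sum.elim embp embm b ↔
      Relation.EqvGen (fun p q : M.carrier ⊕ M.carrier =>
        ∃ x ∈ M.boundary, p = Sum.inl x ∧ q = Sum.inr x) a b

/-- The cyclic branched covering `W^{(d)}`: `d` copies of `W` glued cyclically, identifying the
copy `−M ⊆ ∂W_j` with the copy `M ⊆ ∂W_{j+1}` via the identity of `M` (indices mod `d`). -/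
structure CyclicGluing {n : ℕ} (B : BranchSetup n) (d : ℕ) [NeZero d] : Type 1 where
  total : OCCManifold n
  closed : total.boundary = ∅
  emb : Fin d → C(B.W.carrier, total.carrier)
  quotient : Topology.IsQuotientMap fun p : Fin d × B.W.carrier => emb p.1 p.2
  identifications : ∀ a b : Fin d × B.W.carrier,
    emb a.1 a.2 = emb b.1 b.2 ↔
      Relation.EqvGen (fun p q : Fin d × B.W.carrier =>
        ∃ (j : Fin d) (x : B.M.carrier),
          p = (j, ((B.embm x : B.W.boundary) : B.W.carrier)) ∧
          q = (j + 1, ((B.embp x : B.W.boundary) : B.W.carrier))) a b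


namespace SV
local notation "𝕀" => unitInterval

/-! ### Chain algebra -/

/-- The standard simplex as a type. -/
abbrev Sx (n : ℕ) : Type := TopSimplex n

/-- Linear version of the boundary. -/
def bd {n : ℕ} : SingularChain R X (n + 1) →ₗ[R] SingularChain R X n :=
  Finsupp.linearCombination R fun σ =>
    ∑ i : Fin (n + 2), (-1 : R) ^ (i : ℕ) • Finsupp.single (σ.comp (faceMap n i)) (1 : R)

theorem chainBoundary_eq {n : ℕ} (c : SingularChain R X (n + 1)) : chainBoundary c = bd c := by
  simp only [chainBoundary, bd, Finsupp.linearCombination_apply, Finset.smul_sum, smul_smul]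

theorem bd_single {n : ℕ} (σ : C(Sx (n + 1), X)) :
    bd (Finsupp.single σ (1 : R)) =
      ∑ i : Fin (n + 2), (-1 : R) ^ (i : ℕ) • Finsupp.single (σ.comp (faceMap n i)) (1 : R) := by
  simp [bd]

/-- Linear version of the pushforward. -/
def pf (f : C(X, Y)) {n : ℕ} : SingularChain R X n →ₗ[R] SingularChain R Y n :=
  Finsupp.lmapDomain R R fun σ => f.comp σ

theorem chainMap_eq (f : C(X, Y)) {n : ℕ} (c : SingularChain R X n) : chainMap f c = pf f c := rfl

theorem pf_single (f : C(X, Y)) {n : ℕ} (σ : C(Sx n, X)) (r : R) :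
    pf f (Finsupp.single σ r) = Finsupp.single (f.comp σ) r := by
  simp [pf]

theorem pf_pf {Z : Type} [TopologicalSpace Z] (g : C(Y, Z)) (f : C(X, Y)) {n : ℕ}
    (c : SingularChain R X n) : pf g (pf f c) = pf (g.comp f) c := by
  simp only [pf, Finsupp.lmapDomain_apply, ← Finsupp.mapDomain_comp]
  rfl

theorem pf_id {n : ℕ} (c : SingularChain R X n) : pf (ContinuousMap.id X) c = c :=
  Finsupp.mapDomain_id

/-- Linear maps out of singular chains agree if they agree on simplices. -/
theorem ch_ext {n : ℕ} {P : Type} [AddCommGroup P] [Module R P]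
    {f g : SingularChain R X n →ₗ[R] P}
    (h : ∀ σ, f (Finsupp.single σ 1) = g (Finsupp.single σ 1)) : f = g :=
  Finsupp.lhom_ext' fun σ => LinearMap.ext_ring (h σ)

theorem bd_pf (f : C(X, Y)) {n : ℕ} (c : SingularChain R X (n + 1)) :
    bd (pf f c) = pf f (bd c) := by
  have : (bd ∘ₗ pf f : SingularChain R X (n + 1) →ₗ[R] _) = pf f ∘ₗ bd := by
    apply ch_ext
    intro σ
    simp only [LinearMap.comp_apply, pf_single, bd_single, map_sum, map_smul]
    rfl
  exact LinearMap.congr_fun this c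

/-- membership in `chainsOn`, via supports -/
theorem mem_chainsOn {A : Set X} {n : ℕ} {c : SingularChain R X n} :
    c ∈ chainsOn A n ↔ ∀ σ ∈ c.support, ∀ t, σ t ∈ A := by
  classical
  constructor
  · rintro ⟨c, rfl⟩ σ hσ t
    have := Finsupp.mapDomain_support (f := fun σ => (subInc A).comp σ) (s := c) hσ
    obtain ⟨τ, -, rfl⟩ := Finset.mem_image.1 this
    exact (τ t).2
  · intro h
    refine ⟨c.sum fun σ r => if hh : ∀ t, σ t ∈ A then
      Finsupp.single (⟨fun t => ⟨σ t, hh t⟩, by fun_prop⟩ : C(TopSimplex n, A)) r else 0, ?_⟩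
    show pf _ _ = c
    rw [Finsupp.sum, map_sum]
    conv_rhs => rw [← Finsupp.sum_single c]
    apply Finset.sum_congr rfl
    intro σ hσ
    rw [dif_pos (h σ hσ), pf_single]
    rfl

/-- `chainsOn` as a submodule -/
def con (R : Type) [CommRing R] (A : Set X) (n : ℕ) : Submodule R (SingularChain R X n) :=
  Finsupp.supported R R {σ | ∀ t, σ t ∈ A}

theorem mem_con {A : Set X} {n : ℕ} {c : SingularChain R X n} :
    c ∈ con R A n ↔ ∀ σ ∈ c.support, ∀ t, σ t ∈ A := by
  rw [con, Finsupp.mem_supported]; rfl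

theorem mem_chainsOn_iff {A : Set X} {n : ℕ} {c : SingularChain R X n} :
    c ∈ chainsOn A n ↔ c ∈ con R A n := by rw [mem_con, mem_chainsOn]

theorem con_eq_span (A : Set X) (n : ℕ) : con R A n =
    Submodule.span R ((fun σ => Finsupp.single σ (1 : R)) '' {σ : C(Sx n, X) | ∀ t, σ t ∈ A}) :=
  Finsupp.supported_eq_span_single _ _

theorem single_mem_con {A : Set X} {n : ℕ} {σ : C(Sx n, X)} (h : ∀ t, σ t ∈ A) (r : R) :
    Finsupp.single σ r ∈ con R A n :=
  Finsupp.single_mem_supported R r h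

/-- A linear map sending simplices in `A` into `S` sends `con A` into `S`. -/
theorem map_con {A : Set X} {n : ℕ} {P : Type} [AddCommGroup P] [Module R P]
    (f : SingularChain R X n →ₗ[R] P) (S : Submodule R P)
    (h : ∀ σ : C(Sx n, X), (∀ t, σ t ∈ A) → f (Finsupp.single σ 1) ∈ S)
    {c : SingularChain R X n} (hc : c ∈ con R A n) : f c ∈ S := by
  rw [con_eq_span] at hc
  have : Submodule.span R ((fun σ => Finsupp.single σ (1 : R)) '' {σ : C(Sx n, X) | ∀ t, σ t ∈ A})
      ≤ S.comap f := by
    rw [Submodule.span_le]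
    rintro _ ⟨σ, hσ, rfl⟩
    exact h σ hσ
  exact this hc

theorem con_mono {A B : Set X} (h : A ⊆ B) {n : ℕ} {c : SingularChain R X n}
    (hc : c ∈ con R A n) : c ∈ con R B n := by
  rw [mem_con] at *
  exact fun σ hσ t => h (hc σ hσ t)

theorem con_inter {A B : Set X} {n : ℕ} {c : SingularChain R X n}
    (hc : c ∈ con R A n) (hc' : c ∈ con R B n) : c ∈ con R (A ∩ B) n := by
  rw [mem_con] at *
  exact fun σ hσ t => ⟨hc σ hσ t, hc' σ hσ t⟩

theorem con_empty {n : ℕ} {c : SingularChain R X n} (hc : c ∈ con R (∅ : Set X) n) : c = 0 := by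
  rw [mem_con] at hc
  rw [← Finsupp.support_eq_empty, Finset.eq_empty_iff_forall_notMem]
  intro σ hσ
  have : (Sx n) := ⟨Pi.single 0 1, single_mem_stdSimplex ℝ 0⟩
  exact hc σ hσ this

theorem con_univ {n : ℕ} (c : SingularChain R X n) : c ∈ con R (Set.univ : Set X) n := by
  rw [mem_con]; simp

theorem bd_con {A : Set X} {n : ℕ} {c : SingularChain R X (n + 1)} (hc : c ∈ con R A (n + 1)) :
    bd c ∈ con R A n := by
  refine map_con bd _ (fun σ hσ => ?_) hc
  rw [bd_single]
  exact Submodule.sum_mem _ fun i _ => Submodule.smul_mem _ _ (single_mem_con (σ := σ.comp (faceMap n i)) (fun t => hσ _) _)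

theorem pf_con {A : Set X} {B : Set Y} {f : C(X, Y)} (h : ∀ x ∈ A, f x ∈ B) {n : ℕ}
    {c : SingularChain R X n} (hc : c ∈ con R A n) : pf f c ∈ con R B n := by
  refine map_con (pf f) _ (fun σ hσ => ?_) hc
  rw [pf_single]
  exact single_mem_con (fun t => h _ (hσ t)) _

theorem exists_sub {A : Set X} {n : ℕ} {c : SingularChain R X n} (hc : c ∈ con R A n) :
    ∃ b : SingularChain R A n, pf (subInc A) b = c := mem_chainsOn_iff.2 hc

theorem pf_inj {f : C(X, Y)} (hf : Function.Injective f) {n : ℕ} :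
    Function.Injective (pf f : SingularChain R X n →ₗ[R] _) := by
  apply Finsupp.mapDomain_injective
  intro σ τ h
  ext t
  exact hf (DFunLike.congr_fun h t)

theorem pf_congr {A : Set X} {f g : C(X, Y)} (h : ∀ x ∈ A, f x = g x) {n : ℕ}
    {c : SingularChain R X n} (hc : c ∈ con R A n) : pf f c = pf g c := by
  have := map_con (pf f - pf g) (⊥ : Submodule R (SingularChain R Y n)) (fun σ hσ => ?_) hc
  · simpa [sub_eq_zero] using this
  · have : f.comp σ = g.comp σ := by ext t; exact h _ (hσ t)
    simp [pf_single, this]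

/-- change of coefficients -/
theorem chainExt_single {n : ℕ} (σ : C(Sx n, X)) (k : ℤ) :
    chainExt (Finsupp.single σ k) = Finsupp.single σ (k : ℝ) := by
  simp [chainExt]

/-- `chainExt` as an additive map -/
def cext {n : ℕ} : SingularChain ℤ X n →+ SingularChain ℝ X n :=
  Finsupp.mapRange.addMonoidHom (Int.castAddHom ℝ)

theorem chainExt_eq {n : ℕ} (c : SingularChain ℤ X n) : chainExt c = cext c := rfl

theorem cext_single {n : ℕ} (σ : C(Sx n, X)) (k : ℤ) :
    cext (Finsupp.single σ k) = Finsupp.single σ (k : ℝ) := by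
  simp [cext]

theorem cext_zsmul {n : ℕ} (k : ℤ) (c : SingularChain ℤ X n) :
    cext (k • c) = (k : ℝ) • cext c := by
  rw [map_zsmul, Int.cast_smul_eq_zsmul]

theorem cext_bd {n : ℕ} (c : SingularChain ℤ X (n + 1)) : cext (bd c) = bd (cext c) := by
  have : (cext.comp (bd : SingularChain ℤ X (n + 1) →ₗ[ℤ] _).toAddMonoidHom) =
      (bd : SingularChain ℝ X (n + 1) →ₗ[ℝ] _).toAddMonoidHom.comp cext := by
    apply Finsupp.addHom_ext'
    intro σ
    apply AddMonoidHom.ext_int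
    simp only [AddMonoidHom.comp_apply, LinearMap.toAddMonoidHom_coe,
      Finsupp.singleAddHom_apply, cext_single, Int.cast_one, bd_single, map_sum]
    refine Finset.sum_congr rfl fun i _ => ?_
    simp [cext_single]
  exact DFunLike.congr_fun this c

theorem cext_pf (f : C(X, Y)) {n : ℕ} (c : SingularChain ℤ X n) : cext (pf f c) = pf f (cext c) := by
  have : (cext.comp (pf f : SingularChain ℤ X n →ₗ[ℤ] _).toAddMonoidHom) =
      (pf f : SingularChain ℝ X n →ₗ[ℝ] _).toAddMonoidHom.comp cext := by
    apply Finsupp.addHom_ext'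
    intro σ
    apply AddMonoidHom.ext_int
    simp [cext_single, pf_single]
  exact DFunLike.congr_fun this c

theorem cext_con {A : Set X} {n : ℕ} {c : SingularChain ℤ X n} (hc : c ∈ con ℤ A n) :
    cext c ∈ con ℝ A n := by
  rw [mem_con] at *
  intro σ hσ
  apply hc σ
  simp only [Finsupp.mem_support_iff] at *
  intro h
  apply hσ
  simp [cext, h]

/-! ### Tuple complexes -/

/-- Tuple chains. -/
abbrev T (R : Type) [CommRing R] (V : Type) (k : ℕ) := (Fin (k + 1) → V) →₀ R

section tuples
variable {V V' V'' : Type}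

theorem t_ext {n : ℕ} {P : Type} [AddCommGroup P] [Module R P]
    {f g : T R V n →ₗ[R] P}
    (h : ∀ σ, f (Finsupp.single σ 1) = g (Finsupp.single σ 1)) : f = g :=
  Finsupp.lhom_ext' fun σ => LinearMap.ext_ring (h σ)

/-- boundary of tuples -/
def tbd {k : ℕ} : T R V (k + 1) →ₗ[R] T R V k :=
  Finsupp.linearCombination R fun v =>
    ∑ i : Fin (k + 2), (-1 : R) ^ (i : ℕ) • Finsupp.single (v ∘ i.succAbove) (1 : R)

theorem tbd_single {k : ℕ} (v : Fin (k + 2) → V) :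
    tbd (Finsupp.single v (1 : R)) =
      ∑ i : Fin (k + 2), (-1 : R) ^ (i : ℕ) • Finsupp.single (v ∘ i.succAbove) (1 : R) := by
  simp [tbd]

/-- functoriality -/
def tmap (f : V → V') {k : ℕ} : T R V k →ₗ[R] T R V' k := Finsupp.lmapDomain R R (f ∘ ·)

theorem tmap_single (f : V → V') {k : ℕ} (v : Fin (k + 1) → V) (r : R) :
    tmap f (Finsupp.single v r) = Finsupp.single (f ∘ v) r := by simp [tmap]

theorem tmap_tmap (g : V' → V'') (f : V → V') {k : ℕ} (z : T R V k) :
    tmap g (tmap f z) = tmap (g ∘ f) z := by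
  simp only [tmap, Finsupp.lmapDomain_apply, ← Finsupp.mapDomain_comp]
  rfl

theorem tbd_tmap (f : V → V') {k : ℕ} (z : T R V (k + 1)) : tbd (tmap f z) = tmap f (tbd z) := by
  have : (tbd ∘ₗ tmap f : T R V (k + 1) →ₗ[R] _) = tmap f ∘ₗ tbd := by
    apply t_ext
    intro σ
    simp only [LinearMap.comp_apply, tmap_single, tbd_single, map_sum, map_smul]
    rfl
  exact LinearMap.congr_fun this z

/-- cone -/
def tcone (p : V) {k : ℕ} : T R V k →ₗ[R] T R V (k + 1) :=
  Finsupp.lmapDomain R R (fun v => (Fin.cons p v : Fin (k + 2) → V))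

theorem tcone_single (p : V) {k : ℕ} (v : Fin (k + 1) → V) (r : R) :
    tcone p (Finsupp.single v r) = Finsupp.single (Fin.cons p v : Fin (k + 2) → V) r := by
  simp [tcone]

theorem cons_comp_succAbove (p : V) {k : ℕ} (v : Fin (k + 2) → V) (i : Fin (k + 2)) :
    (Fin.cons p v : Fin (k + 3) → V) ∘ i.succ.succAbove =
      (Fin.cons p (v ∘ i.succAbove) : Fin (k + 2) → V) := by
  funext j
  refine Fin.cases ?_ (fun j => ?_) j <;> simp

theorem tbd_tcone (p : V) {k : ℕ} (z : T R V (k + 1)) :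
    tbd (tcone p z) = z - tcone p (tbd z) := by
  have : (tbd ∘ₗ tcone p : T R V (k + 1) →ₗ[R] _) = LinearMap.id - tcone p ∘ₗ tbd := by
    apply t_ext
    intro v
    simp only [LinearMap.comp_apply, tcone_single, tbd_single, map_sum, map_smul,
      LinearMap.sub_apply, LinearMap.id_apply]
    rw [Fin.sum_univ_succ, sub_eq_add_neg]
    congr 1
    · simp only [Fin.val_zero, pow_zero, one_smul]
      congr 1
    · rw [← Finset.sum_neg_distrib]
      refine Finset.sum_congr rfl fun i _ => ?_
      rw [cons_comp_succAbove, Fin.val_succ, pow_succ]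
      simp
  exact LinearMap.congr_fun this z

/-- augmentation -/
def teps {k : ℕ} : T R V k →ₗ[R] R := Finsupp.linearCombination R fun _ => (1 : R)

theorem teps_single {k : ℕ} (v : Fin (k + 1) → V) (r : R) : teps (Finsupp.single v r) = r := by
  simp [teps]

theorem teps_tmap (f : V → V') {k : ℕ} (z : T R V k) : teps (tmap f z) = teps z := by
  have : (teps ∘ₗ tmap f : T R V k →ₗ[R] _) = teps := by
    apply t_ext
    intro σ
    simp only [LinearMap.comp_apply, tmap_single, teps_single]
  exact LinearMap.congr_fun this z

theorem tbd_tcone_zero (p : V) (z : T R V 0) :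
    tbd (tcone p z) = z - teps z • Finsupp.single (fun _ => p) 1 := by
  have : (tbd ∘ₗ tcone p : T R V 0 →ₗ[R] _) =
      LinearMap.id - teps.smulRight (Finsupp.single (fun _ => p) 1) := by
    apply t_ext
    intro v
    simp only [LinearMap.comp_apply, tcone_single, tbd_single, LinearMap.sub_apply,
      LinearMap.id_apply, LinearMap.smulRight_apply, teps_single, one_smul]
    rw [Fin.sum_univ_two]
    simp only [Fin.val_zero, pow_zero, one_smul, Fin.val_one, pow_one, neg_smul]
    rw [sub_eq_add_neg]
    congr 2
    congr 1
    funext j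
    fin_cases j
    rfl
  exact LinearMap.congr_fun this z

theorem teps_tbd (z : T R V 1) : teps (tbd z) = 0 := by
  have : (teps ∘ₗ tbd : T R V 1 →ₗ[R] _) = 0 := by
    apply t_ext
    intro σ
    simp [tbd_single, teps_single, Fin.sum_univ_two]
  exact LinearMap.congr_fun this z

theorem single_eq_tcone {k : ℕ} (v : Fin (k + 2) → V) :
    Finsupp.single v (1 : R) = tcone (v 0) (Finsupp.single (Fin.tail v) 1) := by
  rw [tcone_single, Fin.cons_self_tail]

theorem tbd_tbd {k : ℕ} : ∀ z : T R V (k + 2), tbd (tbd z) = 0 := by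
  induction k with
  | zero =>
    intro z
    have : (tbd ∘ₗ tbd : T R V 2 →ₗ[R] _) = 0 := by
      apply t_ext
      intro v
      rw [LinearMap.comp_apply, single_eq_tcone, tbd_tcone, map_sub, tbd_tcone_zero, teps_tbd]
      simp
    exact LinearMap.congr_fun this z
  | succ k ih =>
    intro z
    have : (tbd ∘ₗ tbd : T R V (k + 3) →ₗ[R] _) = 0 := by
      apply t_ext
      intro v
      rw [LinearMap.comp_apply, single_eq_tcone, tbd_tcone, map_sub, tbd_tcone, ih]
      simp
    exact LinearMap.congr_fun this z

end tuples

/-- Linear evaluation over index maps, used to deduce simplicial identities. -/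
theorem simplicial_sum {k : ℕ} {P : Type} [AddCommGroup P] [Module R P]
    (F : (Fin (k + 1) → Fin (k + 3)) → P) :
    ∑ i : Fin (k + 3), (-1 : R) ^ (i : ℕ) • ∑ j : Fin (k + 2), (-1 : R) ^ (j : ℕ) •
      F (i.succAbove ∘ j.succAbove) = 0 := by
  have h := congrArg (Finsupp.linearCombination R F)
    (tbd_tbd (Finsupp.single (id : Fin (k + 3) → Fin (k + 3)) (1 : R)))
  simp only [tbd_single, map_sum, map_smul, map_zero, Finsupp.linearCombination_single, one_smul,
    Function.id_comp] at h
  exact h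

/-! ### Simplicial maps, mixing, realization -/

/-- The affine map of simplices induced by a map of vertices. -/
def simpMap {p q : ℕ} (v : Fin (p + 1) → Fin (q + 1)) : C(Sx p, Sx q) where
  toFun x := ⟨fun j => ∑ k : Fin (p + 1), if v k = j then (x : Fin (p + 1) → ℝ) k else 0, by
      refine ⟨fun j => Finset.sum_nonneg fun k _ => ?_, ?_⟩
      · by_cases h : v k = j
        · simpa [h] using x.2.1 k
        · simp [h]
      · rw [Finset.sum_comm]
        simp only [Finset.sum_ite_eq, Finset.mem_univ, if_true]
        exact x.2.2⟩
  continuous_toFun := by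
    apply Continuous.subtype_mk
    apply continuous_pi
    intro j
    apply continuous_finsetSum
    intro k _
    by_cases h : v k = j
    · simp only [h, if_true]
      exact (continuous_apply k).comp continuous_subtype_val
    · simpa [h] using continuous_const

theorem faceMap_eq (n : ℕ) (i : Fin (n + 2)) : faceMap n i = simpMap i.succAbove := rfl

theorem simpMap_apply {p q : ℕ} (v : Fin (p + 1) → Fin (q + 1)) (x : Sx p) (j : Fin (q + 1)) :
    (simpMap v x).1 j = ∑ k : Fin (p + 1), if v k = j then x.1 k else 0 := rfl

/-- weighted sums against a simplicial image -/
theorem simpMap_sum {p q : ℕ} (v : Fin (p + 1) → Fin (q + 1)) (x : Sx p) (f : Fin (q + 1) → ℝ) :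
    ∑ j, (simpMap v x).1 j * f j = ∑ k, x.1 k * f (v k) := by
  simp only [simpMap_apply, Finset.sum_mul, ite_mul, zero_mul]
  rw [Finset.sum_comm]
  simp

theorem simpMap_comp {p q r : ℕ} (w : Fin (q + 1) → Fin (r + 1)) (v : Fin (p + 1) → Fin (q + 1)) :
    (simpMap w).comp (simpMap v) = simpMap (w ∘ v) := by
  ext x j
  show (simpMap w (simpMap v x)).1 j = _
  have := simpMap_sum v x (fun k => if w k = j then 1 else 0)
  simp only [mul_ite, mul_one, mul_zero] at this
  rw [simpMap_apply, this]
  rfl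

theorem simpMap_id {p : ℕ} : simpMap (id : Fin (p + 1) → Fin (p + 1)) = ContinuousMap.id _ := by
  ext x j
  show (simpMap id x).1 j = x.1 j
  simp [simpMap_apply]

theorem face_face {n : ℕ} (i : Fin (n + 3)) (j : Fin (n + 2)) :
    (faceMap (n + 1) i).comp (faceMap n j) = simpMap (i.succAbove ∘ j.succAbove) := by
  rw [faceMap_eq, faceMap_eq, simpMap_comp]

theorem bd_bd {n : ℕ} (c : SingularChain R X (n + 2)) : bd (bd c) = 0 := by
  have : (bd ∘ₗ bd : SingularChain R X (n + 2) →ₗ[R] _) = 0 := by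
    apply ch_ext
    intro σ
    simp only [LinearMap.comp_apply, bd_single, map_sum, map_smul, ContinuousMap.comp_assoc,
      face_face]
    exact simplicial_sum (R := R) fun v => Finsupp.single (σ.comp (simpMap v)) (1 : R)
  exact LinearMap.congr_fun this c

@[fun_prop]
theorem cont_coord {p : ℕ} (j : Fin (p + 1)) : Continuous fun x : Sx p => x.1 j :=
  (continuous_apply j).comp continuous_subtype_val

/-- Spaces with affine combinations. -/
class Mix (K : Type) [TopologicalSpace K] where
  mix : ∀ {k : ℕ}, (Fin (k + 1) → K) → C(Sx k, K)
  mix_simp : ∀ {k l : ℕ} (v : Fin (l + 1) → K) (w : Fin (k + 1) → Fin (l + 1)),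
    (mix v).comp (simpMap w) = mix (v ∘ w)

open Mix

instance mixI : Mix unitInterval where
  mix {k} v := ⟨fun x => ⟨∑ j, x.1 j * (v j : ℝ), by
      refine ⟨Finset.sum_nonneg fun j _ => mul_nonneg (x.2.1 j) (v j).2.1, ?_⟩
      calc ∑ j, x.1 j * (v j : ℝ) ≤ ∑ j, x.1 j :=
            Finset.sum_le_sum fun j _ => mul_le_of_le_one_right (x.2.1 j) (v j).2.2
        _ = 1 := x.2.2⟩, by refine Continuous.subtype_mk ?_ _; fun_prop⟩
  mix_simp v w := by
    ext x
    exact simpMap_sum w x fun j => (v j : ℝ)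

instance mixSx (p : ℕ) : Mix (Sx p) where
  mix {k} v := ⟨fun x => ⟨fun i => ∑ j, x.1 j * (v j).1 i, by
      refine ⟨fun i => Finset.sum_nonneg fun j _ => mul_nonneg (x.2.1 j) ((v j).2.1 i), ?_⟩
      rw [Finset.sum_comm]
      simp only [← Finset.mul_sum]
      have : ∀ j, ∑ i, (v j).1 i = 1 := fun j => (v j).2.2
      simp only [this, mul_one]
      exact x.2.2⟩, by refine Continuous.subtype_mk ?_ _; fun_prop⟩
  mix_simp v w := by
    ext x i
    exact simpMap_sum w x fun j => (v j).1 i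

instance mixProd {K L : Type} [TopologicalSpace K] [TopologicalSpace L] [Mix K] [Mix L] :
    Mix (K × L) where
  mix v := (mix (fun i => (v i).1)).prodMk (mix (fun i => (v i).2))
  mix_simp v w := by
    have h1 := mix_simp (fun i => (v i).1) w
    have h2 := mix_simp (fun i => (v i).2) w
    ext x
    · exact DFunLike.congr_fun h1 x
    · exact DFunLike.congr_fun h2 x

theorem mixSx_apply {p k : ℕ} (v : Fin (k + 1) → Sx p) (x : Sx k) (i) :
    (mix v x).1 i = ∑ j, x.1 j * (v j).1 i := rfl

theorem mixI_apply {k : ℕ} (v : Fin (k + 1) → unitInterval) (x : Sx k) :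
    ((mix v x : unitInterval) : ℝ) = ∑ j, x.1 j * (v j : ℝ) := rfl

/-- Affine maps. -/
def MixHom {K L : Type} [TopologicalSpace K] [TopologicalSpace L] [Mix K] [Mix L] (f : C(K, L)) :
    Prop := ∀ {k : ℕ} (v : Fin (k + 1) → K), f.comp (mix v) = mix (f ∘ v)

theorem mixHom_simp {p q : ℕ} (w : Fin (p + 1) → Fin (q + 1)) : MixHom (simpMap w) := by
  intro k v
  ext x i
  show (simpMap w (mix v x)).1 i = ∑ j, x.1 j * (simpMap w (v j)).1 i
  simp only [simpMap_apply, mixSx_apply, Finset.mul_sum]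
  rw [Finset.sum_comm]
  refine Finset.sum_congr rfl fun j _ => ?_
  split_ifs <;> simp

theorem mixHom_prodMap {K L K' L' : Type} [TopologicalSpace K] [TopologicalSpace L] [Mix K] [Mix L]
    [TopologicalSpace K'] [TopologicalSpace L'] [Mix K'] [Mix L'] {f : C(K, K')} {g : C(L, L')}
    (hf : MixHom f) (hg : MixHom g) : MixHom (f.prodMap g) := by
  intro k v
  have h1 := hf (fun i => (v i).1)
  have h2 := hg (fun i => (v i).2)
  ext x
  · exact DFunLike.congr_fun h1 x
  · exact DFunLike.congr_fun h2 x

theorem mixHom_id {K : Type} [TopologicalSpace K] [Mix K] : MixHom (ContinuousMap.id K) := by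
  intro k v; rfl

/-- mix is an affine map -/
theorem mixHom_mix_Sx {p k : ℕ} (v : Fin (k + 1) → Sx p) : MixHom (mix v) := by
  intro l w
  ext x i
  show (mix v (mix w x)).1 i = ∑ j, x.1 j * (mix v (w j)).1 i
  simp only [mixSx_apply, Finset.mul_sum, Finset.sum_mul]
  rw [Finset.sum_comm]
  exact Finset.sum_congr rfl fun j _ => Finset.sum_congr rfl fun j _ => by ring

/-- vertices -/
def vtx {p : ℕ} (i : Fin (p + 1)) : Sx p := ⟨Pi.single i 1, single_mem_stdSimplex ℝ i⟩

theorem simpMap_vtx {p q : ℕ} (w : Fin (p + 1) → Fin (q + 1)) (i) :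
    simpMap w (vtx i) = vtx (w i) := by
  ext j
  show (simpMap w (vtx i)).1 j = _
  rw [simpMap_apply, Finset.sum_eq_single i]
  · simp [vtx, Pi.single_apply, eq_comm]
  · intro b _ hb
    simp [vtx, hb]
  · simp

theorem mix_vtx {p k : ℕ} (w : Fin (k + 1) → Fin (p + 1)) :
    mix (fun i => vtx (w i)) = simpMap w := by
  ext x j
  show ∑ k, x.1 k * (vtx (w k)).1 j = (simpMap w x).1 j
  simp [simpMap_apply, vtx, Pi.single_apply, eq_comm]

section real
variable {K L : Type} [TopologicalSpace K] [TopologicalSpace L] [Mix K] [Mix L]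

/-- realization of tuples as affine singular simplices -/
def real {k : ℕ} : T R K k →ₗ[R] SingularChain R K k := Finsupp.lmapDomain R R mix

theorem real_single {k : ℕ} (v : Fin (k + 1) → K) (r : R) :
    real (Finsupp.single v r) = Finsupp.single (mix v) r := by simp [real]

theorem bd_real {k : ℕ} (z : T R K (k + 1)) : bd (real z) = real (tbd z) := by
  have : (bd ∘ₗ real : T R K (k + 1) →ₗ[R] _) = real ∘ₗ tbd := by
    apply t_ext
    intro v
    simp only [LinearMap.comp_apply, real_single, bd_single, tbd_single, map_sum, map_smul,
      faceMap_eq, mix_simp]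
  exact LinearMap.congr_fun this z

theorem pf_real {f : C(K, L)} (hf : MixHom f) {k : ℕ} (z : T R K k) :
    pf f (real z) = real (tmap f z) := by
  have : (pf f ∘ₗ real : T R K k →ₗ[R] _) = real ∘ₗ tmap f := by
    apply t_ext
    intro v
    simp only [LinearMap.comp_apply, real_single, pf_single, tmap_single, hf v]
  exact LinearMap.congr_fun this z

end real

/-! ### Acyclic models -/

section models
variable {K : ℕ → Type} (b : ∀ p, K p)
  (kmap : ∀ {p q : ℕ}, (Fin (p + 1) → Fin (q + 1)) → K p → K q)
  (u : ∀ k, T R (K k) k)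

/-- alternating sum of the face maps of a model -/
def mface {p k : ℕ} : T R (K p) k →ₗ[R] T R (K (p + 1)) k :=
  ∑ i : Fin (p + 2), (-1 : R) ^ (i : ℕ) • tmap (kmap i.succAbove)

theorem mface_apply {p k : ℕ} (z : T R (K p) k) : mface kmap z =
    ∑ i : Fin (p + 2), (-1 : R) ^ (i : ℕ) • tmap (kmap i.succAbove) z := by
  simp [mface]

theorem mface_mface (hk : ∀ {p q r : ℕ} (w : Fin (q + 1) → Fin (r + 1))
      (v : Fin (p + 1) → Fin (q + 1)), kmap w ∘ kmap v = kmap (w ∘ v))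
    {p k : ℕ} (z : T R (K p) k) : mface kmap (mface kmap z) = 0 := by
  rw [mface_apply kmap (mface kmap z)]
  simp only [mface_apply kmap z, map_sum, map_smul, tmap_tmap, hk]
  exact simplicial_sum (R := R) fun v => tmap (kmap v) z

theorem tbd_mface {p k : ℕ} (z : T R (K p) (k + 1)) :
    tbd (mface kmap z) = mface kmap (tbd z) := by
  simp only [mface_apply, map_sum, map_smul, tbd_tmap]

/-- The model solution. -/
def msol : ∀ k, T R (K k) (k + 1)
  | 0 => tcone (b 0) (u 0)
  | k + 1 => tcone (b (k + 1)) (u (k + 1) - mface kmap (msol k))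

theorem tbd_msol_zero (h0 : teps (u 0) = 0) : tbd (msol b kmap u 0) = u 0 := by
  rw [msol, tbd_tcone_zero, h0]; simp

theorem tbd_msol (hk : ∀ {p q r : ℕ} (w : Fin (q + 1) → Fin (r + 1))
      (v : Fin (p + 1) → Fin (q + 1)), kmap w ∘ kmap v = kmap (w ∘ v))
    (h0 : teps (u 0) = 0) (hu : ∀ k, tbd (u (k + 1)) = mface kmap (u k)) (k : ℕ) :
    tbd (msol b kmap u (k + 1)) = u (k + 1) - mface kmap (msol b kmap u k) := by
  rw [msol, tbd_tcone]
  suffices h : tbd (u (k + 1) - mface kmap (msol b kmap u k)) = 0 by rw [h]; simp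
  rw [map_sub, hu, tbd_mface]
  cases k with
  | zero => rw [tbd_msol_zero b kmap u h0, sub_self]
  | succ k => rw [tbd_msol hk h0 hu k, map_sub, mface_mface kmap hk]; simp

end models

/-! ### Natural operators -/

/-- The natural operator determined by a tuple chain on the standard simplex. -/
def op {k j : ℕ} (t : T R (Sx k) j) : SingularChain R X k →ₗ[R] SingularChain R X j :=
  Finsupp.linearCombination R fun σ => pf σ (real t)

theorem op_single {k j : ℕ} (t : T R (Sx k) j) (σ : C(Sx k, X)) :
    op t (Finsupp.single σ 1) = pf σ (real t) := by simp [op]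

theorem op_con {A : Set X} {k j : ℕ} (t : T R (Sx k) j) {c : SingularChain R X k}
    (hc : c ∈ con R A k) : op t c ∈ con R A j := by
  refine map_con (op t) _ (fun σ hσ => ?_) hc
  rw [op_single]
  exact pf_con (A := Set.univ) (fun x _ => hσ x) (con_univ _)

theorem op_pf (f : C(X, Y)) {k j : ℕ} (t : T R (Sx k) j) (c : SingularChain R X k) :
    op t (pf f c) = pf f (op t c) := by
  have : (op t ∘ₗ pf f : SingularChain R X k →ₗ[R] _) = pf f ∘ₗ op t := by
    apply ch_ext
    intro σ
    simp only [LinearMap.comp_apply, op_single, pf_single, pf_pf]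
  exact LinearMap.congr_fun this c

theorem bd_op {k j : ℕ} (t : T R (Sx k) (j + 1)) (c : SingularChain R X k) :
    bd (op t c) = op (tbd t) c := by
  have : (bd ∘ₗ op t : SingularChain R X k →ₗ[R] _) = op (tbd t) := by
    apply ch_ext
    intro σ
    simp only [LinearMap.comp_apply, op_single, bd_pf, bd_real]
  exact LinearMap.congr_fun this c

/-- the simplicial structure of the standard simplices as a model -/
def sk {p q : ℕ} (v : Fin (p + 1) → Fin (q + 1)) : Sx p → Sx q := simpMap v

theorem sk_sk {p q r : ℕ} (w : Fin (q + 1) → Fin (r + 1)) (v : Fin (p + 1) → Fin (q + 1)) :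
    sk w ∘ sk v = sk (w ∘ v) := by
  funext x; exact DFunLike.congr_fun (simpMap_comp w v) x

theorem op_bd {k j : ℕ} (t : T R (Sx k) j) (c : SingularChain R X (k + 1)) :
    op t (bd c) = op (mface sk t) c := by
  have : (op t ∘ₗ bd : SingularChain R X (k + 1) →ₗ[R] _) = op (mface sk t) := by
    apply ch_ext
    intro σ
    simp only [LinearMap.comp_apply, op_single, bd_single, map_sum, map_smul, mface_apply]
    refine Finset.sum_congr rfl fun i _ => ?_
    congr 1
    rw [← pf_pf, faceMap_eq, pf_real (mixHom_simp _)]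
    rfl
  exact LinearMap.congr_fun this c

theorem op_add {k j : ℕ} (s t : T R (Sx k) j) (c : SingularChain R X k) :
    op (s + t) c = op s c + op t c := by
  have : (op (s + t) : SingularChain R X k →ₗ[R] _) = op s + op t := by
    apply ch_ext
    intro σ
    simp only [op_single, map_add, LinearMap.add_apply]
  exact LinearMap.congr_fun this c

theorem op_sub {k j : ℕ} (s t : T R (Sx k) j) (c : SingularChain R X k) :
    op (s - t) c = op s c - op t c := by
  have : (op (s - t) : SingularChain R X k →ₗ[R] _) = op s - op t := by
    apply ch_ext
    intro σ
    simp only [op_single, map_sub, LinearMap.sub_apply]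
  exact LinearMap.congr_fun this c

/-- The identity simplex. -/
def iot (k : ℕ) : T R (Sx k) k := Finsupp.single vtx 1

theorem op_iot {k : ℕ} (c : SingularChain R X k) : op (iot k) c = c := by
  have : (op (iot k) : SingularChain R X k →ₗ[R] _) = LinearMap.id := by
    apply ch_ext
    intro σ
    simp only [op_single, LinearMap.id_apply, iot, real_single, pf_single]
    have := mix_vtx (id : Fin (k + 1) → Fin (k + 1))
    rw [simpMap_id] at this
    simp only [id] at this
    rw [this, ContinuousMap.comp_id]
  exact LinearMap.congr_fun this c

theorem tbd_iot (k : ℕ) : tbd (iot (k + 1) : T R _ _) = mface sk (iot k) := by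
  simp only [iot, tbd_single, mface_apply, tmap_single]
  refine Finset.sum_congr rfl fun i _ => ?_
  congr 2
  funext j
  exact (simpMap_vtx _ _).symm

/-- Package: a natural chain map homotopic to the identity. -/
theorem op_homotopy (s : ∀ k, T R (Sx k) k) (h0 : s 0 = iot 0)
    (hs : ∀ k, tbd (s (k + 1)) = mface sk (s k)) :
    ∃ t : ∀ k, T R (Sx k) (k + 1), (∀ k, tbd (t (k + 1)) = s (k + 1) - iot (k + 1) - mface sk (t k)) ∧
      tbd (t 0) = 0 := by
  refine ⟨msol (fun _ => vtx 0) sk (fun k => s k - iot k), fun k => ?_, ?_⟩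
  · rw [tbd_msol _ _ _ (fun w v => sk_sk w v) (by simp [h0])]
    intro k
    rw [map_sub, map_sub, hs, tbd_iot]
  · rw [tbd_msol_zero _ _ _ (by simp [h0]), h0, sub_self]

/-! ### Prisms and homotopies -/

/-- prism model maps -/
def prk {p q : ℕ} (v : Fin (p + 1) → Fin (q + 1)) : Sx p × unitInterval → Sx q × unitInterval :=
  (simpMap v).prodMap (ContinuousMap.id _)

/-- end of the prism model -/
def pre (s : unitInterval) (k : ℕ) : T R (Sx k × unitInterval) k :=
  Finsupp.single (fun i => (vtx i, s)) 1

theorem tbd_pre (s : unitInterval) (k : ℕ) :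
    tbd (pre s (k + 1) : T R _ _) = mface (fun {_ _} => prk) (pre s k) := by
  simp only [pre, tbd_single, mface_apply, tmap_single]
  refine Finset.sum_congr rfl fun i _ => ?_
  congr 2
  funext j
  exact Prod.ext (simpMap_vtx _ _).symm rfl

/-- prism tuples -/
def prT (k : ℕ) : T R (Sx k × unitInterval) (k + 1) :=
  msol (fun _ => (vtx 0, 0)) prk (fun k => pre 1 k - pre 0 k) k

theorem prk_prk {p q r : ℕ} (w : Fin (q + 1) → Fin (r + 1)) (v : Fin (p + 1) → Fin (q + 1)) :
    prk w ∘ prk v = prk (w ∘ v) := by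
  funext x; exact Prod.ext (DFunLike.congr_fun (simpMap_comp w v) x.1) rfl

theorem tbd_prT (k : ℕ) : tbd (prT (k + 1) : T R _ _) =
    pre 1 (k + 1) - pre 0 (k + 1) - mface (fun {_ _} => prk) (prT k) := by
  rw [prT, tbd_msol _ _ _ (fun w v => prk_prk w v)]
  · rfl
  · simp [pre, teps_single]
  · intro k
    rw [map_sub, map_sub, tbd_pre, tbd_pre]

theorem tbd_prT_zero : tbd (prT 0 : T R _ _) = pre 1 0 - pre 0 0 := by
  exact tbd_msol_zero (fun _ => (vtx 0, 0)) prk (fun k => pre 1 k - pre 0 k)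
    (by simp [pre, teps_single])

/-- slice of a homotopy -/
def slice {Z : Type} [TopologicalSpace Z] (H : C(Z × unitInterval, Y)) (s : unitInterval) : C(Z, Y) :=
  H.comp ((ContinuousMap.id Z).prodMk (ContinuousMap.const Z s))

theorem slice_apply {Z : Type} [TopologicalSpace Z] (H : C(Z × unitInterval, Y)) (s : unitInterval)
    (z : Z) : slice H s z = H (z, s) := rfl

/-- the chain of a singular prism -/
def prism {k : ℕ} (H : C(Sx k × unitInterval, Y)) : SingularChain R Y (k + 1) :=
  pf H (real (prT k))

theorem pf_pre {k : ℕ} (H : C(Sx k × unitInterval, Y)) (s : unitInterval) :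
    pf H (real (pre s k : T R _ _)) = Finsupp.single (slice H s) 1 := by
  rw [pre, real_single, pf_single]
  congr 1
  have := mix_vtx (id : Fin (k + 1) → Fin (k + 1))
  rw [simpMap_id] at this
  simp only [id] at this
  ext x
  show H _ = H _
  congr 1
  refine Prod.ext (DFunLike.congr_fun this x) ?_
  ext
  show ∑ j, x.1 j * (s : ℝ) = s
  rw [← Finset.sum_mul]
  have : ∑ j, x.1 j = 1 := x.2.2
  rw [this, one_mul]

/-- face of a prism -/
def pface {k : ℕ} (H : C(Sx (k + 1) × unitInterval, Y)) (i : Fin (k + 2)) :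
    C(Sx k × unitInterval, Y) := H.comp ((faceMap k i).prodMap (ContinuousMap.id _))

theorem bd_prism {k : ℕ} (H : C(Sx (k + 1) × unitInterval, Y)) :
    bd (prism H : SingularChain R Y (k + 2)) = Finsupp.single (slice H 1) 1 -
      Finsupp.single (slice H 0) 1 - ∑ i : Fin (k + 2), (-1 : R) ^ (i : ℕ) • prism (pface H i) := by
  rw [prism, bd_pf, bd_real, tbd_prT, map_sub, map_sub, map_sub, map_sub, pf_pre, pf_pre]
  congr 1
  simp only [mface_apply, map_sum, map_smul]
  refine Finset.sum_congr rfl fun i _ => ?_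
  rw [prism, pface, ← pf_pf, faceMap_eq, pf_real (mixHom_prodMap (mixHom_simp _) mixHom_id)]
  rfl

theorem bd_prism_zero (H : C(Sx 0 × unitInterval, Y)) :
    bd (prism H : SingularChain R Y 1) = Finsupp.single (slice H 1) 1 -
      Finsupp.single (slice H 0) 1 := by
  rw [prism, bd_pf, bd_real, tbd_prT_zero, map_sub, map_sub, pf_pre, pf_pre]

theorem prism_con {A : Set Y} {k : ℕ} {H : C(Sx k × unitInterval, Y)} (h : ∀ x, H x ∈ A) :
    prism H ∈ con R A (k + 1) :=
  pf_con (A := Set.univ) (fun x _ => h x) (con_univ _)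

/-- homotopy operator -/
def hop (F : C(X × unitInterval, Y)) {k : ℕ} : SingularChain R X k →ₗ[R] SingularChain R Y (k + 1) :=
  Finsupp.linearCombination R fun σ => prism (F.comp (σ.prodMap (ContinuousMap.id _)))

theorem hop_single (F : C(X × unitInterval, Y)) {k : ℕ} (σ : C(Sx k, X)) :
    hop F (Finsupp.single σ (1 : R)) = prism (F.comp (σ.prodMap (ContinuousMap.id _))) := by
  simp [hop]

theorem bd_hop (F : C(X × unitInterval, Y)) {k : ℕ} (c : SingularChain R X (k + 1)) :
    bd (hop F c) = pf (slice F 1) c - pf (slice F 0) c - hop F (bd c) := by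
  have : (bd ∘ₗ hop F : SingularChain R X (k + 1) →ₗ[R] _) =
      pf (slice F 1) - pf (slice F 0) - hop F ∘ₗ bd := by
    apply ch_ext
    intro σ
    simp only [LinearMap.comp_apply, hop_single, LinearMap.sub_apply, bd_prism, bd_single,
      map_sum, map_smul, pf_single]
    rfl
  exact LinearMap.congr_fun this c

theorem bd_hop_zero (F : C(X × unitInterval, Y)) (c : SingularChain R X 0) :
    bd (hop F c) = pf (slice F 1) c - pf (slice F 0) c := by
  have : (bd ∘ₗ hop F : SingularChain R X 0 →ₗ[R] _) =
      pf (slice F 1) - pf (slice F 0) := by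
    apply ch_ext
    intro σ
    simp only [LinearMap.comp_apply, hop_single, LinearMap.sub_apply, bd_prism_zero, pf_single]
    rfl
  exact LinearMap.congr_fun this c

theorem hop_con {A : Set X} {B : Set Y} {F : C(X × unitInterval, Y)}
    (h : ∀ x ∈ A, ∀ s, F (x, s) ∈ B) {k : ℕ} {c : SingularChain R X k} (hc : c ∈ con R A k) :
    hop F c ∈ con R B (k + 1) := by
  refine map_con (hop F) _ (fun σ hσ => ?_) hc
  rw [hop_single]
  exact prism_con fun x => h _ (hσ _) _

/-! ### Subdivision -/

/-- barycenter -/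
def bary (k : ℕ) : Sx k := ⟨fun _ => (1 : ℝ) / (k + 1), by
  refine ⟨fun _ => by positivity, ?_⟩
  simp
  field_simp⟩

/-- subdivision tuples -/
def sdT : ∀ k, T R (Sx k) k
  | 0 => iot 0
  | k + 1 => tcone (bary (k + 1)) (mface sk (sdT k))

theorem tbd_sdT (k : ℕ) : tbd (sdT (k + 1) : T R _ _) = mface sk (sdT k) := by
  cases k with
  | zero =>
    have : tbd (sdT (0 + 1) : T R _ _) = tbd (tcone (bary 1) (mface sk (sdT 0))) := rfl
    rw [this, tbd_tcone_zero]
    simp [mface_apply, sdT, iot, tmap_single, teps_single, Fin.sum_univ_two]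
  | succ k =>
    rw [sdT, tbd_tcone, tbd_mface, tbd_sdT k, mface_mface _ (fun w v => sk_sk w v)]
    simp

/-- tuples all of whose pairs of vertices have overlapping supports -/
def Ovl {k j : ℕ} (v : Fin (j + 1) → Sx k) : Prop := ∀ a b, ∃ i, 0 < (v a).1 i ∧ 0 < (v b).1 i

theorem tmap_support {V V' : Type} {f : V → V'} {k : ℕ} {z : T R V k} {w} (h : w ∈ (tmap f z).support) :
    ∃ v ∈ z.support, w = f ∘ v := by
  classical
  have := Finsupp.mapDomain_support (f := (f ∘ · : (Fin (k + 1) → V) → _)) (s := z) h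
  obtain ⟨v, hv, rfl⟩ := Finset.mem_image.1 this
  exact ⟨v, hv, rfl⟩

theorem tcone_support {V : Type} {p : V} {k : ℕ} {z : T R V k} {w} (h : w ∈ (tcone p z).support) :
    ∃ v ∈ z.support, w = (Fin.cons p v : Fin (k + 2) → V) := by
  classical
  have := Finsupp.mapDomain_support (f := fun v => (Fin.cons p v : Fin (k + 2) → V)) (s := z) h
  obtain ⟨v, hv, rfl⟩ := Finset.mem_image.1 this
  exact ⟨v, hv, rfl⟩

theorem mface_support {K : ℕ → Type} {kmap : ∀ {p q : ℕ}, (Fin (p + 1) → Fin (q + 1)) → K p → K q}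
    {p k : ℕ} {z : T R (K p) k} {w} (h : w ∈ (mface kmap z).support) :
    ∃ v ∈ z.support, ∃ i : Fin (p + 2), w = kmap i.succAbove ∘ v := by
  classical
  rw [mface_apply] at h
  have := Finsupp.support_finsetSum h
  simp only [Finset.mem_biUnion, Finset.mem_univ, true_and] at this
  obtain ⟨i, hi⟩ := this
  obtain ⟨v, hv, rfl⟩ := tmap_support (Finsupp.support_smul hi)
  exact ⟨v, hv, i, rfl⟩

theorem exists_pos {k : ℕ} (x : Sx k) : ∃ i, 0 < x.1 i := by
  by_contra! h
  have h1 : ∑ i, x.1 i = 1 := x.2.2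
  have : ∑ i, x.1 i ≤ 0 := Finset.sum_nonpos fun i _ => h i
  linarith

theorem simpMap_pos {p q : ℕ} (v : Fin (p + 1) → Fin (q + 1)) (x : Sx p) {i} (h : 0 < x.1 i) :
    0 < (simpMap v x).1 (v i) := by
  rw [simpMap_apply]
  refine lt_of_lt_of_le h ?_
  have := Finset.single_le_sum (f := fun k => if v k = v i then x.1 k else 0) (s := Finset.univ)
    (fun k _ => by split_ifs; exacts [x.2.1 k, le_rfl]) (Finset.mem_univ i)
  simpa using this

theorem ovl_sdT (k : ℕ) : ∀ v ∈ (sdT k : T R (Sx k) k).support, Ovl v := by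
  induction k with
  | zero =>
    intro v hv a b
    have : a = b := Subsingleton.elim (α := Fin 1) _ _
    subst this
    obtain ⟨i, hi⟩ := exists_pos (v a)
    exact ⟨i, hi, hi⟩
  | succ k ih =>
    intro v hv
    rw [sdT] at hv
    obtain ⟨w, hw, rfl⟩ := tcone_support hv
    obtain ⟨w, hw', i, rfl⟩ := mface_support hw
    have hb : ∀ i, 0 < (bary (k + 1)).1 i := fun i => by
      show (0 : ℝ) < 1 / _
      positivity
    intro a b
    refine Fin.cases ?_ (fun a => ?_) a <;> refine Fin.cases ?_ (fun b => ?_) b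
    · exact ⟨0, hb _, hb _⟩
    · obtain ⟨j, hj⟩ := exists_pos (sk i.succAbove (w b))
      exact ⟨j, by simpa using hb j, by simpa using hj⟩
    · obtain ⟨j, hj⟩ := exists_pos (sk i.succAbove (w a))
      exact ⟨j, by simpa using hj, by simpa using hb j⟩
    · obtain ⟨j, h1, h2⟩ := ih w hw' a b
      refine ⟨i.succAbove j, ?_, ?_⟩
      · simpa [sk] using simpMap_pos i.succAbove (w a) h1
      · simpa [sk] using simpMap_pos i.succAbove (w b) h2

/-! ### Small simplices -/

open Mix in
theorem contract_coord {j : ℕ} (p q : Sx j) (v : Fin (j + 1) → ℝ) (D : ℝ)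
    (hv : ∀ a b, v a - v b ≤ D) :
    ∑ i, p.1 i * v i - ∑ i, q.1 i * v i ≤ (1 - ∑ i, min (p.1 i) (q.1 i)) * D := by
  obtain ⟨a, -, ha⟩ := Finset.exists_min_image (Finset.univ : Finset (Fin (j + 1))) v ⟨0, by simp⟩
  have hp : ∑ i, p.1 i = 1 := p.2.2
  have hq : ∑ i, q.1 i = 1 := q.2.2
  have e1 : ∑ i, p.1 i * v i - ∑ i, q.1 i * v i = ∑ i, (p.1 i - q.1 i) * (v i - v a) := by
    have : ∀ i, (p.1 i - q.1 i) * (v i - v a) =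
      p.1 i * v i - q.1 i * v i - (p.1 i * v a - q.1 i * v a) := fun i => by ring
    simp only [this, Finset.sum_sub_distrib, ← Finset.sum_mul, hp, hq]
    ring
  have e2 : (1 - ∑ i, min (p.1 i) (q.1 i)) * D = ∑ i, (p.1 i - min (p.1 i) (q.1 i)) * D := by
    rw [← Finset.sum_mul, Finset.sum_sub_distrib, hp]
  rw [e1, e2]
  refine Finset.sum_le_sum fun i _ => ?_
  have h1 := ha i (Finset.mem_univ i)
  have h2 := hv i a
  calc (p.1 i - q.1 i) * (v i - v a) ≤ (p.1 i - min (p.1 i) (q.1 i)) * (v i - v a) := by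
        refine mul_le_mul_of_nonneg_right ?_ (by linarith)
        linarith [min_le_right (p.1 i) (q.1 i)]
    _ ≤ _ := by
        refine mul_le_mul_of_nonneg_left h2 ?_
        linarith [min_le_left (p.1 i) (q.1 i)]

open Mix in
/-- diameter bound for tuples -/
def DiamLE {k j : ℕ} (v : Fin (j + 1) → Sx k) (D : ℝ) : Prop := ∀ a b i, (v a).1 i - (v b).1 i ≤ D

open Mix in
theorem sd_contract (k : ℕ) : ∃ ρ : ℝ, 0 ≤ ρ ∧ ρ < 1 ∧ ∀ w ∈ (sdT k : T R (Sx k) k).support,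
    ∀ {m : ℕ} (v : Fin (k + 1) → Sx m) (D : ℝ), 0 ≤ D → DiamLE v D → DiamLE (mix v ∘ w) (ρ * D) := by
  classical
  let f : (Fin (k + 1) → Sx k) × Fin (k + 1) × Fin (k + 1) → ℝ :=
    fun x => 1 - ∑ i, min ((x.1 x.2.1).1 i) ((x.1 x.2.2).1 i)
  let S := ((sdT k : T R (Sx k) k).support ×ˢ (Finset.univ : Finset (Fin (k + 1) × Fin (k + 1))))
  have hf : ∀ x ∈ S, f x < 1 := by
    rintro ⟨w, a, b⟩ hx
    have hw : w ∈ (sdT k : T R (Sx k) k).support := (Finset.mem_product.1 hx).1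
    obtain ⟨i, h1, h2⟩ := ovl_sdT k w hw a b
    have : 0 < ∑ i, min ((w a).1 i) ((w b).1 i) :=
      Finset.sum_pos' (fun i _ => le_min ((w a).2.1 i) ((w b).2.1 i)) ⟨i, by simp, lt_min h1 h2⟩
    show 1 - _ < _
    linarith
  have : ∃ ρ : ℝ, 0 ≤ ρ ∧ ρ < 1 ∧ ∀ x ∈ S, f x ≤ ρ := by
    rcases S.eq_empty_or_nonempty with h | h
    · exact ⟨0, le_rfl, one_pos, by simp [h]⟩
    · obtain ⟨x, hx, hm⟩ := Finset.exists_max_image S f h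
      exact ⟨max 0 (f x), le_max_left _ _, max_lt one_pos (hf x hx),
        fun y hy => (hm y hy).trans (le_max_right _ _)⟩
  obtain ⟨ρ, h0, h1, h⟩ := this
  refine ⟨ρ, h0, h1, fun w hw m v D hD hv a b i => ?_⟩
  have := contract_coord (w a) (w b) (fun j => (v j).1 i) D fun a b => hv a b i
  refine this.trans ?_
  gcongr
  exact h (w, a, b) (by simp only [S, Finset.mem_product, Finset.mem_univ, and_true]; exact hw)

open Mix in
/-- chains of small affine pieces of `σ` -/
def sml (R : Type) [CommRing R] {k : ℕ} (σ : C(Sx k, X)) (D : ℝ) : Submodule R (SingularChain R X k) :=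
  Submodule.span R {c | ∃ v : Fin (k + 1) → Sx k, DiamLE v D ∧ c = Finsupp.single (σ.comp (mix v)) 1}

open Mix in
theorem op_sml {k : ℕ} (t : T R (Sx k) k) (σ : C(Sx k, X)) {D D' : ℝ}
    (h : ∀ w ∈ t.support, ∀ v : Fin (k + 1) → Sx k, DiamLE v D → DiamLE (mix v ∘ w) D')
    {c : SingularChain R X k} (hc : c ∈ sml R σ D) : op t c ∈ sml R σ D' := by
  have : sml R σ D ≤ (sml R σ D').comap (op t) := by
    rw [sml, Submodule.span_le]
    rintro _ ⟨v, hv, rfl⟩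
    show op t (Finsupp.single (σ.comp (mix v)) 1) ∈ sml R σ D'
    rw [op_single, ← pf_pf σ (mix v), pf_real (mixHom_mix_Sx v)]
    generalize hz : tmap (mix v : Sx k → Sx k) t = z
    rw [← Finsupp.sum_single z, Finsupp.sum, map_sum, map_sum]
    refine Submodule.sum_mem _ fun w hw => ?_
    rw [← hz] at hw
    obtain ⟨w, hw', rfl⟩ := tmap_support hw
    rw [real_single, pf_single, ← mul_one (z _), ← smul_eq_mul,
      ← Finsupp.smul_single]
    exact Submodule.smul_mem _ _ (Submodule.subset_span ⟨_, h w hw' v hv, rfl⟩)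
  exact this hc

/-- iterated subdivision -/
def sdN (N : ℕ) {k : ℕ} : SingularChain R X k →ₗ[R] SingularChain R X k := (op (sdT k)) ^ N

theorem sdN_succ (N : ℕ) {k : ℕ} (c : SingularChain R X k) :
    sdN (N + 1) c = op (sdT k) (sdN N c) := by
  rw [sdN, pow_succ']; rfl

theorem sdN_succ' (N : ℕ) {k : ℕ} (c : SingularChain R X k) :
    sdN (N + 1) c = sdN N (op (sdT k) c) := by
  rw [sdN, pow_succ]; rfl

theorem sdN_zero {k : ℕ} (c : SingularChain R X k) : sdN 0 c = c := rfl

theorem sdN_con {A : Set X} {k : ℕ} (N : ℕ) {c : SingularChain R X k} (hc : c ∈ con R A k) :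
    sdN N c ∈ con R A k := by
  induction N with
  | zero => exact hc
  | succ N ih => rw [sdN_succ]; exact op_con _ ih

theorem bd_sdN {k : ℕ} (N : ℕ) (c : SingularChain R X (k + 1)) : bd (sdN N c) = sdN N (bd c) := by
  induction N with
  | zero => rfl
  | succ N ih => rw [sdN_succ, sdN_succ, bd_op, tbd_sdT, ← op_bd, ih]

theorem sdN_pf (f : C(X, Y)) {k : ℕ} (N : ℕ) (c : SingularChain R X k) :
    sdN N (pf f c) = pf f (sdN N c) := by
  induction N with
  | zero => rfl
  | succ N ih => rw [sdN_succ, sdN_succ, ih, op_pf]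

/-- homotopy tuples for the subdivision -/
def sdH (k : ℕ) : T R (Sx k) (k + 1) := (op_homotopy (sdT (R := R)) rfl tbd_sdT).choose k

/-- homotopy for iterated subdivision -/
def sdD (N : ℕ) {k : ℕ} : SingularChain R X k →ₗ[R] SingularChain R X (k + 1) :=
  ∑ i ∈ Finset.range N, (op (sdH k)) ∘ₗ sdN i

theorem sdD_con {A : Set X} {k : ℕ} (N : ℕ) {c : SingularChain R X k} (hc : c ∈ con R A k) :
    sdD N c ∈ con R A (k + 1) := by
  rw [sdD, LinearMap.sum_apply]
  exact Submodule.sum_mem _ fun i _ => op_con _ (sdN_con i hc)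

theorem sdD_pf (f : C(X, Y)) {k : ℕ} (N : ℕ) (c : SingularChain R X k) :
    sdD N (pf f c) = pf f (sdD N c) := by
  simp only [sdD, LinearMap.sum_apply, map_sum, LinearMap.comp_apply, sdN_pf, op_pf]

theorem sdN_homotopy {k : ℕ} (N : ℕ) (c : SingularChain R X (k + 1)) :
    sdN N c = c + bd (sdD N c) + sdD N (bd c) := by
  have key : ∀ c : SingularChain R X (k + 1),
      op (sdT (k + 1)) c = c + bd (op (sdH (k + 1)) c) + op (sdH k) (bd c) := by
    intro c
    have := (op_homotopy (sdT (R := R)) rfl tbd_sdT).choose_spec.1 k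
    have e : sdT (k + 1) = iot (k + 1) + tbd (sdH (k + 1)) + mface sk (sdH (R := R) k) := by
      simp only [sdH]
      rw [this]
      abel
    rw [bd_op, op_bd, e, op_add, op_add, op_iot]
  induction N with
  | zero => simp [sdN_zero, sdD]
  | succ N ih =>
    rw [sdN_succ, key, bd_sdN]
    conv_lhs => enter [1, 1]; rw [ih]
    simp only [sdD, Finset.sum_range_succ, LinearMap.add_apply, LinearMap.comp_apply, map_add]
    abel

theorem sdN_homotopy_zero (N : ℕ) (c : SingularChain R X 0) : sdN N c = c := by
  induction N with
  | zero => rfl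
  | succ N ih => rw [sdN_succ, ih]; exact op_iot c

open Mix in
theorem sdN_sml {k : ℕ} : ∃ ρ : ℝ, 0 ≤ ρ ∧ ρ < 1 ∧ ∀ (σ : C(Sx k, X)) (N : ℕ),
    sdN N (Finsupp.single σ (1 : R)) ∈ sml R σ (ρ ^ N) := by
  obtain ⟨ρ, h0, h1, h⟩ := sd_contract (R := R) k
  refine ⟨ρ, h0, h1, fun σ N => ?_⟩
  induction N with
  | zero =>
    refine Submodule.subset_span ⟨vtx, ?_, ?_⟩
    · intro a b i
      have h1 : (vtx a : Sx k).1 i ≤ 1 := by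
        simp only [vtx, Pi.single_apply]; split_ifs <;> norm_num
      have h2 : 0 ≤ (vtx b : Sx k).1 i := (vtx b : Sx k).2.1 i
      rw [pow_zero]
      linarith
    · rw [sdN_zero]
      have := mix_vtx (id : Fin (k + 1) → Fin (k + 1))
      rw [simpMap_id] at this
      simp only [id] at this
      rw [show mix (vtx : Fin (k + 1) → Sx k) = _ from this, ContinuousMap.comp_id]
  | succ N ih =>
    rw [sdN_succ, pow_succ']
    exact op_sml _ σ (fun w hw v hv => h w hw v _ (by positivity) hv) ih

open Mix in
theorem sml_le {k : ℕ} (σ : C(Sx k, X)) {U V : Set X} (hU : IsOpen U) (hV : IsOpen V)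
    (hσ : ∀ t, σ t ∈ U ∪ V) : ∃ δ > 0, ∀ D < δ, 0 ≤ D → sml R σ D ≤ con R U k ⊔ con R V k := by
  have : CompactSpace (Sx k) := isCompact_iff_compactSpace.1 (isCompact_stdSimplex ℝ (Fin (k + 1)))
  obtain ⟨δ, hδ, h⟩ := lebesgue_number_lemma_of_metric (s := (Set.univ : Set (Sx k)))
    (c := fun b : Bool => σ ⁻¹' (if b then U else V)) isCompact_univ
    (fun b => by cases b; exacts [hV.preimage σ.continuous, hU.preimage σ.continuous])
    (fun x _ => by
      rcases hσ x with h | h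
      · exact Set.mem_iUnion.2 ⟨true, h⟩
      · exact Set.mem_iUnion.2 ⟨false, h⟩)
  refine ⟨δ, hδ, fun D hD hD0 => ?_⟩
  rw [sml, Submodule.span_le]
  rintro _ ⟨v, hv, rfl⟩
  obtain ⟨b, hb⟩ := h (v 0) (Set.mem_univ _)
  have hball : ∀ x, mix v x ∈ Metric.ball (v 0) δ := by
    intro x
    rw [Metric.mem_ball, Subtype.dist_eq]
    refine lt_of_le_of_lt ?_ hD
    rw [dist_pi_le_iff hD0]
    intro i
    have key : ∀ w : Fin (k + 1) → ℝ, (∀ j, w j ≤ D) → ∑ j, x.1 j * w j ≤ D := by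
      intro w hw
      calc ∑ j, x.1 j * w j ≤ ∑ j, x.1 j * D :=
            Finset.sum_le_sum fun j _ => mul_le_mul_of_nonneg_left (hw j) (x.2.1 j)
        _ = D := by rw [← Finset.sum_mul, show ∑ j, x.1 j = 1 from x.2.2, one_mul]
    have e : (mix v x).1 i - (v 0).1 i = ∑ j, x.1 j * ((v j).1 i - (v 0).1 i) := by
      simp only [mul_sub, Finset.sum_sub_distrib, ← Finset.sum_mul]
      rw [show ∑ j, x.1 j = 1 from x.2.2, one_mul]
      rfl
    rw [Real.dist_eq, abs_le]
    constructor
    · have := key (fun j => (v 0).1 i - (v j).1 i) fun j => hv 0 j i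
      have e' : ∑ j, x.1 j * ((v 0).1 i - (v j).1 i) = - ((mix v x).1 i - (v 0).1 i) := by
        rw [e, ← Finset.sum_neg_distrib]
        exact Finset.sum_congr rfl fun j _ => by ring
      linarith
    · rw [e]
      exact key _ fun j => hv j 0 i
  cases b
  · exact Submodule.mem_sup_right (single_mem_con (fun t => by simpa using hb (hball t)) _)
  · exact Submodule.mem_sup_left (single_mem_con (fun t => by simpa using hb (hball t)) _)

theorem sdN_sup {U V : Set X} {k : ℕ} (N : ℕ) {c : SingularChain R X k}
    (hc : c ∈ con R U k ⊔ con R V k) : sdN N c ∈ con R U k ⊔ con R V k := by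
  obtain ⟨a, ha, b, hb, rfl⟩ := Submodule.mem_sup.1 hc
  rw [map_add]
  exact Submodule.add_mem_sup (sdN_con N ha) (sdN_con N hb)

/-- **Small simplices.** -/
theorem small {U V : Set X} (hU : IsOpen U) (hV : IsOpen V) {k : ℕ} {c : SingularChain R X k}
    (hc : c ∈ con R (U ∪ V) k) : ∃ N, ∀ M, N ≤ M → sdN M c ∈ con R U k ⊔ con R V k := by
  have hup : ∀ (c : SingularChain R X k) N, sdN N c ∈ con R U k ⊔ con R V k →
      ∀ M, N ≤ M → sdN M c ∈ con R U k ⊔ con R V k := by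
    intro c N h M hM
    obtain ⟨L, rfl⟩ := Nat.exists_eq_add_of_le hM
    have : sdN (N + L) c = sdN L (sdN N c) := by
      have := pow_add (op (sdT k) : Module.End R (SingularChain R X k)) L N
      rw [Nat.add_comm L N] at this
      exact LinearMap.congr_fun this c
    rw [this]
    exact sdN_sup L h
  let S : Submodule R (SingularChain R X k) :=
    { carrier := {c | ∃ N, ∀ M, N ≤ M → sdN M c ∈ con R U k ⊔ con R V k}
      add_mem' := by
        rintro a b ⟨N, hN⟩ ⟨M, hM⟩
        refine ⟨max N M, fun L hL => ?_⟩
        rw [map_add]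
        exact Submodule.add_mem _ (hN L (le_trans (le_max_left _ _) hL))
          (hM L (le_trans (le_max_right _ _) hL))
      zero_mem' := ⟨0, fun M _ => by rw [map_zero]; exact Submodule.zero_mem _⟩
      smul_mem' := by
        rintro r a ⟨N, hN⟩
        exact ⟨N, fun L hL => by rw [map_smul]; exact Submodule.smul_mem _ _ (hN L hL)⟩ }
  refine map_con LinearMap.id S (c := c) (fun σ hσ => ?_) hc
  obtain ⟨ρ, h0, h1, h⟩ := sdN_sml (R := R) (X := X) (k := k)
  obtain ⟨δ, hδ, hD⟩ := sml_le (R := R) σ hU hV hσ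
  obtain ⟨N, hN⟩ := exists_pow_lt_of_lt_one hδ h1
  exact ⟨N, hup _ N (hD _ hN (by positivity) (h σ N))⟩

/-! ### Norms and alternation -/

theorem lin_bound {α : Type} (ℓ : (α →₀ ℝ) →ₗ[ℝ] ℝ) {B : ℝ}
    (h : ∀ a, |ℓ (Finsupp.single a 1)| ≤ B) (c : α →₀ ℝ) : |ℓ c| ≤ B * c.sum fun _ r => |r| := by
  have e : ℓ c = c.sum fun a r => r * ℓ (Finsupp.single a 1) := by
    conv_lhs => rw [← Finsupp.sum_single c]
    rw [Finsupp.sum, map_sum]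
    refine Finset.sum_congr rfl fun a _ => ?_
    show _ = c a * _
    rw [← smul_eq_mul, ← map_smul, Finsupp.smul_single, smul_eq_mul, mul_one]
  rw [e, Finsupp.sum, Finsupp.sum, Finset.mul_sum]
  refine (Finset.abs_sum_le_sum_abs _ _).trans (Finset.sum_le_sum fun a _ => ?_)
  rw [abs_mul, mul_comm]
  exact mul_le_mul_of_nonneg_right (h a) (abs_nonneg _)

theorem chain_bound {n : ℕ} (φ : SingularChain ℝ X n →ₗ[ℝ] ℝ) {B : ℝ}
    (h : ∀ σ, |φ (Finsupp.single σ 1)| ≤ B) (c : SingularChain ℝ X n) :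
    |φ c| ≤ B * chainNorm c := lin_bound φ h c

theorem op_bound {k j : ℕ} (t : T ℝ (Sx k) j) (φ : SingularChain ℝ X j →ₗ[ℝ] ℝ) {B : ℝ}
    (h : ∀ σ, |φ (Finsupp.single σ 1)| ≤ B) (σ : C(Sx k, X)) :
    |φ (op t (Finsupp.single σ 1))| ≤ B * t.sum fun _ r => |r| := by
  rw [op_single]
  refine lin_bound (φ ∘ₗ pf σ ∘ₗ real) (fun v => ?_) t
  simp only [LinearMap.comp_apply, real_single, pf_single]
  exact h _

/-- ℓ¹-norm of the prism tuples -/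
def prC (k : ℕ) : ℝ := (prT k : T ℝ _ _).sum fun _ r => |r|

theorem prism_bound {k : ℕ} (φ : SingularChain ℝ X (k + 1) →ₗ[ℝ] ℝ) {B : ℝ}
    (h : ∀ σ, |φ (Finsupp.single σ 1)| ≤ B) (H : C(Sx k × unitInterval, X)) :
    |φ (prism H)| ≤ B * prC k := by
  refine lin_bound (φ ∘ₗ pf H ∘ₗ real) (fun v => ?_) (prT k)
  simp only [LinearMap.comp_apply, real_single, pf_single]
  exact h _

/-- Alternation tuples. -/
def altT (k : ℕ) : T ℝ (Sx k) k :=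
  ((k + 1).factorial : ℝ)⁻¹ • ∑ π : Equiv.Perm (Fin (k + 1)),
    ((Equiv.Perm.sign π : ℤ) : ℝ) • Finsupp.single (vtx ∘ π) 1

/-- permutations of `Fin (k+2)` with prescribed value at `i` -/
def pex {k : ℕ} (i : Fin (k + 2)) (x : Fin (k + 2) × Equiv.Perm (Fin (k + 1))) :
    Equiv.Perm (Fin (k + 2)) :=
  (x.1.cycleRange)⁻¹ * Equiv.Perm.decomposeFin.symm (0, x.2) * i.cycleRange

theorem pex_succAbove {k : ℕ} (i : Fin (k + 2)) (x : Fin (k + 2) × Equiv.Perm (Fin (k + 1))) (l) :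
    pex i x (i.succAbove l) = x.1.succAbove (x.2 l) := by
  have h1 : i.cycleRange (i.succAbove l) = l.succ := by
    rw [← Fin.cycleRange_symm_succ, Equiv.apply_symm_apply]
  have h2 : (Equiv.Perm.decomposeFin.symm (0, x.2)) l.succ = (x.2 l).succ := by
    simp
  have h3 : (x.1.cycleRange)⁻¹ (x.2 l).succ = x.1.succAbove (x.2 l) := Fin.cycleRange_symm_succ _ _
  rw [pex, Equiv.Perm.mul_apply, Equiv.Perm.mul_apply, h1, h2, h3]

theorem pex_self {k : ℕ} (i : Fin (k + 2)) (x : Fin (k + 2) × Equiv.Perm (Fin (k + 1))) :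
    pex i x i = x.1 := by
  have h3 : (x.1.cycleRange)⁻¹ 0 = x.1 := Fin.cycleRange_symm_zero _
  rw [pex, Equiv.Perm.mul_apply, Equiv.Perm.mul_apply, Fin.cycleRange_self,
    Equiv.Perm.decomposeFin_symm_apply_zero, h3]

theorem pex_bij {k : ℕ} (i : Fin (k + 2)) : Function.Bijective (pex i) := by
  rw [Fintype.bijective_iff_injective_and_card]
  constructor
  · rintro ⟨j, τ⟩ ⟨j', τ'⟩ h
    have h1 : j = j' := by
      have := congrArg (fun π => π i) h
      simpa only [pex_self] using this
    subst h1
    refine Prod.ext rfl (Equiv.ext fun l => ?_)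
    have := congrArg (fun π => π (i.succAbove l)) h
    simp only [pex_succAbove] at this
    exact Fin.succAbove_right_injective this
  · simp [Fintype.card_perm, Nat.factorial_succ]

theorem sign_pex {k : ℕ} (i : Fin (k + 2)) (x : Fin (k + 2) × Equiv.Perm (Fin (k + 1))) :
    ((Equiv.Perm.sign (pex i x) : ℤ) : ℝ) =
      (-1) ^ (x.1 : ℕ) * ((Equiv.Perm.sign x.2 : ℤ) : ℝ) * (-1) ^ (i : ℕ) := by
  rw [pex, map_mul, map_mul, map_inv, Fin.sign_cycleRange, Fin.sign_cycleRange,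
    Equiv.Perm.decomposeFin.symm_sign]
  simp

theorem tbd_altT (k : ℕ) : tbd (altT (k + 1)) = mface sk (altT k) := by
  have e1 : tbd (altT (k + 1)) = ((k + 1 + 1).factorial : ℝ)⁻¹ • ∑ i : Fin (k + 2),
      ∑ π : Equiv.Perm (Fin (k + 2)), (((Equiv.Perm.sign π : ℤ) : ℝ) * (-1) ^ (i : ℕ)) •
        Finsupp.single ((vtx : _ → Sx (k + 1)) ∘ π ∘ i.succAbove) (1 : ℝ) := by
    simp only [altT, map_smul, map_sum, tbd_single, Finset.smul_sum, smul_smul]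
    rw [Finset.sum_comm]
    simp only [mul_assoc]
    rfl
  have e2 : mface sk (altT k) = ((k + 1).factorial : ℝ)⁻¹ •
      ∑ x : Fin (k + 2) × Equiv.Perm (Fin (k + 1)),
        ((-1) ^ (x.1 : ℕ) * ((Equiv.Perm.sign x.2 : ℤ) : ℝ)) •
        Finsupp.single ((vtx : _ → Sx (k + 1)) ∘ x.1.succAbove ∘ x.2) (1 : ℝ) := by
    simp only [altT, mface_apply, map_smul, map_sum, tmap_single, Finset.smul_sum, smul_smul]
    rw [Fintype.sum_prod_type, Finset.sum_comm]
    refine Finset.sum_congr rfl fun j _ => Finset.sum_congr rfl fun τ _ => ?_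
    congr 1
    · ring
    · congr 1
      funext l
      exact simpMap_vtx _ _
  have e3 : ∀ i : Fin (k + 2), (∑ π : Equiv.Perm (Fin (k + 2)),
      (((Equiv.Perm.sign π : ℤ) : ℝ) * (-1) ^ (i : ℕ)) •
        Finsupp.single ((vtx : _ → Sx (k + 1)) ∘ π ∘ i.succAbove) (1 : ℝ)) =
      ∑ x : Fin (k + 2) × Equiv.Perm (Fin (k + 1)),
        ((-1) ^ (x.1 : ℕ) * ((Equiv.Perm.sign x.2 : ℤ) : ℝ)) •
        Finsupp.single ((vtx : _ → Sx (k + 1)) ∘ x.1.succAbove ∘ x.2) (1 : ℝ) := by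
    intro i
    rw [← (pex_bij i).sum_comp]
    refine Finset.sum_congr rfl fun x _ => ?_
    congr 1
    · rw [sign_pex, mul_assoc _ ((-1 : ℝ) ^ (i : ℕ)), ← mul_pow]
      norm_num
    · congr 1
      funext l
      simp only [Function.comp_apply, pex_succAbove]
  rw [e1, e2, Finset.sum_congr rfl fun i _ => e3 i, Finset.sum_const, Finset.card_univ,
    Fintype.card_fin, ← Nat.cast_smul_eq_nsmul ℝ, smul_smul]
  congr 1
  rw [Nat.factorial_succ (k + 1)]
  push_cast
  have : ((k + 1).factorial : ℝ) ≠ 0 := by positivity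
  field_simp
  ring

theorem altT_zero : altT 0 = iot 0 := by
  simp [altT, iot]

/-- Alternation kills constants, keeps the bound and is homotopic to the identity. -/
theorem alternate {A : Set X} {n : ℕ} (φ : SingularChain ℝ X (n + 1) →ₗ[ℝ] ℝ)
    (hφ : ∀ c : SingularChain ℝ X (n + 2), φ (bd c) = 0)
    (h1 : ∀ σ, |φ (Finsupp.single σ 1)| ≤ 1) (a : ℝ)
    (hA : ∀ σ : C(Sx (n + 1), X), (∀ t, σ t ∈ A) → φ (Finsupp.single σ 1) = a) :
    ∃ (ψ : SingularChain ℝ X n →ₗ[ℝ] ℝ) (K : ℝ), (∀ σ, |ψ (Finsupp.single σ 1)| ≤ K) ∧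
      (∀ σ, |φ (Finsupp.single σ 1) - ψ (bd (Finsupp.single σ 1))| ≤ 1) ∧
      (∀ σ : C(Sx (n + 1), X), (∀ t, σ t ∈ A) → φ (Finsupp.single σ 1) -
        ψ (bd (Finsupp.single σ 1)) = 0) := by
  obtain ⟨t, ht, -⟩ := op_homotopy altT altT_zero tbd_altT
  have key : ∀ c : SingularChain ℝ X (n + 1),
      φ c - (-(φ ∘ₗ op (t n))) (bd c) = φ (op (altT (n + 1)) c) := by
    intro c
    have e : altT (n + 1) = iot (n + 1) + tbd (t (n + 1)) + mface sk (t n) := by rw [ht]; abel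
    rw [e, op_add, op_add, op_iot, map_add, map_add, ← bd_op, hφ, ← op_bd]
    simp
  have sgn1 : ∀ π : Equiv.Perm (Fin (n + 1 + 1)), |((Equiv.Perm.sign π : ℤ) : ℝ)| = 1 := by
    intro π
    rcases Int.units_eq_one_or (Equiv.Perm.sign π) with h | h <;> simp [h]
  have hval : ∀ σ : C(Sx (n + 1), X), φ (op (altT (n + 1)) (Finsupp.single σ 1)) =
      ((n + 1 + 1).factorial : ℝ)⁻¹ * ∑ π : Equiv.Perm (Fin (n + 1 + 1)),
        ((Equiv.Perm.sign π : ℤ) : ℝ) * φ (Finsupp.single (σ.comp (Mix.mix (vtx ∘ π))) 1) := by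
    intro σ
    rw [op_single, altT]
    simp only [map_smul, map_sum, real_single, pf_single, smul_eq_mul]
  refine ⟨-(φ ∘ₗ op (t n)), 1 * (t n).sum fun _ r => |r|, fun σ => ?_, fun σ => ?_, fun σ hσ => ?_⟩
  · rw [LinearMap.neg_apply, abs_neg]
    exact op_bound (t n) φ h1 σ
  · rw [key, hval, abs_mul, abs_inv, Nat.abs_cast, inv_mul_le_iff₀ (by positivity), mul_one]
    refine (Finset.abs_sum_le_sum_abs _ _).trans ?_
    calc ∑ π : Equiv.Perm (Fin (n + 1 + 1)), |((Equiv.Perm.sign π : ℤ) : ℝ) *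
          φ (Finsupp.single (σ.comp (Mix.mix (vtx ∘ π))) 1)|
        ≤ ∑ π : Equiv.Perm (Fin (n + 1 + 1)), (1 : ℝ) := by
          refine Finset.sum_le_sum fun π _ => ?_
          rw [abs_mul, sgn1, one_mul]
          exact h1 _
      _ = _ := by simp [Fintype.card_perm]
  · rw [key, hval]
    have : ∀ π : Equiv.Perm (Fin (n + 1 + 1)),
        φ (Finsupp.single (σ.comp (Mix.mix (vtx ∘ π))) 1) = a := fun π => hA _ fun t => hσ _
    simp only [this, ← Finset.sum_mul]
    have hs : ∑ π : Equiv.Perm (Fin (n + 1 + 1)), ((Equiv.Perm.sign π : ℤ) : ℝ) = 0 := by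
      have h := Equiv.sum_comp (Equiv.mulRight (Equiv.swap (0 : Fin (n + 1 + 1)) 1))
        fun π : Equiv.Perm (Fin (n + 1 + 1)) => ((Equiv.Perm.sign π : ℤ) : ℝ)
      simp only [Equiv.coe_mulRight, map_mul, Equiv.Perm.sign_swap (zero_ne_one' (Fin (n + 2)))] at h
      simp only [mul_neg, mul_one, Units.val_neg, Int.cast_neg, Finset.sum_neg_distrib] at h
      linarith
    rw [hs]
    simp

/-! ### Means -/

/-- A left-invariant mean, as a linear functional on all functions. -/
structure MeanOn (G : Type) [Group G] where
  m : (G → ℝ) →ₗ[ℝ] ℝ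
  bound : ∀ (f : G → ℝ) (C : ℝ), (∀ x, |f x| ≤ C) → |m f| ≤ C
  one : m (fun _ => 1) = 1
  inv : ∀ (a : G) (f : G → ℝ) (C : ℝ), (∀ x, |f x| ≤ C) → m (fun x => f (a * x)) = m f

/-- bounded functions -/
def bfun (G : Type) : Submodule ℝ (G → ℝ) where
  carrier := {f | ∃ C, ∀ x, |f x| ≤ C}
  add_mem' := by
    rintro f g ⟨C, hC⟩ ⟨D, hD⟩
    exact ⟨C + D, fun x => (abs_add_le _ _).trans (add_le_add (hC x) (hD x))⟩
  zero_mem' := ⟨0, by simp⟩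
  smul_mem' := by
    rintro r f ⟨C, hC⟩
    refine ⟨|r| * C, fun x => ?_⟩
    rw [Pi.smul_apply, smul_eq_mul, abs_mul]
    exact mul_le_mul_of_nonneg_left (hC x) (abs_nonneg _)

/-- Hahn–Banach construction of means from a family of upper bounds. -/
theorem mean_of_upper (G : Type) [Group G] (Up : (G → ℝ) → ℝ → Prop)
    (hcst : ∀ (f : G → ℝ) (c : ℝ), (∀ x, f x ≤ c) → Up f c)
    (hlow : ∀ (f : G → ℝ) (c C : ℝ), Up f c → (∀ x, C ≤ f x) → C ≤ c)
    (hadd : ∀ (f g : G → ℝ) (c d : ℝ), Up f c → Up g d → Up (fun x => f x + g x) (c + d))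
    (hsmul : ∀ (f : G → ℝ) (c r : ℝ), 0 < r → Up f c → Up (fun x => r * f x) (r * c))
    (hinv : ∀ (f : G → ℝ) (a : G) (C : ℝ), (∀ x, |f x| ≤ C) → ∀ ε > 0, Up (fun x => f x - f (a * x)) ε) :
    Nonempty (MeanOn G) := by
  classical
  let N : bfun G → ℝ := fun f => sInf {c | Up f.1 c}
  have hne : ∀ f : bfun G, {c | Up f.1 c}.Nonempty := fun f => by
    obtain ⟨C, hC⟩ := f.2
    exact ⟨C, hcst _ _ fun x => (abs_le.1 (hC x)).2⟩
  have hbd : ∀ f : bfun G, BddBelow {c | Up f.1 c} := fun f => by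
    obtain ⟨C, hC⟩ := f.2
    exact ⟨-C, fun c hc => hlow _ _ _ hc fun x => (abs_le.1 (hC x)).1⟩
  have hle : ∀ (f : bfun G) c, Up f.1 c → N f ≤ c := fun f c h => csInf_le (hbd f) h
  have hN : ∀ (f : bfun G) (b : ℝ), (∀ c, Up f.1 c → b ≤ c) → b ≤ N f :=
    fun f b h => le_csInf (hne f) h
  have hs1 : ∀ (f : bfun G) (r : ℝ), 0 < r → N (r • f) ≤ r * N f := by
    intro f r hr
    rw [← div_le_iff₀' hr]
    refine hN f _ fun c hc => ?_
    rw [div_le_iff₀' hr]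
    exact hle _ _ (hsmul _ _ r hr hc)
  obtain ⟨g, -, hg⟩ := exists_extension_of_le_sublinear (⊥ : bfun G →ₗ.[ℝ] ℝ) N
    (fun r hr f => by
      refine le_antisymm (hs1 f r hr) ?_
      have := hs1 (r • f) r⁻¹ (by positivity)
      rw [smul_smul, inv_mul_cancel₀ hr.ne', one_smul] at this
      rwa [le_inv_mul_iff₀ hr] at this)
    (fun f g => by
      rw [← sub_le_iff_le_add]
      refine hN f _ fun c hc => ?_
      rw [sub_le_comm]
      refine hN g _ fun d hd => ?_
      rw [sub_le_iff_le_add']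
      exact hle _ _ (hadd _ _ _ _ hc hd))
    (by
      rintro ⟨f, hf⟩
      have : f = 0 := (Submodule.mem_bot ℝ).1 hf
      subst this
      have e : (⊥ : bfun G →ₗ.[ℝ] ℝ) ⟨0, hf⟩ = 0 := (⊥ : bfun G →ₗ.[ℝ] ℝ).map_zero
      rw [e]
      exact hN _ _ fun c hc => hlow _ _ 0 hc fun x => le_rfl)
  have hgle : ∀ (f : bfun G) c, (∀ x, f.1 x ≤ c) → g f ≤ c := fun f c h =>
    (hg f).trans (hle _ _ (hcst _ _ h))
  have hgab : ∀ (f : bfun G) c, (∀ x, |f.1 x| ≤ c) → |g f| ≤ c := fun f c h => by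
    rw [abs_le]
    constructor
    · have := hgle (-f) c fun x => by
        have := (abs_le.1 (h x)).1
        show - (f.1 x) ≤ c
        linarith
      rw [map_neg] at this
      linarith
    · exact hgle f c fun x => (abs_le.1 (h x)).2
  obtain ⟨m, hm⟩ := LinearMap.exists_extend g
  have hm' : ∀ f : bfun G, m f.1 = g f := fun f => LinearMap.congr_fun hm f
  refine ⟨⟨m, fun f C h => ?_, ?_, fun a f C h => ?_⟩⟩
  · have := hgab ⟨f, C, h⟩ C h
    rwa [← hm'] at this
  · have h1 : (fun _ => 1 : G → ℝ) ∈ bfun G := ⟨1, by simp⟩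
    have a1 := hgle ⟨_, h1⟩ 1 fun x => le_rfl
    have a2 := hgle (-⟨_, h1⟩) (-1) fun x => le_rfl
    rw [map_neg] at a2
    rw [← hm'] at a1 a2
    exact le_antisymm a1 (by linarith)
  · have key : ∀ f : G → ℝ, (∀ x, |f x| ≤ C) → m f ≤ m (fun x => f (a * x)) := by
      intro f h
      have hf : f ∈ bfun G := ⟨C, h⟩
      have hf' : (fun x => f (a * x)) ∈ bfun G := ⟨C, fun x => h _⟩
      have : ∀ ε > 0, g (⟨f, hf⟩ - ⟨_, hf'⟩) ≤ ε := fun ε hε =>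
        (hg _).trans (hle _ _ (hinv f a C h ε hε))
      have := le_of_forall_pos_le_add (a := g (⟨f, hf⟩ - ⟨_, hf'⟩)) (b := 0)
        fun ε hε => by simpa using this ε hε
      rw [map_sub, ← hm', ← hm'] at this
      simpa using this
    refine le_antisymm ?_ (key f h)
    have := key (fun x => -f x) fun x => by rw [abs_neg]; exact h x
    have e1 : m (fun x => -f x) = - m f := by rw [← map_neg]; rfl
    have e2 : m (fun x => -f (a * x)) = - m (fun x => f (a * x)) := by rw [← map_neg]; rfl
    rw [e1, e2] at this
    linarith

/-- Abelian groups are amenable. -/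
theorem mean_of_comm (G : Type) [Group G] (hc : ∀ a b : G, a * b = b * a) :
    Nonempty (MeanOn G) := by
  refine mean_of_upper G (fun f c => ∃ (ι : Type) (_ : Fintype ι) (_ : Nonempty ι) (l : ι → G),
    ∀ x, ∑ i, f (l i * x) ≤ Fintype.card ι * c) ?_ ?_ ?_ ?_ ?_
  · intro f c h
    exact ⟨Unit, inferInstance, inferInstance, fun _ => 1, fun x => by simpa using h x⟩
  · rintro f c C ⟨ι, _, _, l, hl⟩ hC
    have h1 := hl 1
    have h2 : (Fintype.card ι : ℝ) * C ≤ ∑ i, f (l i * 1) := by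
      rw [← nsmul_eq_mul, ← Finset.card_univ]
      exact Finset.card_nsmul_le_sum _ _ _ fun i _ => hC _
    have h3 : (0 : ℝ) < Fintype.card ι := by exact_mod_cast Fintype.card_pos
    exact le_of_mul_le_mul_left (h2.trans h1) h3
  · rintro f g c d ⟨ι, _, _, l, hl⟩ ⟨κ, _, _, k, hk⟩
    refine ⟨ι × κ, inferInstance, inferInstance, fun p => l p.1 * k p.2, fun x => ?_⟩
    rw [Finset.sum_add_distrib]
    have h1 : ∑ p : ι × κ, f (l p.1 * k p.2 * x) ≤ Fintype.card κ * (Fintype.card ι * c) := by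
      rw [Fintype.sum_prod_type_right, ← nsmul_eq_mul, ← Finset.card_univ (α := κ)]
      refine Finset.sum_le_card_nsmul _ _ _ fun j _ => ?_
      simpa only [mul_assoc] using hl (k j * x)
    have h2 : ∑ p : ι × κ, g (l p.1 * k p.2 * x) ≤ Fintype.card ι * (Fintype.card κ * d) := by
      rw [Fintype.sum_prod_type, ← nsmul_eq_mul, ← Finset.card_univ (α := ι)]
      refine Finset.sum_le_card_nsmul _ _ _ fun i _ => ?_
      simpa only [hc (l i), mul_assoc] using hk (l i * x)
    rw [Fintype.card_prod]
    push_cast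
    linarith
  · rintro f c r hr ⟨ι, _, _, l, hl⟩
    refine ⟨ι, inferInstance, inferInstance, l, fun x => ?_⟩
    rw [← Finset.mul_sum]
    have := mul_le_mul_of_nonneg_left (hl x) hr.le
    linarith
  · intro f a C h ε hε
    obtain ⟨n, hn⟩ := exists_nat_gt (2 * C / ε)
    refine ⟨Fin (n + 1), inferInstance, inferInstance, fun i => a ^ (i : ℕ), fun x => ?_⟩
    have e : ∑ i : Fin (n + 1), (f (a ^ (i : ℕ) * x) - f (a * (a ^ (i : ℕ) * x))) =
        f x - f (a ^ (n + 1) * x) := by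
      rw [Fin.sum_univ_eq_sum_range (fun i => f (a ^ i * x) - f (a * (a ^ i * x)))]
      have := Finset.sum_range_sub' (fun i => f (a ^ i * x)) (n + 1)
      simp only [pow_zero, one_mul] at this
      rw [← this]
      refine Finset.sum_congr rfl fun i _ => ?_
      rw [pow_succ' a i, mul_assoc]
    rw [e, Fintype.card_fin]
    rw [div_lt_iff₀ hε] at hn
    have h1 := abs_le.1 (h x)
    have h2 := abs_le.1 (h (a ^ (n + 1) * x))
    push_cast
    linarith [h1.2, h2.1]

section fam
variable {G : Type} [Group G] (μ : InvariantMean G)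

theorem im_empty : μ.meas ∅ = 0 := by
  have := μ.additive ∅ ∅ (by simp)
  simp at this
  exact this

theorem im_sum {ι : Type} [Fintype ι] (k : G → ι) (S : Set G) :
    μ.meas S = ∑ i, μ.meas (S ∩ k ⁻¹' {i}) := by
  classical
  have : ∀ F : Finset ι, μ.meas (S ∩ k ⁻¹' F) = ∑ i ∈ F, μ.meas (S ∩ k ⁻¹' {i}) := by
    intro F
    induction F using Finset.induction_on with
    | empty => simp [im_empty]
    | insert i F hi ih =>
      rw [Finset.sum_insert hi, ← ih, ← μ.additive]
      · congr 1
        ext x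
        simp only [Set.mem_inter_iff, Set.mem_preimage, Finset.coe_insert, Set.mem_insert_iff,
          Set.mem_union, Set.mem_singleton_iff]
        tauto
      · rw [Set.disjoint_left]
        rintro x ⟨-, hx⟩ ⟨-, hx'⟩
        have : k x = i := hx
        exact hi (this ▸ hx')
  rw [← this]
  simp

/-- integral of a simple function -/
def simpInt {ι : Type} [Fintype ι] (k : G → ι) (v : ι → ℝ) : ℝ := ∑ i, v i * μ.meas (k ⁻¹' {i})

theorem simpInt_mono {ι κ : Type} [Fintype ι] [Fintype κ] (k : G → ι) (v : ι → ℝ) (l : G → κ)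
    (w : κ → ℝ) (h : ∀ x, v (k x) ≤ w (l x)) : simpInt μ k v ≤ simpInt μ l w := by
  have e1 : simpInt μ k v = ∑ i, ∑ j, v i * μ.meas (k ⁻¹' {i} ∩ l ⁻¹' {j}) := by
    refine Finset.sum_congr rfl fun i _ => ?_
    rw [im_sum μ l, Finset.mul_sum]
  have e2 : simpInt μ l w = ∑ i, ∑ j, w j * μ.meas (k ⁻¹' {i} ∩ l ⁻¹' {j}) := by
    rw [Finset.sum_comm]
    refine Finset.sum_congr rfl fun i _ => ?_
    rw [im_sum μ k, Finset.mul_sum]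
    refine Finset.sum_congr rfl fun j _ => ?_
    rw [Set.inter_comm]
  rw [e1, e2]
  refine Finset.sum_le_sum fun i _ => Finset.sum_le_sum fun j _ => ?_
  rcases (k ⁻¹' {i} ∩ l ⁻¹' {j}).eq_empty_or_nonempty with h0 | ⟨x, hx, hx'⟩
  · rw [h0, im_empty]; simp
  · have h1 : k x = i := hx
    have h2 : l x = j := hx'
    refine mul_le_mul_of_nonneg_right ?_ (μ.nonneg _)
    rw [← h1, ← h2]
    exact h x

theorem simpInt_comp {ι κ : Type} [Fintype ι] [Fintype κ] (k : G → ι) (p : ι → κ) (v : κ → ℝ) :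
    simpInt μ k (v ∘ p) = simpInt μ (p ∘ k) v :=
  le_antisymm (simpInt_mono _ _ _ _ _ fun _ => le_rfl) (simpInt_mono _ _ _ _ _ fun _ => le_rfl)

theorem simpInt_const (c : ℝ) : simpInt μ (fun _ : G => ()) (fun _ => c) = c := by
  simp [simpInt, μ.total]

theorem mean_of_im (μ : InvariantMean G) : Nonempty (MeanOn G) := by
  refine mean_of_upper G (fun f c => ∃ (ι : Type) (_ : Fintype ι) (k : G → ι) (v : ι → ℝ),
    (∀ x, f x ≤ v (k x)) ∧ simpInt μ k v ≤ c) ?_ ?_ ?_ ?_ ?_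
  · intro f c h
    exact ⟨Unit, inferInstance, fun _ => (), fun _ => c, h, (simpInt_const μ c).le⟩
  · rintro f c C ⟨ι, _, k, v, h, hc⟩ hC
    refine le_trans ?_ hc
    rw [← simpInt_const μ C]
    exact simpInt_mono _ _ _ _ _ fun x => (hC x).trans (h x)
  · rintro f g c d ⟨ι, _, k, v, h, hc⟩ ⟨κ, _, l, w, h', hd⟩
    refine ⟨ι × κ, inferInstance, fun x => (k x, l x), fun p => v p.1 + w p.2,
      fun x => add_le_add (h x) (h' x), ?_⟩
    have e1 := simpInt_comp μ (fun x => (k x, l x)) Prod.fst v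
    have e2 := simpInt_comp μ (fun x => (k x, l x)) Prod.snd w
    have e3 : simpInt μ (fun x => (k x, l x)) (fun p => v p.1 + w p.2) =
        simpInt μ (fun x => (k x, l x)) (v ∘ Prod.fst) +
        simpInt μ (fun x => (k x, l x)) (w ∘ Prod.snd) := by
      simp only [simpInt, add_mul, Finset.sum_add_distrib, Function.comp]
    rw [e3, e1, e2]
    exact add_le_add hc hd
  · rintro f c r hr ⟨ι, _, k, v, h, hc⟩
    refine ⟨ι, inferInstance, k, fun i => r * v i,
      fun x => mul_le_mul_of_nonneg_left (h x) hr.le, ?_⟩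
    have : simpInt μ k (fun i => r * v i) = r * simpInt μ k v := by
      simp only [simpInt, mul_assoc, Finset.mul_sum]
    rw [this]
    exact mul_le_mul_of_nonneg_left hc hr.le
  · intro f a C h ε hε
    -- colour by levels of width `ε`
    obtain ⟨n, hn⟩ := exists_nat_gt (C / ε)
    rw [div_lt_iff₀ hε] at hn
    have hfl : ∀ x, ⌊f x / ε⌋ ∈ Finset.Icc (-(n : ℤ)) n := by
      intro x
      have := abs_le.1 (h x)
      rw [Finset.mem_Icc]
      constructor
      · rw [Int.le_floor, le_div_iff₀ hε]; push_cast; linarith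
      · have : f x / ε ≤ n := by rw [div_le_iff₀ hε]; linarith
        exact_mod_cast (Int.floor_le _).trans this
    let k : G → Finset.Icc (-(n : ℤ)) n := fun x => ⟨_, hfl x⟩
    let v : Finset.Icc (-(n : ℤ)) n → ℝ := fun i => (i : ℤ) * ε
    have hv1 : ∀ x, v (k x) ≤ f x := fun x => by
      show (⌊f x / ε⌋ : ℝ) * ε ≤ _
      rw [← le_div_iff₀ hε]
      exact Int.floor_le _
    have hv2 : ∀ x, f x ≤ v (k x) + ε := fun x => by
      show _ ≤ (⌊f x / ε⌋ : ℝ) * ε + ε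
      have := (Int.lt_floor_add_one (f x / ε)).le
      rw [div_le_iff₀ hε] at this
      linarith
    refine ⟨_ × _, inferInstance, fun x => (k x, k (a * x)), fun p => v p.1 - v p.2 + ε, fun x => ?_,
      ?_⟩
    · have h1 := hv2 x
      have h2 := hv1 (a * x)
      show _ ≤ v (k x) - v (k (a * x)) + ε
      linarith
    · have e1 := simpInt_comp μ (fun x => (k x, k (a * x))) Prod.fst v
      have e2 := simpInt_comp μ (fun x => (k x, k (a * x))) Prod.snd v
      have e4 := simpInt_comp μ (fun x => (k x, k (a * x))) (fun _ => ()) (fun _ => ε)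
      have e3 : simpInt μ (fun x => (k x, k (a * x))) (fun p => v p.1 - v p.2 + ε) =
          simpInt μ (fun x => (k x, k (a * x))) (v ∘ Prod.fst) -
          simpInt μ (fun x => (k x, k (a * x))) (v ∘ Prod.snd) +
          simpInt μ (fun x => (k x, k (a * x))) ((fun _ => ε) ∘ (fun _ => ())) := by
        simp only [simpInt, add_mul, sub_mul, Finset.sum_add_distrib, Finset.sum_sub_distrib,
          Function.comp]
      have e5 : simpInt μ (Prod.snd ∘ fun x => (k x, k (a * x))) v =
          simpInt μ (Prod.fst ∘ fun x => (k x, k (a * x))) v := by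
        refine Finset.sum_congr rfl fun i _ => ?_
        congr 1
        rw [← μ.invariant a]
        congr 1
        ext x
        simp only [Set.mem_image, Set.mem_preimage]
        constructor
        · rintro ⟨y, hy, rfl⟩
          exact hy
        · intro hx
          exact ⟨a⁻¹ * x, by simpa using hx, by simp⟩
      rw [e3, e1, e2, e4, e5, sub_self, zero_add]
      exact (simpInt_const μ ε).le

end fam

/-- transport along surjective homomorphisms -/
theorem mean_of_surj {G G' : Type} [Group G] [Group G'] (M : MeanOn G) (f : G → G')
    (hmul : ∀ a b, f (a * b) = f a * f b) (hf : Function.Surjective f) : Nonempty (MeanOn G') := by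
  refine ⟨⟨M.m ∘ₗ LinearMap.funLeft ℝ ℝ f, fun F C h => ?_, M.one, fun a F C h => ?_⟩⟩
  · exact M.bound _ C fun x => h _
  · obtain ⟨a, rfl⟩ := hf a
    have := M.inv a (F ∘ f) C fun x => h _
    simp only [Function.comp_apply, hmul] at this
    exact this

/-! ### Paths and squares -/



theorem square_hom {Y : Type} [TopologicalSpace Y] {y00 y10 y01 y11 : Y} (b : Path y00 y10)
    (r : Path y10 y11) (l : Path y00 y01) (t : Path y01 y11) (F : C(𝕀 × 𝕀, Y))
    (hb : ∀ u, F (u, 0) = b u) (hr : ∀ u, F (1, u) = r u) (hl : ∀ u, F (0, u) = l u)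
    (ht : ∀ u, F (u, 1) = t u) : (b.trans r).Homotopic (l.trans t) := by
  have e00 : F (0, 0) = y00 := by rw [hb]; simp
  have e10 : F (1, 0) = y10 := by rw [hb]; simp
  have e01 : F (0, 1) = y01 := by rw [hl]; simp
  have e11 : F (1, 1) = y11 := by rw [hr]; simp
  subst e00 e10 e01 e11
  let pb : Path ((0, 0) : 𝕀 × 𝕀) (1, 0) := ⟨⟨fun u => (u, 0), by fun_prop⟩, rfl, rfl⟩
  let pr : Path ((1, 0) : 𝕀 × 𝕀) (1, 1) := ⟨⟨fun u => (1, u), by fun_prop⟩, rfl, rfl⟩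
  let pl : Path ((0, 0) : 𝕀 × 𝕀) (0, 1) := ⟨⟨fun u => (0, u), by fun_prop⟩, rfl, rfl⟩
  let pt : Path ((0, 1) : 𝕀 × 𝕀) (1, 1) := ⟨⟨fun u => (u, 1), by fun_prop⟩, rfl, rfl⟩
  haveI : ContractibleSpace 𝕀 := (convex_Icc (0 : ℝ) 1).contractibleSpace ⟨0, by simp⟩
  have : (pb.trans pr).Homotopic (pl.trans pt) := SimplyConnectedSpace.paths_homotopic _ _
  have := this.map F
  rw [Path.map_trans, Path.map_trans] at this
  have h1 : pb.map F.continuous = b := by ext u; exact hb u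
  have h2 : pr.map F.continuous = r := by ext u; exact hr u
  have h3 : pl.map F.continuous = l := by ext u; exact hl u
  have h4 : pt.map F.continuous = t := by ext u; exact ht u
  rwa [h1, h2, h3, h4] at this

section qt
open Path.Homotopic
variable {Y : Type} [TopologicalSpace Y]

theorem comm_conj {y0 y1 : Y} (α β : Path.Homotopic.Quotient y0 y0)
    (k : Path.Homotopic.Quotient y0 y1) (α' β' : Path.Homotopic.Quotient y1 y1)
    (ha : α.trans k = k.trans α') (hb : β.trans k = k.trans β')
    (h : α'.trans β' = β'.trans α') : α.trans β = β.trans α := by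
  have key : ∀ α β : Path.Homotopic.Quotient y0 y0, ∀ α' β' : Path.Homotopic.Quotient y1 y1,
      α.trans k = k.trans α' → β.trans k = k.trans β' →
      (α.trans β).trans k = k.trans (α'.trans β') := by
    intro α β α' β' ha hb
    rw [Quotient.trans_assoc, hb, ← Quotient.trans_assoc, ha, Quotient.trans_assoc]
  have h1 := key α β α' β' ha hb
  have h2 := key β α β' α' hb ha
  rw [h, ← h2] at h1
  have := congrArg (fun z => z.trans k.symm) h1
  simpa [Quotient.trans_assoc, Quotient.trans_symm, Quotient.trans_refl] using this

end qt

/-! ### Maps rel boundary -/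

/-- boundary points of the simplex -/
def bdry {r : ℕ} (x : Sx r) : Prop := ∃ i, x.1 i = 0

/-- maps agreeing with `ρ` on the boundary -/
def Yb {Z : Type} [TopologicalSpace Z] {r : ℕ} (ρ : C(Sx r, Z)) : Type :=
  {f : C(Sx r, Z) // ∀ x, bdry x → f x = ρ x}

instance {Z : Type} [TopologicalSpace Z] {r : ℕ} (ρ : C(Sx r, Z)) : TopologicalSpace (Yb ρ) :=
  inferInstanceAs (TopologicalSpace {f : C(Sx r, Z) // ∀ x, bdry x → f x = ρ x})

instance cpSx (r : ℕ) : CompactSpace (Sx r) :=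
  isCompact_iff_compactSpace.1 (isCompact_stdSimplex ℝ (Fin (r + 1)))

section yb
variable {Z : Type} [TopologicalSpace Z] {r : ℕ} {ρ : C(Sx r, Z)}
variable {T' : Type} [TopologicalSpace T']

def toY (F : C(T' × Sx r, Z)) (h : ∀ t x, bdry x → F (t, x) = ρ x) : C(T', Yb ρ) :=
  ⟨fun t => ⟨F.curry t, fun x hx => h t x hx⟩, by
    exact Continuous.subtype_mk F.curry.continuous _⟩

theorem toY_apply (F : C(T' × Sx r, Z)) (h : ∀ t x, bdry x → F (t, x) = ρ x) (t x) :
    (toY F h t).1 x = F (t, x) := rfl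

def toP (F : C(𝕀 × Sx r, Z)) (h : ∀ t x, bdry x → F (t, x) = ρ x) {y0 y1 : Yb ρ}
    (h0 : ∀ x, F (0, x) = y0.1 x) (h1 : ∀ x, F (1, x) = y1.1 x) : Path y0 y1 :=
  ⟨toY F h, Subtype.ext (ContinuousMap.ext h0), Subtype.ext (ContinuousMap.ext h1)⟩

theorem toP_apply (F : C(𝕀 × Sx r, Z)) (h : ∀ t x, bdry x → F (t, x) = ρ x) {y0 y1 : Yb ρ}
    (h0 : ∀ x, F (0, x) = y0.1 x) (h1 : ∀ x, F (1, x) = y1.1 x) (t x) :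
    (toP F h h0 h1 t).1 x = F (t, x) := rfl

def ofY (f : C(T', Yb ρ)) : C(T' × Sx r, Z) :=
  ⟨fun p => (f p.1).1 p.2, by
    have h1 : Continuous fun p : T' × Sx r => (f p.1).1 :=
      continuous_subtype_val.comp (f.continuous.comp continuous_fst)
    exact ContinuousEval.continuous_eval.comp (h1.prodMk continuous_snd)⟩

theorem ofY_apply (f : C(T', Yb ρ)) (t x) : ofY f (t, x) = (f t).1 x := rfl

theorem yb_ext {f g : Yb ρ} (h : ∀ x, f.1 x = g.1 x) : f = g :=
  Subtype.ext (ContinuousMap.ext h)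

end yb

/-! ### Radial geometry of the simplex -/

section rad
variable {r : ℕ}

/-- gauge -/
def gau (v : Fin (r + 1) → ℝ) : ℝ := (r + 1) * Finset.univ.sup' Finset.univ_nonempty fun i => - v i

theorem gau_cont : Continuous (gau : (Fin (r + 1) → ℝ) → ℝ) := by
  unfold gau
  refine continuous_const.mul ?_
  refine Continuous.finset_sup'_apply _ fun i _ => ?_
  fun_prop

theorem le_gau (v : Fin (r + 1) → ℝ) (i) : (r + 1) * (- v i) ≤ gau v :=
  mul_le_mul_of_nonneg_left (Finset.le_sup' (fun i => - v i) (Finset.mem_univ i)) (by positivity)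

theorem exists_gau (v : Fin (r + 1) → ℝ) : ∃ i, gau v = (r + 1) * (- v i) := by
  obtain ⟨i, -, hi⟩ := Finset.exists_mem_eq_sup' Finset.univ_nonempty fun i => - v i
  exact ⟨i, by rw [gau, hi]⟩

theorem gau_smul (v : Fin (r + 1) → ℝ) {s : ℝ} (hs : 0 ≤ s) : gau (s • v) = s * gau v := by
  apply le_antisymm
  · obtain ⟨i, hi⟩ := exists_gau (s • v)
    rw [hi]
    have := mul_le_mul_of_nonneg_left (le_gau v i) hs
    simp only [Pi.smul_apply, smul_eq_mul]
    linarith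
  · obtain ⟨i, hi⟩ := exists_gau v
    have := le_gau (s • v) i
    rw [hi]
    simp only [Pi.smul_apply, smul_eq_mul] at this
    linarith

/-- centering -/
def cen (v : Fin (r + 1) → ℝ) : Fin (r + 1) → ℝ := fun i => v i - (∑ j, v j) / (r + 1)

theorem cen_sum (v : Fin (r + 1) → ℝ) : ∑ i, cen v i = 0 := by
  have : ((r : ℝ) + 1) ≠ 0 := by positivity
  simp only [cen, Finset.sum_sub_distrib, Finset.sum_const, Finset.card_univ, Fintype.card_fin,
    nsmul_eq_mul]
  push_cast
  field_simp
  ring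

theorem cen_eq {v : Fin (r + 1) → ℝ} (h : ∑ j, v j = 0) : cen v = v := by
  ext i; simp [cen, h]

theorem cen_cont : Continuous (cen : (Fin (r + 1) → ℝ) → _) := by
  unfold cen; fun_prop

/-- radial retraction to the simplex -/
def rad : C(Fin (r + 1) → ℝ, Sx r) where
  toFun v := ⟨fun i => 1 / (r + 1) + cen v i / max 1 (gau (cen v)), by
    have hr : (0 : ℝ) < r + 1 := by positivity
    have hm : (0 : ℝ) < max 1 (gau (cen v)) := lt_max_of_lt_left one_pos
    constructor
    · intro i
      have h1 := le_gau (cen v) i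
      have h2 : (r + 1) * (- cen v i) ≤ max 1 (gau (cen v)) := h1.trans (le_max_right _ _)
      have h3 : - (cen v i / max 1 (gau (cen v))) ≤ 1 / (r + 1) := by
        rw [← neg_div, div_le_div_iff₀ hm hr]
        linarith
      show (0 : ℝ) ≤ 1 / (r + 1) + cen v i / max 1 (gau (cen v))
      linarith
    · rw [Finset.sum_add_distrib, ← Finset.sum_div Finset.univ (cen v), cen_sum]
      simp only [Finset.sum_const, Finset.card_univ, Fintype.card_fin, nsmul_eq_mul]
      push_cast
      field_simp
      simp⟩
  continuous_toFun := by
    refine Continuous.subtype_mk (continuous_pi fun i => continuous_const.add ?_) _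
    refine Continuous.div ((continuous_apply i).comp cen_cont)
      (continuous_const.max (gau_cont.comp cen_cont)) fun v => ?_
    exact (lt_max_of_lt_left one_pos).ne'

theorem rad_apply {v : Fin (r + 1) → ℝ} (h : ∑ j, v j = 0) (i) :
    (rad v).1 i = 1 / (r + 1) + v i / max 1 (gau v) := by
  show 1 / ((r : ℝ) + 1) + cen v i / max 1 (gau (cen v)) = _
  rw [cen_eq h]

theorem rad_bdry {v : Fin (r + 1) → ℝ} (h : ∑ j, v j = 0) (hg : 1 ≤ gau v) : bdry (rad v) := by
  obtain ⟨i, hi⟩ := exists_gau v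
  refine ⟨i, ?_⟩
  have hr : (0 : ℝ) < r + 1 := by positivity
  have hv : v i ≠ 0 := by
    intro h0; rw [hi, h0] at hg; norm_num at hg
  rw [rad_apply h, max_eq_right hg, hi]
  field_simp
  simp

/-- centered coordinates -/
def ctr (x : Sx r) : Fin (r + 1) → ℝ := fun i => x.1 i - 1 / (r + 1)

theorem ctr_cont : Continuous (ctr : Sx r → _) := by
  unfold ctr; fun_prop

theorem ctr_sum (x : Sx r) : ∑ i, ctr x i = 0 := by
  have : ∑ i, x.1 i = 1 := x.2.2
  simp only [ctr, Finset.sum_sub_distrib, this, Finset.sum_const, Finset.card_univ,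
    Fintype.card_fin, nsmul_eq_mul]
  push_cast
  field_simp
  simp

theorem gau_ctr_le (x : Sx r) : gau (ctr x) ≤ 1 := by
  obtain ⟨i, hi⟩ := exists_gau (ctr x)
  have hr : (0 : ℝ) < r + 1 := by positivity
  rw [hi, ctr]
  have := x.2.1 i
  have : ((r : ℝ) + 1) * (-(x.1 i - 1 / (r + 1))) = 1 - (r + 1) * x.1 i := by field_simp; ring
  rw [this]
  have : 0 ≤ ((r : ℝ) + 1) * x.1 i := mul_nonneg hr.le (x.2.1 i)
  linarith

theorem gau_ctr_bdry {x : Sx r} (h : bdry x) : gau (ctr x) = 1 := by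
  refine le_antisymm (gau_ctr_le x) ?_
  obtain ⟨i, hi⟩ := h
  refine le_trans ?_ (le_gau _ i)
  rw [ctr, hi]
  have hr : (0 : ℝ) < r + 1 := by positivity
  field_simp
  norm_num

theorem rad_ctr (x : Sx r) : rad (ctr x) = x := by
  apply Subtype.ext
  ext i
  rw [rad_apply (ctr_sum x), max_eq_left (gau_ctr_le x), ctr]
  ring

theorem smul_sum0 {v : Fin (r + 1) → ℝ} (h : ∑ j, v j = 0) (s : ℝ) : ∑ j, (s • v) j = 0 := by
  simp only [Pi.smul_apply, smul_eq_mul, ← Finset.mul_sum, h, mul_zero]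

end rad

/-! ### Commutativity: the constant case -/

section comm
variable {r : ℕ}

def shrV (η : Fin (r + 1) → ℝ) (w : ℝ) (x : Sx r) : Fin (r + 1) → ℝ :=
  (1 + w * (2 * r + 1)) • (ctr x - w • η)

theorem shrV_cont (η : Fin (r + 1) → ℝ) : Continuous fun p : ℝ × Sx r => shrV η p.1 p.2 := by
  unfold shrV
  have := ctr_cont (r := r)
  fun_prop

theorem shrV_sum {η : Fin (r + 1) → ℝ} (h : ∑ i, η i = 0) (w : ℝ) (x : Sx r) :
    ∑ i, shrV η w x i = 0 := by
  apply smul_sum0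
  simp only [Pi.sub_apply, Finset.sum_sub_distrib, ctr_sum, smul_sum0 h, sub_zero]

theorem shrV_bdry {η : Fin (r + 1) → ℝ} (hη : ∀ i, - (1 / (2 * (r + 1))) ≤ η i) {w : ℝ}
    (h0 : 0 ≤ w) (h1 : w ≤ 1) {x : Sx r} (hx : bdry x) : 1 ≤ gau (shrV η w x) := by
  obtain ⟨i, hi⟩ := hx
  refine le_trans ?_ (le_gau _ i)
  have hr : (0 : ℝ) < r + 1 := by positivity
  have e : shrV η w x i = (1 + w * (2 * r + 1)) * (- (1 / (r + 1)) - w * η i) := by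
    simp [shrV, ctr, hi]
  rw [e]
  have h2 : w * (-(1 / (2 * (r + 1)))) ≤ w * η i := mul_le_mul_of_nonneg_left (hη i) h0
  have h3 : 1 - w / 2 ≤ (r + 1) * (1 / (r + 1) + w * η i) := by
    have : ((r : ℝ) + 1) * (1 / (r + 1) + w * (-(1 / (2 * (r + 1))))) = 1 - w / 2 := by
      field_simp
      ring
    rw [← this]
    exact mul_le_mul_of_nonneg_left (by linarith) hr.le
  have hs : (0 : ℝ) ≤ 1 + w * (2 * r + 1) := by positivity
  have h4 := mul_le_mul_of_nonneg_left h3 hs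
  have hr0 : (0 : ℝ) ≤ r := by positivity
  have h5 : 1 ≤ (1 + w * (2 * r + 1)) * (1 - w / 2) := by
    nlinarith [mul_nonneg h0 hr0, mul_nonneg (mul_nonneg h0 hr0) (sub_nonneg.2 h1),
      mul_nonneg h0 (sub_nonneg.2 h1)]
  calc (1 : ℝ) ≤ _ := h5
    _ ≤ _ := h4
    _ = _ := by ring

variable {Z : Type} [TopologicalSpace Z] {z0 : Z}

abbrev cst (r : ℕ) (z0 : Z) : C(Sx r, Z) := ContinuousMap.const _ z0

def ybase (ρ : C(Sx r, Z)) : Yb ρ := ⟨ρ, fun _ _ => rfl⟩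

def shrC (η : Fin (r + 1) → ℝ) : C(𝕀 × Sx r, Sx r) :=
  ⟨fun p => rad (shrV η p.1 p.2), by
    have := shrV_cont η
    exact rad.continuous.comp (this.comp (by fun_prop :
      Continuous fun p : 𝕀 × Sx r => ((p.1 : ℝ), p.2)))⟩

theorem shrC_bdry {η : Fin (r + 1) → ℝ} (h : ∑ i, η i = 0)
    (hη : ∀ i, - (1 / (2 * (r + 1))) ≤ η i) (w : 𝕀) {x : Sx r} (hx : bdry x) :
    bdry (shrC η (w, x)) :=
  rad_bdry (shrV_sum h _ _) (shrV_bdry hη w.2.1 w.2.2 hx)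

theorem shrC_zero (η : Fin (r + 1) → ℝ) (x : Sx r) : shrC η (0, x) = x := by
  have : shrV η 0 x = ctr x := by simp [shrV]
  show rad (shrV η 0 x) = x
  rw [this, rad_ctr]

/-- compressed loop -/
def cmpr (a : Path (ybase (cst r z0)) (ybase (cst r z0))) {η : Fin (r + 1) → ℝ}
    (h : ∑ i, η i = 0) (hη : ∀ i, - (1 / (2 * (r + 1))) ≤ η i) :
    Path (ybase (cst r z0)) (ybase (cst r z0)) :=
  toP (ρ := cst r z0) ⟨fun p => (ofY a.toContinuousMap) (p.1, shrC η (1, p.2)), by fun_prop⟩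
    (fun t x hx => (a t).2 _ (shrC_bdry h hη 1 hx))
    (fun x => by
      show (a 0).1 _ = _
      rw [a.source]; rfl)
    (fun x => by
      show (a 1).1 _ = _
      rw [a.target]; rfl)

theorem cmpr_hom (a : Path (ybase (cst r z0)) (ybase (cst r z0))) {η : Fin (r + 1) → ℝ}
    (h : ∑ i, η i = 0) (hη : ∀ i, - (1 / (2 * (r + 1))) ≤ η i) :
    a.Homotopic (cmpr a h hη) := by
  have := square_hom a (Path.refl _) (Path.refl _) (cmpr a h hη)
    (toY ⟨fun p => (ofY a.toContinuousMap) (p.1.1, shrC η (p.1.2, p.2)), by fun_prop⟩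
      (fun t x hx => (a t.1).2 _ (shrC_bdry h hη t.2 hx)))
    (fun u => yb_ext fun x => by
      show (a u).1 _ = _
      rw [shrC_zero])
    (fun u => yb_ext fun x => by
      show (a 1).1 _ = _
      rw [a.target]; rfl)
    (fun u => yb_ext fun x => by
      show (a 0).1 _ = _
      rw [a.source]; rfl)
    (fun u => yb_ext fun x => rfl)
  exact ((Path.Homotopic.trans_refl a).symm.trans this).trans (Path.Homotopic.refl_trans _)

theorem cmpr_comm (a b : Path (ybase (cst r z0)) (ybase (cst r z0))) {η : Fin (r + 1) → ℝ}
    (h : ∑ i, η i = 0) (hη : ∀ i, - (1 / (2 * (r + 1))) ≤ η i)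
    (h' : ∑ i, (-η) i = 0) (hη' : ∀ i, - (1 / (2 * (r + 1))) ≤ (-η) i)
    (hdis : ∀ x, gau (shrV η 1 x) ≤ 1 → 1 ≤ gau (shrV (-η) 1 x)) :
    ((cmpr a h hη).trans (cmpr b h' hη')).Homotopic ((cmpr b h' hη').trans (cmpr a h hη)) := by
  classical
  have ca := shrV_cont η
  have outa : ∀ t x, 1 ≤ gau (shrV η 1 x) → (a t).1 (shrC η (1, x)) = z0 := fun t x hx =>
    (a t).2 _ (rad_bdry (shrV_sum h _ _) hx)
  have outb : ∀ t x, 1 ≤ gau (shrV (-η) 1 x) → (b t).1 (shrC (-η) (1, x)) = z0 := fun t x hx =>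
    (b t).2 _ (rad_bdry (shrV_sum h' _ _) hx)
  let F : C((𝕀 × 𝕀) × Sx r, Z) := ⟨fun p => if gau (shrV η 1 p.2) ≤ 1 then
      (ofY a.toContinuousMap) (p.1.1, shrC η (1, p.2)) else
      (ofY b.toContinuousMap) (p.1.2, shrC (-η) (1, p.2)), by
    refine Continuous.if_le (by fun_prop) (by fun_prop) ?_ continuous_const ?_
    · exact gau_cont.comp (ca.comp (by fun_prop : Continuous fun p : (𝕀 × 𝕀) × Sx r => ((1 : ℝ), p.2)))
    · rintro ⟨t, x⟩ hx
      rw [ofY_apply, ofY_apply]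
      show (a _).1 _ = (b _).1 _
      rw [outa _ _ hx.ge, outb _ _ (hdis _ hx.le)]⟩
  have FE : ∀ t u x, F ((t, u), x) = if gau (shrV η 1 x) ≤ 1 then (a t).1 (shrC η (1, x)) else
      (b u).1 (shrC (-η) (1, x)) := fun t u x => rfl
  have FB : ∀ t x, bdry x → F (t, x) = cst r z0 x := by
    rintro ⟨t, u⟩ x hx
    rw [FE]
    split_ifs
    · exact outa _ _ (shrV_bdry hη zero_le_one le_rfl hx)
    · exact outb _ _ (shrV_bdry hη' zero_le_one le_rfl hx)
  have b0 : ∀ x, (b 0).1 x = z0 := fun x => by rw [b.source]; rfl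
  have b1 : ∀ x, (b 1).1 x = z0 := fun x => by rw [b.target]; rfl
  have a0 : ∀ x, (a 0).1 x = z0 := fun x => by rw [a.source]; rfl
  have a1 : ∀ x, (a 1).1 x = z0 := fun x => by rw [a.target]; rfl
  refine square_hom _ _ _ _ (toY F FB) ?_ ?_ ?_ ?_
  · refine fun u => yb_ext fun x => ?_
    show F ((u, 0), x) = (a u).1 (shrC η (1, x))
    rw [FE]
    split_ifs with hc
    · rfl
    · rw [b0, outa _ _ (not_le.1 hc).le]
  · refine fun u => yb_ext fun x => ?_
    show F ((1, u), x) = (b u).1 (shrC (-η) (1, x))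
    rw [FE]
    split_ifs with hc
    · rw [a1, outb _ _ (hdis _ hc)]
    · rfl
  · refine fun u => yb_ext fun x => ?_
    show F ((0, u), x) = (b u).1 (shrC (-η) (1, x))
    rw [FE]
    split_ifs with hc
    · rw [a0, outb _ _ (hdis _ hc)]
    · rfl
  · refine fun u => yb_ext fun x => ?_
    show F ((u, 1), x) = (a u).1 (shrC η (1, x))
    rw [FE]
    split_ifs with hc
    · rfl
    · rw [b1, outa _ _ (not_le.1 hc).le]

theorem comm_cst (hr : 1 ≤ r) (a b : Path (ybase (cst r z0)) (ybase (cst r z0))) :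
    (a.trans b).Homotopic (b.trans a) := by
  let η : Fin (r + 1) → ℝ := fun i => if i = 0 then 1 / (2 * (r + 1)) else
    if i = 1 then - (1 / (2 * (r + 1))) else 0
  have hr' : (0 : ℝ) < r + 1 := by positivity
  have hpos : (0 : ℝ) < 1 / (2 * (r + 1)) := by positivity
  have h01 : (1 : Fin (r + 1)) ≠ 0 := by
    rw [Ne, Fin.one_eq_zero_iff]
    omega
  have η1 : η 1 = - (1 / (2 * (r + 1))) := by simp [η, h01]
  have h : ∑ i, η i = 0 := by
    have : ∀ i, η i = (if i = 0 then 1 / (2 * ((r : ℝ) + 1)) else 0) +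
        (if i = 1 then - (1 / (2 * ((r : ℝ) + 1))) else 0) := by
      intro i
      simp only [η]
      by_cases h0 : i = 0
      · subst h0; simp [h01.symm]
      · simp [h0]
    simp only [this, Finset.sum_add_distrib, Finset.sum_ite_eq', Finset.mem_univ, if_true]
    ring
  have hη : ∀ i, - (1 / (2 * (r + 1))) ≤ η i := by
    intro i; simp only [η]; split_ifs <;> linarith
  have h' : ∑ i, (-η) i = 0 := by simp [h]
  have hη' : ∀ i, - (1 / (2 * (r + 1))) ≤ (-η) i := by
    intro i; simp only [η, Pi.neg_apply]; split_ifs <;> linarith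
  have hdis : ∀ x, gau (shrV η 1 x) ≤ 1 → 1 ≤ gau (shrV (-η) 1 x) := by
    intro x hx
    let u : Fin (r + 1) → ℝ := ctr x - η
    have hu : ∑ i, u i = 0 := by
      simp [u, Finset.sum_sub_distrib, ctr_sum, h]
    have e : ∀ i, shrV η 1 x i = (2 * (r + 1)) * u i := by
      intro i; simp [shrV, u]; ring_nf; simp
    have e' : shrV (-η) 1 x 1 = (2 * (r + 1)) * (u 1 - 1 / (r + 1)) := by
      have : shrV (-η) 1 x 1 = (2 * (r + 1)) * (u 1 + 2 * η 1) := by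
        simp [shrV, u]; ring
      rw [this, η1]
      field_simp
      ring
    have hlow : ∀ i, - (1 / (2 * (r + 1) ^ 2)) ≤ u i := by
      intro i
      have := (le_gau (shrV η 1 x) i).trans hx
      rw [e] at this
      rw [neg_le, le_div_iff₀ (by positivity)]
      linarith
    have hup : u 1 ≤ r * (1 / (2 * (r + 1) ^ 2)) := by
      have h2 := Finset.add_sum_erase Finset.univ u (Finset.mem_univ 1)
      rw [hu] at h2
      have h3 := Finset.card_nsmul_le_sum (Finset.univ.erase (1 : Fin (r + 1))) u _
        fun i _ => hlow i
      rw [Finset.card_erase_of_mem (Finset.mem_univ _), Finset.card_univ, Fintype.card_fin,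
        nsmul_eq_mul, Nat.add_sub_cancel] at h3
      linarith
    refine le_trans ?_ (le_gau _ 1)
    rw [e']
    have h4 : ((r : ℝ) + 1) * (2 * (r + 1) * (r * (1 / (2 * (r + 1) ^ 2)) - 1 / (r + 1))) = - r - 2 := by
      field_simp
      ring
    have h5 : ((r : ℝ) + 1) * (2 * (r + 1) * (u 1 - 1 / (r + 1))) ≤ - r - 2 := by
      rw [← h4]
      refine mul_le_mul_of_nonneg_left (mul_le_mul_of_nonneg_left ?_ (by positivity)) hr'.le
      linarith
    linarith
  have k1 := cmpr_hom a h hη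
  have k2 := cmpr_hom b h' hη'
  exact ((k1.hcomp k2).trans (cmpr_comm a b h hη h' hη' hdis)).trans (k2.symm.hcomp k1.symm)

end comm

/-! ### Commutativity: the general case -/

section comm2
variable {r : ℕ} {Z : Type} [TopologicalSpace Z]

/-- slope -/
def slp (w : ℝ) : ℝ := 1 + 2 * w

/-- zigzag factor -/
def kap (w l : ℝ) : ℝ :=
  min (slp w) (max (2 / max l (1 / 3) - slp w) (slp w - (slp w - 1) / max l (1 / 3)))

theorem kap_cont : Continuous fun p : ℝ × ℝ => kap p.1 p.2 := by
  have h : ∀ p : ℝ × ℝ, max p.2 (1 / 3) ≠ 0 := fun p =>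
    (lt_of_lt_of_le (by norm_num) (le_max_right _ _)).ne'
  unfold kap slp
  refine Continuous.min (by fun_prop) (Continuous.max ?_ ?_)
  · exact (Continuous.div (by fun_prop) (by fun_prop) h).sub (by fun_prop)
  · exact Continuous.sub (by fun_prop) (Continuous.div (by fun_prop) (by fun_prop) h)

theorem kap_edge {w l : ℝ} (h0 : 0 ≤ w) (h1 : w ≤ 1) (h : slp w * l = 1) : kap w l = slp w := by
  have hs : 1 ≤ slp w := by unfold slp; linarith
  have hs3 : slp w ≤ 3 := by unfold slp; linarith
  have hl : l = 1 / slp w := by field_simp; linarith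
  have h3 : 1 / 3 ≤ l := by rw [hl]; exact one_div_le_one_div_of_le (by linarith) hs3
  unfold kap
  rw [max_eq_left h3]
  refine min_eq_left (le_max_of_le_left ?_)
  rw [hl]
  have : 2 / (1 / slp w) = 2 * slp w := by field_simp
  linarith

theorem kap_one {w : ℝ} (h0 : 0 ≤ w) : kap w 1 = 1 := by
  unfold kap
  rw [max_eq_left (by norm_num : (1 / 3 : ℝ) ≤ 1)]
  have : slp w - (slp w - 1) / 1 = 1 := by ring
  rw [this, max_eq_right (by unfold slp; linarith), min_eq_right (by unfold slp; linarith)]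

theorem kap_mid : kap 1 (2 / 3) = 0 := by
  norm_num [kap, slp]

/-- the base tracks -/
def trk (ρ : C(Sx r, Z)) (F : C(𝕀, Yb ρ)) : C((𝕀 × 𝕀) × Sx r, Z) := by
  classical
  exact ⟨fun p => if slp p.1.2 * gau (ctr p.2) ≤ 1 then
      ofY F (p.1.1, rad (slp p.1.2 • ctr p.2)) else
      ρ (rad (kap p.1.2 (gau (ctr p.2)) • ctr p.2)), by
    have hc := ctr_cont (r := r)
    have hg := gau_cont (r := r)
    have hs : Continuous slp := by unfold slp; fun_prop
    have hgc : Continuous fun p : (𝕀 × 𝕀) × Sx r => gau (ctr p.2) := hg.comp (hc.comp continuous_snd)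
    have hk : Continuous fun p : (𝕀 × 𝕀) × Sx r => kap p.1.2 (gau (ctr p.2)) :=
      kap_cont.comp ((by fun_prop : Continuous fun p : (𝕀 × 𝕀) × Sx r => (p.1.2 : ℝ)).prodMk hgc)
    refine Continuous.if_le (by fun_prop) (by fun_prop) ?_ continuous_const ?_
    · exact Continuous.mul (by fun_prop) hgc
    · rintro ⟨⟨t, w⟩, x⟩ h
      rw [ofY_apply]
      show (F t).1 _ = ρ (rad (kap w (gau (ctr x)) • ctr x))
      rw [kap_edge w.2.1 w.2.2 h]
      refine (F t).2 _ (rad_bdry (smul_sum0 (ctr_sum x) _) ?_)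
      rw [gau_smul _ (by have := w.2.1; unfold slp; linarith)]
      exact h.ge⟩

theorem trk_in {ρ : C(Sx r, Z)} (F : C(𝕀, Yb ρ)) {t w : 𝕀} {x : Sx r}
    (h : slp w * gau (ctr x) ≤ 1) : trk ρ F ((t, w), x) = (F t).1 (rad (slp w • ctr x)) := if_pos h

theorem trk_out {ρ : C(Sx r, Z)} (F : C(𝕀, Yb ρ)) {t w : 𝕀} {x : Sx r}
    (h : ¬ slp w * gau (ctr x) ≤ 1) :
    trk ρ F ((t, w), x) = ρ (rad (kap w (gau (ctr x)) • ctr x)) := if_neg h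

theorem trk_zero {ρ : C(Sx r, Z)} (F : C(𝕀, Yb ρ)) (t : 𝕀) (x : Sx r) :
    trk ρ F ((t, 0), x) = (F t).1 x := by
  have hs : slp ((0 : 𝕀) : ℝ) = 1 := by simp [slp]
  rw [trk_in, hs, one_smul, rad_ctr]
  rw [hs, one_mul]
  exact gau_ctr_le x

theorem trk_bdry {ρ : C(Sx r, Z)} (F : C(𝕀, Yb ρ)) (t : 𝕀 × 𝕀) (x : Sx r) (hx : bdry x) :
    trk ρ F (t, x) = ρ x := by
  obtain ⟨t, w⟩ := t
  by_cases h : slp w * gau (ctr x) ≤ 1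
  · have hw : slp w = 1 := by
      rw [gau_ctr_bdry hx] at h
      have := w.2.1
      unfold slp at h ⊢
      linarith
    rw [trk_in F h, hw, one_smul, rad_ctr]
    exact (F t).2 x hx
  · rw [trk_out F h, gau_ctr_bdry hx, kap_one w.2.1, one_smul, rad_ctr]

/-- insertion of spheres at the middle -/
def ins (ρ : C(Sx r, Z)) : C(Yb (cst r (ρ (bary r))), Yb ρ) := by
  classical
  refine toY ⟨fun p => if 3 / 2 * gau (ctr p.2) ≤ 1 then
      ofY (ContinuousMap.id _) (p.1, rad ((3 / 2 : ℝ) • ctr p.2)) else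
      ρ (rad (kap 1 (gau (ctr p.2)) • ctr p.2)), ?_⟩ ?_
  · have hc := ctr_cont (r := r)
    have hg := gau_cont (r := r)
    have hgc : Continuous fun p : Yb (cst r (ρ (bary r))) × Sx r => gau (ctr p.2) :=
      hg.comp (hc.comp continuous_snd)
    have hk : Continuous fun p : Yb (cst r (ρ (bary r))) × Sx r => kap 1 (gau (ctr p.2)) :=
      kap_cont.comp (continuous_const.prodMk hgc)
    refine Continuous.if_le (by fun_prop) (by fun_prop) ?_ continuous_const ?_
    · exact continuous_const.mul hgc
    · rintro ⟨f, x⟩ h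
      rw [ofY_apply]
      show f.1 _ = ρ (rad (kap 1 (gau (ctr x)) • ctr x))
      have hl : gau (ctr x) = 2 / 3 := by
        have : 3 / 2 * gau (ctr x) = 1 := h
        linarith
      rw [hl, kap_mid, zero_smul, f.2 _ (rad_bdry (smul_sum0 (ctr_sum x) _) ?_)]
      · show ρ _ = ρ _
        congr 1
        apply Subtype.ext
        ext i
        rw [rad_apply (by simp)]
        simp [bary]
      · rw [gau_smul _ (by norm_num), hl]; norm_num
  · intro f x hx
    show (if 3 / 2 * gau (ctr x) ≤ 1 then _ else _) = _
    rw [if_neg (by rw [gau_ctr_bdry hx]; norm_num), gau_ctr_bdry hx, kap_one zero_le_one, one_smul,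
      rad_ctr]

open scoped Classical in
theorem ins_apply (ρ : C(Sx r, Z)) (f : Yb (cst r (ρ (bary r)))) (x : Sx r) :
    (ins ρ f).1 x = if 3 / 2 * gau (ctr x) ≤ 1 then f.1 (rad ((3 / 2 : ℝ) • ctr x)) else
      ρ (rad (kap 1 (gau (ctr x)) • ctr x)) := by
  by_cases h : 3 / 2 * gau (ctr x) ≤ 1
  · rw [if_pos h]; exact if_pos h
  · rw [if_neg h]; exact if_neg h

theorem gau_rad {v : Fin (r + 1) → ℝ} (h : ∑ j, v j = 0) (hg : gau v ≤ 1) : ctr (rad v) = v := by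
  ext i
  rw [ctr, rad_apply h, max_eq_left hg]
  ring

/-- the extracted sphere -/
def ext0 (ρ : C(Sx r, Z)) (F : C(𝕀, Yb ρ)) : C(𝕀, Yb (cst r (ρ (bary r)))) :=
  toY ⟨fun p => trk ρ F ((p.1, 1), rad ((2 / 3 : ℝ) • ctr p.2)), by
      have hc := ctr_cont (r := r)
      fun_prop⟩ (by
    intro t x hx
    have hg : gau ((2 / 3 : ℝ) • ctr x) = 2 / 3 := by
      rw [gau_smul _ (by norm_num), gau_ctr_bdry hx]; norm_num
    have hc : ctr (rad ((2 / 3 : ℝ) • ctr x)) = (2 / 3 : ℝ) • ctr x :=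
      gau_rad (smul_sum0 (ctr_sum x) _) (by rw [hg]; norm_num)
    show trk ρ F ((t, 1), rad ((2 / 3 : ℝ) • ctr x)) = ρ (bary r)
    rw [trk_out, hc, hg, Set.Icc.coe_one, kap_mid, zero_smul]
    · congr 1
      apply Subtype.ext
      ext i
      rw [rad_apply (by simp)]
      simp [bary]
    · rw [hc, hg]; norm_num [slp])

theorem ins_ext0 (ρ : C(Sx r, Z)) (F : C(𝕀, Yb ρ)) (t : 𝕀) (x : Sx r) :
    (ins ρ (ext0 ρ F t)).1 x = trk ρ F ((t, 1), x) := by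
  rw [ins_apply]
  split_ifs with h
  · show trk ρ F ((t, 1), rad ((2 / 3 : ℝ) • ctr (rad ((3 / 2 : ℝ) • ctr x)))) = _
    rw [gau_rad (smul_sum0 (ctr_sum x) _) (by rwa [gau_smul _ (by norm_num)]), smul_smul]
    norm_num
    rw [rad_ctr]
  · rw [trk_out, Set.Icc.coe_one]
    intro h'
    apply h
    rw [Set.Icc.coe_one] at h'
    norm_num [slp] at h'
    linarith

theorem trk_const (ρ : C(Sx r, Z)) (F : C(𝕀, Yb ρ)) (t : 𝕀) (h : F t = ybase ρ) (x : Sx r) :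
    trk ρ F ((t, 1), x) = ρ (rad (kap 1 (gau (ctr x)) • ctr x)) := by
  by_cases hx : slp ((1 : 𝕀) : ℝ) * gau (ctr x) ≤ 1
  · rw [trk_in F hx, h]
    have : kap 1 (gau (ctr x)) = slp 1 := by
      have h2 : gau (ctr x) ≤ 1 / 3 := by
        norm_num [slp] at hx; linarith
      unfold kap
      rw [max_eq_right h2]
      norm_num [slp]
    rw [this]
    rfl
  · rw [trk_out F hx]; rfl

theorem trk_congr (ρ : C(Sx r, Z)) (F F' : C(𝕀, Yb ρ)) (t t' w : 𝕀) (h : F t = F' t') (x : Sx r) :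
    trk ρ F ((t, w), x) = trk ρ F' ((t', w), x) := by
  by_cases hx : slp (w : ℝ) * gau (ctr x) ≤ 1
  · rw [trk_in F hx, trk_in F' hx, h]
  · rw [trk_out F hx, trk_out F' hx]

theorem ext0_congr (ρ : C(Sx r, Z)) (F F' : C(𝕀, Yb ρ)) (t t' : 𝕀) (h : F t = F' t') :
    ext0 ρ F t = ext0 ρ F' t' := yb_ext fun x => trk_congr ρ F F' t t' 1 h _

theorem rad_zero : (rad (0 : Fin (r + 1) → ℝ)) = bary r := by
  apply Subtype.ext
  ext i
  rw [rad_apply (by simp)]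
  simp [bary]

theorem comm_joined (hr : 1 ≤ r) {z0 : Z} {g : Yb (cst r z0)}
    (k : Path g (ybase (cst r z0))) (A B : Path g g) :
    (Path.Homotopic.Quotient.mk A).trans (.mk B) = (Path.Homotopic.Quotient.mk B).trans (.mk A) := by
  have key : ∀ A : Path g g, (Path.Homotopic.Quotient.mk A).trans (.mk k) =
      (Path.Homotopic.Quotient.mk k).trans (.mk (k.symm.trans (A.trans k))) := by
    intro A
    rw [Path.Homotopic.Quotient.mk_trans, Path.Homotopic.Quotient.mk_trans, ← Path.Homotopic.Quotient.trans_assoc,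
      Path.Homotopic.Quotient.mk_symm, Path.Homotopic.Quotient.trans_symm,
      Path.Homotopic.Quotient.refl_trans]
  refine comm_conj _ _ (.mk k) _ _ (key A) (key B) ?_
  rw [← Path.Homotopic.Quotient.mk_trans, ← Path.Homotopic.Quotient.mk_trans]
  exact Path.Homotopic.Quotient.eq.2 (comm_cst hr _ _)

/-- For `r ≥ 1`, loops of maps rel boundary commute. -/
theorem comm_yb (hr : 1 ≤ r) (ρ : C(Sx r, Z)) (a b : Path (ybase ρ) (ybase ρ)) :
    (Path.Homotopic.Quotient.mk a).trans (.mk b) = (Path.Homotopic.Quotient.mk b).trans (.mk a) := by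
  -- the constant loop
  let F0 : C(𝕀, Yb ρ) := ContinuousMap.const _ (ybase ρ)
  let g : Yb (cst r (ρ (bary r))) := ext0 ρ F0 0
  let k : Path g (ybase (cst r (ρ (bary r)))) := toP
    ⟨fun p => ρ (rad (((1 - (p.1 : ℝ)) * kap 1 (2 / 3 * gau (ctr p.2)) * (2 / 3)) • ctr p.2)), by
      have hc := ctr_cont (r := r)
      have hg := gau_cont (r := r)
      have hgc : Continuous fun p : 𝕀 × Sx r => gau (ctr p.2) := hg.comp (hc.comp continuous_snd)
      have hk : Continuous fun p : 𝕀 × Sx r => kap 1 (2 / 3 * gau (ctr p.2)) :=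
        kap_cont.comp (continuous_const.prodMk (continuous_const.mul hgc))
      fun_prop⟩
    (by
      intro t x hx
      show ρ _ = ρ _
      rw [gau_ctr_bdry hx, mul_one, kap_mid, mul_zero, zero_mul, zero_smul, rad_zero])
    (by
      intro x
      have hg : gau ((2 / 3 : ℝ) • ctr x) = 2 / 3 * gau (ctr x) := gau_smul _ (by norm_num)
      have hc : ctr (rad ((2 / 3 : ℝ) • ctr x)) = (2 / 3 : ℝ) • ctr x :=
        gau_rad (smul_sum0 (ctr_sum x) _) (by
          rw [hg]; have := gau_ctr_le x; linarith)
      show ρ (rad (((1 - ((0 : 𝕀) : ℝ)) * kap 1 (2 / 3 * gau (ctr x)) * (2 / 3)) • ctr x)) =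
        trk ρ F0 ((0, 1), rad ((2 / 3 : ℝ) • ctr x))
      rw [trk_const ρ F0 0 rfl, hc, hg, smul_smul, Set.Icc.coe_zero, sub_zero, one_mul])
    (by
      intro x
      show ρ (rad (((1 - ((1 : 𝕀) : ℝ)) * kap 1 (2 / 3 * gau (ctr x)) * (2 / 3)) • ctr x)) =
        ρ (bary r)
      rw [Set.Icc.coe_one, sub_self, zero_mul, zero_mul, zero_smul, rad_zero])
  let K : Path (ybase ρ) (ins ρ g) := toP
    ⟨fun p => trk ρ F0 ((0, p.1), p.2), by fun_prop⟩
    (fun t x hx => trk_bdry F0 _ x hx)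
    (fun x => trk_zero F0 0 x)
    (fun x => (ins_ext0 ρ F0 0 x).symm)
  let L : Path (ybase ρ) (ybase ρ) → Path g g := fun a =>
    ⟨ext0 ρ a.toContinuousMap, ext0_congr _ _ _ _ _ a.source, ext0_congr _ _ _ _ _ a.target⟩
  have sq : ∀ a : Path (ybase ρ) (ybase ρ), (Path.Homotopic.Quotient.mk a).trans (.mk K) =
      (Path.Homotopic.Quotient.mk K).trans (.mk ((L a).map (ins ρ).continuous)) := by
    intro a
    rw [← Path.Homotopic.Quotient.mk_trans, ← Path.Homotopic.Quotient.mk_trans]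
    refine Path.Homotopic.Quotient.eq.2 (square_hom _ _ _ _
      (toY (trk ρ a.toContinuousMap) (fun t x hx => trk_bdry _ _ x hx)) ?_ ?_ ?_ ?_)
    · intro u
      exact yb_ext fun x => trk_zero _ _ _
    · intro u
      exact yb_ext fun x => trk_congr _ _ _ _ _ _ a.target x
    · intro u
      exact yb_ext fun x => trk_congr _ _ _ _ _ _ a.source x
    · intro u
      exact yb_ext fun x => (ins_ext0 _ _ _ x).symm
  refine comm_conj _ _ (.mk K) _ _ (sq a) (sq b) ?_
  rw [← Path.Homotopic.Quotient.mk_trans, ← Path.Homotopic.Quotient.mk_trans, ← Path.map_trans,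
    ← Path.map_trans, Path.Homotopic.Quotient.mk_map, Path.Homotopic.Quotient.mk_map,
    Path.Homotopic.Quotient.mk_trans, Path.Homotopic.Quotient.mk_trans, comm_joined hr k]

end comm2

/-! ### The averaging data in one degree -/

/-- clamp `2 * u - 1` -/
def hlf (u : 𝕀) : 𝕀 := Set.projIcc 0 1 zero_le_one (2 * (u : ℝ) - 1)

theorem hlf_cont : Continuous hlf := by
  unfold hlf
  exact continuous_projIcc.comp (by fun_prop)

theorem hlf_zero : hlf 0 = 0 := by
  unfold hlf
  apply Subtype.ext
  simp [Set.projIcc]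

theorem hlf_one : hlf 1 = 1 := by
  unfold hlf
  apply Subtype.ext
  norm_num [Set.projIcc]

theorem square_of {Y : Type} [TopologicalSpace Y] {y y' b : Y} (h : Path y y') (p : Path y b)
    (p' : Path y' b) (e : p.Homotopic (h.trans p')) :
    ∃ S : C(𝕀 × 𝕀, Y), (∀ s, S (0, s) = p s) ∧ (∀ s, S (1, s) = p' s) ∧
      (∀ u, S (u, 0) = h (hlf u)) ∧ ∀ u, S (u, 1) = b := by
  obtain ⟨F⟩ := e
  let P : ℝ → 𝕀 := Set.projIcc 0 1 zero_le_one
  have hP : Continuous P := continuous_projIcc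
  have hP0 : ∀ t : ℝ, t ≤ 0 → P t = 0 := fun t ht => Set.projIcc_of_le_left _ ht
  have hP1 : ∀ t : ℝ, 1 ≤ t → P t = 1 := fun t ht => Set.projIcc_of_right_le _ ht
  have hPc : ∀ t : ℝ, 0 ≤ t → t ≤ 1 → (P t : ℝ) = t := fun t h0 h1 => by
    show ((Set.projIcc (0 : ℝ) 1 zero_le_one t : 𝕀) : ℝ) = t
    rw [Set.projIcc_of_mem zero_le_one ⟨h0, h1⟩]
  refine ⟨⟨fun z => F (P (2 * z.1), P ((hlf z.1 : ℝ) / 2 + z.2 * (1 - (hlf z.1 : ℝ) / 2))), by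
    have := hlf_cont
    fun_prop⟩, ?_, ?_, ?_, ?_⟩
  · intro s
    show F (P (2 * ((0 : 𝕀) : ℝ)), P ((hlf 0 : ℝ) / 2 + s * (1 - (hlf 0 : ℝ) / 2))) = p s
    rw [hlf_zero]
    have : P (((0 : 𝕀) : ℝ) / 2 + s * (1 - ((0 : 𝕀) : ℝ) / 2)) = s := by
      apply Subtype.ext
      rw [hPc] <;> simp [s.2.1, s.2.2]
    rw [this, hP0 _ (by simp)]
    simp
  · intro s
    show F (P (2 * ((1 : 𝕀) : ℝ)), P ((hlf 1 : ℝ) / 2 + s * (1 - (hlf 1 : ℝ) / 2))) = p' s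
    rw [hlf_one, hP1 _ (by norm_num), F.apply_one]
    have h0 := s.2.1
    have h1 := s.2.2
    have hc : (P (((1 : 𝕀) : ℝ) / 2 + s * (1 - ((1 : 𝕀) : ℝ) / 2)) : ℝ) = 1 / 2 + s / 2 := by
      rw [hPc] <;> rw [Set.Icc.coe_one] <;> linarith
    show (h.trans p') _ = _
    rw [Path.trans_apply]
    split_ifs with hh
    · have hs : s = 0 := Subtype.ext (by
        rw [hc] at hh
        show (s : ℝ) = 0
        linarith)
      have e1 : p' s = y' := by rw [hs, p'.source]
      rw [e1]
      refine Eq.trans (congrArg h ?_) h.target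
      apply Subtype.ext
      show 2 * (P _ : ℝ) = 1
      rw [hc, hs, Set.Icc.coe_zero]; norm_num
    · congr 1
      apply Subtype.ext
      show 2 * (P _ : ℝ) - 1 = s
      rw [hc]; ring
  · intro u
    show F (P (2 * (u : ℝ)), P ((hlf u : ℝ) / 2 + ((0 : 𝕀) : ℝ) * (1 - (hlf u : ℝ) / 2))) = _
    rw [Set.Icc.coe_zero, zero_mul, add_zero]
    by_cases hu : (u : ℝ) ≤ 1 / 2
    · have : hlf u = 0 := hP0 _ (by linarith)
      rw [this, hP0 (((0 : 𝕀) : ℝ) / 2) (by simp), h.source]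
      simp
    · rw [hP1 _ (by linarith), F.apply_one]
      have h0 := (hlf u).2.1
      have h1 := (hlf u).2.2
      have hc : (P ((hlf u : ℝ) / 2) : ℝ) = (hlf u : ℝ) / 2 := hPc _ (by linarith) (by linarith)
      show (h.trans p') _ = _
      rw [Path.trans_apply, dif_pos (by rw [hc]; linarith)]
      congr 1
      apply Subtype.ext
      show 2 * (P _ : ℝ) = _
      rw [hc]; ring
  · intro u
    show F (P (2 * (u : ℝ)), P ((hlf u : ℝ) / 2 + ((1 : 𝕀) : ℝ) * (1 - (hlf u : ℝ) / 2))) = _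
    rw [hP1 (_ + _) (by rw [Set.Icc.coe_one]; linarith)]
    simp

section kd
variable {r : ℕ} {Z : Type} [TopologicalSpace Z]

/-- homotopy rel boundary -/
def relS (r : ℕ) (Z : Type) [TopologicalSpace Z] : Setoid C(Sx r, Z) :=
  ⟨fun f g => ContinuousMap.HomotopicRel f g {x | bdry x}, ContinuousMap.HomotopicRel.equivalence⟩

/-- classes -/
abbrev Cls (r : ℕ) (Z : Type) [TopologicalSpace Z] := Quotient (relS r Z)

theorem joined_of {ρ β : C(Sx r, Z)} (h : ContinuousMap.HomotopicRel ρ β {x | bdry x}) :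
    ∃ y : Yb β, y.1 = ρ ∧ Nonempty (Path y (ybase β)) := by
  obtain ⟨F⟩ := h
  have hb : ∀ x, bdry x → ρ x = β x := fun x hx =>
    (ContinuousMap.HomotopicRel.fst_eq_snd ⟨F⟩ hx : _)
  refine ⟨⟨ρ, hb⟩, rfl, ⟨toP F.toHomotopy.toContinuousMap (fun t x hx => ?_) (fun x => ?_) (fun x => ?_)⟩⟩
  · rw [← hb x hx]
    exact F.eq_fst t hx
  · exact F.apply_zero x
  · exact F.apply_one x

theorem rep_exists (c : Cls r Z) (ρ : C(Sx r, Z)) (h : Quotient.mk _ ρ = c) :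
    ∃ y : Yb c.out, y.1 = ρ ∧ Nonempty (Path y (ybase c.out)) := by
  apply joined_of
  have : Quotient.mk (relS r Z) ρ = Quotient.mk _ c.out := by rw [h, Quotient.out_eq]
  exact Quotient.exact this

/-- `ρ` as a point over its class -/
def ely (c : Cls r Z) (ρ : C(Sx r, Z)) (h : Quotient.mk _ ρ = c) : Yb c.out :=
  (rep_exists c ρ h).choose

theorem ely_val (c : Cls r Z) (ρ : C(Sx r, Z)) (h : Quotient.mk _ ρ = c) : (ely c ρ h).1 = ρ :=
  (rep_exists c ρ h).choose_spec.1

/-- chosen path to the base point -/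
def elp (c : Cls r Z) (ρ : C(Sx r, Z)) (h : Quotient.mk _ ρ = c) :
    Path (ely c ρ h) (ybase c.out) := (rep_exists c ρ h).choose_spec.2.some

/-- the group -/
abbrev KG (r : ℕ) (Z : Type) [TopologicalSpace Z] : Type :=
  ∀ c : Cls r Z, FundamentalGroup (Yb c.out) (ybase c.out)

theorem fg_rep {Y : Type} [TopologicalSpace Y] {y : Y} (g : FundamentalGroup Y y) :
    ∃ p : Path y y, Path.Homotopic.Quotient.mk p = g := by
  obtain ⟨p, hp⟩ := Path.Homotopic.Quotient.mk_surjective (show Path.Homotopic.Quotient y y from g)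
  exact ⟨p, hp⟩

theorem fg_inv_mul {Y : Type} [TopologicalSpace Y] {y : Y} (α g : FundamentalGroup Y y) :
    (α⁻¹ * g)⁻¹ = Path.Homotopic.Quotient.trans α (g⁻¹ : FundamentalGroup Y y) := by
  rw [mul_inv_rev, inv_inv]
  rfl

/-- the path attached to a group element -/
def gpath (c : Cls r Z) (ρ : C(Sx r, Z)) (h : Quotient.mk _ ρ = c)
    (g : FundamentalGroup (Yb c.out) (ybase c.out)) : Path (ely c ρ h) (ybase c.out) :=
  (elp c ρ h).trans (fg_rep g⁻¹).choose

/-- the homotopies -/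
def kq (ρ : C(Sx r, Z)) (g : KG r Z) : C(Sx r × 𝕀, Z) :=
  (ofY (gpath (Quotient.mk _ ρ) ρ rfl (g _)).toContinuousMap).comp ContinuousMap.prodSwap

theorem kq_apply (c : Cls r Z) (ρ : C(Sx r, Z)) (h : Quotient.mk _ ρ = c) (g : KG r Z) (x s) :
    kq ρ g (x, s) = (gpath c ρ h (g c) s).1 x := by
  subst h
  rfl

theorem kq_zero (ρ : C(Sx r, Z)) (g : KG r Z) (x) : kq ρ g (x, 0) = ρ x := by
  rw [kq_apply _ _ rfl, Path.source, ely_val]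

theorem kq_bdry (ρ : C(Sx r, Z)) (g : KG r Z) (x s) (hx : bdry x) : kq ρ g (x, s) = ρ x := by
  rw [kq_apply _ _ rfl, (gpath _ ρ rfl (g _) s).2 x hx, ← (ely _ ρ rfl).2 x hx, ely_val]

open scoped Classical in
theorem kq_K (H : C(𝕀 × Sx r, Z)) (hH : ∀ u x, bdry x → H (u, x) = H (0, x)) :
    ∃ a : KG r Z, ∀ g : KG r Z, ∃ Q : C(𝕀 × (Sx r × 𝕀), Z),
      (∀ z, Q (0, z) = kq (H.curry 0) (a * g) z) ∧ (∀ z, Q (1, z) = kq (H.curry 1) g z) ∧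
      (∀ u x, Q (u, (x, 0)) = H (hlf u, x)) ∧
      (∀ u x s, bdry x → Q (u, (x, s)) = H (0, x)) ∧
      ∀ u x, Q (u, (x, 1)) = Q (0, (x, 1)) := by
  set c : Cls r Z := Quotient.mk _ (H.curry 0) with hc
  have h0 : Quotient.mk _ (H.curry 0) = c := rfl
  have h1 : Quotient.mk _ (H.curry 1) = c := by
    symm
    refine Quotient.sound ⟨⟨⟨H, fun x => rfl, fun x => rfl⟩, fun t x hx => hH t x hx⟩⟩
  have hbo : ∀ x, bdry x → H (0, x) = c.out x := fun x hx => by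
    rw [← (ely c _ h0).2 x hx, ely_val]; rfl
  let h : Path (ely c _ h0) (ely c _ h1) := toP H (fun t x hx => by rw [hH t x hx, hbo x hx])
    (fun x => by rw [ely_val]; rfl) (fun x => by rw [ely_val]; rfl)
  let α : FundamentalGroup (Yb c.out) (ybase c.out) :=
    Path.Homotopic.Quotient.mk ((elp c _ h0).symm.trans (h.trans (elp c _ h1)))
  let a0 : FundamentalGroup (Yb c.out) (ybase c.out) := α⁻¹
  refine ⟨Function.update (1 : KG r Z) c a0, fun g => ?_⟩
  have hag : (Function.update (1 : KG r Z) c a0 * g) c = a0 * g c := by simp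
  have key : (gpath c _ h0 (a0 * g c)).Homotopic (h.trans (gpath c _ h1 (g c))) := by
    rw [← Path.Homotopic.Quotient.eq]
    unfold gpath
    simp only [Path.Homotopic.Quotient.mk_trans]
    rw [(fg_rep (a0 * g c)⁻¹).choose_spec, (fg_rep (g c)⁻¹).choose_spec]
    rw [fg_inv_mul, ← Path.Homotopic.Quotient.trans_assoc]
    show ((_ : Path.Homotopic.Quotient _ _).trans (Path.Homotopic.Quotient.mk _)).trans _ = _
    rw [Path.Homotopic.Quotient.mk_trans, Path.Homotopic.Quotient.mk_trans,
      Path.Homotopic.Quotient.mk_symm, ← Path.Homotopic.Quotient.trans_assoc,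
      Path.Homotopic.Quotient.trans_symm, Path.Homotopic.Quotient.refl_trans,
      Path.Homotopic.Quotient.trans_assoc]
  obtain ⟨S, hS0, hS1, hS2, hS3⟩ := square_of h _ _ key
  refine ⟨⟨fun z => ofY S ((z.1, z.2.2), z.2.1), by fun_prop⟩, ?_, ?_, ?_, ?_, ?_⟩
  · rintro ⟨x, s⟩
    rw [kq_apply c _ h0, hag, ← hS0]
    rfl
  · rintro ⟨x, s⟩
    rw [kq_apply c _ h1, ← hS1]
    rfl
  · intro u x
    show (S (u, 0)).1 x = _
    rw [hS2]
    rfl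
  · intro u x s hx
    show (S (u, s)).1 x = _
    rw [(S (u, s)).2 x hx, hbo x hx]
  · intro u x
    show (S (u, 1)).1 x = (S (0, 1)).1 x
    rw [hS3, hS3]

theorem no_bdry (x : Sx 0) : ¬ bdry x := by
  rintro ⟨i, hi⟩
  have := x.2.2
  have hi0 : i = 0 := by omega
  subst hi0
  simp at this
  rw [this] at hi
  exact one_ne_zero hi

instance : Subsingleton (Sx 0) := ⟨fun x y => by
  apply Subtype.ext
  have h1 := x.2.2
  have h2 := y.2.2
  ext i
  have hi0 : i = 0 := by omega
  subst hi0
  simp at h1 h2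
  rw [h1, h2]⟩

theorem kg_mean_zero [PathConnectedSpace Z] (ham : ∀ z : Z, IsAmenable (FundamentalGroup Z z)) :
    Nonempty (MeanOn (KG 0 Z)) := by
  have key : ∀ (ρ : C(Sx 0, Z)) (y : Yb ρ), Nonempty (MeanOn (FundamentalGroup (Yb ρ) y)) := by
    intro ρ y
    let e : C(Z, Yb ρ) := toY ⟨fun p => p.1, continuous_fst⟩ (fun t x hx => (no_bdry x hx).elim)
    let ev : C(Yb ρ, Z) := ⟨fun y => y.1 (bary 0), (continuous_eval_const (bary 0)).comp continuous_subtype_val⟩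
    have hee : ∀ y, e (ev y) = y := fun y => yb_ext fun x => by
      show y.1 (bary 0) = y.1 x
      rw [Subsingleton.elim x (bary 0)]
    obtain ⟨z, rfl⟩ : ∃ z, e z = y := ⟨ev y, hee y⟩
    obtain ⟨μ⟩ := ham z
    obtain ⟨m⟩ := mean_of_im μ
    refine mean_of_surj m (FundamentalGroup.map e z) (fun a b => map_mul _ a b) fun g => ?_
    obtain ⟨p, rfl⟩ := fg_rep g
    refine ⟨Path.Homotopic.Quotient.mk (p.map ev.continuous), ?_⟩
    have : FundamentalGroup.map e z (Path.Homotopic.Quotient.mk (p.map ev.continuous)) =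
      Path.Homotopic.Quotient.mk ((p.map ev.continuous).map e.continuous) := rfl
    rw [this]
    congr 1
    ext t
    exact hee _
  obtain ⟨z⟩ : Nonempty Z := inferInstance
  let c0 : Cls 0 Z := Quotient.mk _ (cst 0 z)
  have hu : ∀ c : Cls 0 Z, c = c0 := by
    intro c
    induction c using Quotient.inductionOn with | h ρ => ?_
    obtain ⟨p⟩ := PathConnectedSpace.joined (ρ (bary 0)) z
    refine Quotient.sound ⟨⟨⟨⟨fun w => p w.1, by fun_prop⟩, fun x => ?_, fun x => ?_⟩,
      fun t x hx => (no_bdry x hx).elim⟩⟩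
    · show p 0 = ρ x
      rw [p.source, Subsingleton.elim x (bary 0)]
    · show p 1 = z
      rw [p.target]
  let _ : Unique (Cls 0 Z) := ⟨⟨c0⟩, hu⟩
  obtain ⟨m⟩ := key (default : Cls 0 Z).out (ybase _)
  let E := (MulEquiv.piUnique (fun c : Cls 0 Z => FundamentalGroup (Yb c.out) (ybase c.out)))
  exact mean_of_surj m E.symm (fun a b => map_mul _ a b) E.symm.surjective

theorem kg_mean_pos (hr : 1 ≤ r) : Nonempty (MeanOn (KG r Z)) := by
  refine mean_of_comm _ fun a b => ?_
  funext c
  obtain ⟨p, hp⟩ := fg_rep (a c)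
  obtain ⟨q, hq⟩ := fg_rep (b c)
  show a c * b c = b c * a c
  rw [← hp, ← hq]
  exact comm_yb hr _ q p

/-- Standing hypothesis on `Z`. -/
def Amen (Z : Type) [TopologicalSpace Z] : Prop :=
  PathConnectedSpace Z ∧ ∀ z : Z, IsAmenable (FundamentalGroup Z z)

theorem kg_mean (h : Amen Z) : Nonempty (MeanOn (KG r Z)) := by
  obtain ⟨h1, h2⟩ := h
  rcases r with _ | r
  · exact kg_mean_zero h2
  · exact kg_mean_pos (by omega)

end kd

/-! ### Iterated means -/

section avg
variable {G : Type} [Group G] (M : MeanOn G)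

/-- iterated mean over a list of coordinates -/
def Em {ι : Type} [DecidableEq ι] : List ι → ((ι → G) → ℝ) →ₗ[ℝ] ((ι → G) → ℝ)
  | [] => LinearMap.id
  | j :: L =>
    { toFun := fun f g0 => M.m (fun b => Em L f (Function.update g0 j b))
      map_add' := fun f f' => by
        funext g0
        rw [map_add]
        exact map_add M.m (fun b => Em L f (Function.update g0 j b)) _
      map_smul' := fun c f => by
        funext g0
        rw [map_smul]
        exact map_smul M.m c (fun b => Em L f (Function.update g0 j b)) }

variable {ι κ : Type} [DecidableEq ι] [DecidableEq κ]

theorem Em_cons (j : ι) (L : List ι) (f g0) :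
    Em M (j :: L) f g0 = M.m (fun b => Em M L f (Function.update g0 j b)) := rfl

theorem Em_bound (L : List ι) (f : (ι → G) → ℝ) (C : ℝ) (h : ∀ g, |f g| ≤ C) (g0) :
    |Em M L f g0| ≤ C := by
  induction L generalizing g0 with
  | nil => exact h g0
  | cons j L ih => exact M.bound _ C fun b => ih _

theorem Em_inv (L : List ι) (f : (ι → G) → ℝ) (C : ℝ) (h : ∀ g, |f g| ≤ C) (a g0) :
    Em M L (fun g => f (a * g)) g0 = Em M L f (a * g0) := by
  induction L generalizing g0 with
  | nil => rfl
  | cons j L ih =>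
    rw [Em_cons, Em_cons]
    rw [← M.inv (a j) (fun b => Em M L f (Function.update (a * g0) j b)) C
      fun b => Em_bound M L f C h _]
    congr 1
    funext b
    rw [ih]
    refine congrArg (Em M L f) ?_
    funext i
    by_cases hi : i = j
    · subst hi; simp
    · simp [hi]

theorem Em_indep (L : List ι) (f : (ι → G) → ℝ) (g0 g1 : ι → G) (h : ∀ i, i ∉ L → g0 i = g1 i) :
    Em M L f g0 = Em M L f g1 := by
  induction L generalizing g0 g1 with
  | nil =>
    have : g0 = g1 := funext fun i => h i (by simp)
    rw [this]
  | cons j L ih =>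
    rw [Em_cons, Em_cons]
    congr 1
    funext b
    apply ih
    intro i hi
    by_cases hij : i = j
    · subst hij; simp
    · simp only [Function.update_of_ne hij]
      exact h i (by simp [hij, hi])

theorem mean_const (c : ℝ) : M.m (fun _ => c) = c := by
  have h := map_smul M.m c (fun _ => (1 : ℝ))
  rw [M.one, smul_eq_mul, mul_one] at h
  refine Eq.trans (congrArg M.m ?_) h
  funext x
  simp

open scoped Classical in
theorem Em_marg (s : ι → κ) (hs : Function.Injective s) (f : (ι → G) → ℝ) (L' : List κ)
    (L : List ι) (h : L.map s = L'.filter (fun k => k ∈ Set.range s)) (g0 : κ → G) :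
    Em M L' (fun g => f (g ∘ s)) g0 = Em M L f (g0 ∘ s) := by
  induction L' generalizing L g0 with
  | nil =>
    have : L = [] := by simpa using h
    subst this
    rfl
  | cons k L' ih =>
    by_cases hk : k ∈ Set.range s
    · rw [List.filter_cons_of_pos (by simpa using hk)] at h
      obtain ⟨j, rfl⟩ := hk
      rcases L with _ | ⟨j', L⟩
      · simp at h
      · rw [List.map_cons, List.cons.injEq] at h
        have hj := hs h.1
        subst hj
        rw [Em_cons, Em_cons]
        congr 1
        funext b
        rw [ih L h.2]
        refine congrArg (Em M L f) ?_
        funext i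
        by_cases hi : i = j'
        · subst hi; simp
        · have : s i ≠ s j' := fun e => hi (hs e)
          simp [hi, this]
    · rw [List.filter_cons_of_neg (by simpa using hk)] at h
      rw [Em_cons]
      rw [← mean_const M (Em M L f (g0 ∘ s))]
      congr 1
      funext b
      rw [ih L h]
      refine congrArg (Em M L f) ?_
      funext i
      have : s i ≠ k := fun e => hk ⟨i, e⟩
      simp [this]

end avg

section avg2
variable {G : Type} [Group G] (M : MeanOn G)
variable {ι κ : Type} [LinearOrder ι] [Fintype ι] [LinearOrder κ] [Fintype κ]

/-- the average over all coordinates -/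
def av (f : (ι → G) → ℝ) : ℝ := Em M ((Finset.univ : Finset ι).sort (· ≤ ·)) f 1

theorem av_add (f f' : (ι → G) → ℝ) : av M (fun g => f g + f' g) = av M f + av M f' := by
  unfold av
  exact congrFun (map_add (Em M _) f f') 1

theorem av_smul (c : ℝ) (f : (ι → G) → ℝ) : av M (fun g => c * f g) = c * av M f := by
  unfold av
  exact congrFun (map_smul (Em M _) c f) 1

theorem av_sum {α : Type} (s : Finset α) (f : α → (ι → G) → ℝ) :
    av M (fun g => ∑ a ∈ s, f a g) = ∑ a ∈ s, av M (f a) := by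
  unfold av
  have h : (fun g => ∑ a ∈ s, f a g) = ∑ a ∈ s, f a := by
    funext g
    simp
  rw [h, map_sum, Finset.sum_apply]

theorem av_bound (f : (ι → G) → ℝ) (C : ℝ) (h : ∀ g, |f g| ≤ C) : |av M f| ≤ C :=
  Em_bound M _ f C h 1

theorem av_inv (f : (ι → G) → ℝ) (C : ℝ) (h : ∀ g, |f g| ≤ C) (a : ι → G) :
    av M (fun g => f (a * g)) = av M f := by
  unfold av
  rw [Em_inv M _ f C h]
  exact Em_indep M _ f _ _ fun i hi => absurd ((Finset.mem_sort _).2 (Finset.mem_univ i)) hi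

theorem av_const (c : ℝ) : av M (fun _ : ι → G => c) = c := by
  unfold av
  generalize (Finset.univ : Finset ι).sort (· ≤ ·) = L
  generalize (1 : ι → G) = g0
  induction L generalizing g0 with
  | nil => rfl
  | cons j L ih =>
    rw [Em_cons]
    simp only [ih, mean_const]

theorem av_marg (s : ι → κ) (hs : StrictMono s) (f : (ι → G) → ℝ) :
    av M (fun g : κ → G => f (g ∘ s)) = av M f := by
  classical
  unfold av
  refine Em_marg M s hs.injective f _ _ ?_ 1
  refine List.Perm.eq_of_pairwise' (r := (· ≤ ·)) ?_ ?_ ?_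
  · rw [List.pairwise_map]
    exact ((Finset.univ : Finset ι).pairwise_sort (· ≤ ·)).imp fun h => hs.monotone h
  · exact ((Finset.univ : Finset κ).pairwise_sort (· ≤ ·)).filter _
  · rw [List.perm_ext_iff_of_nodup]
    · intro k
      simp
    · exact (Finset.sort_nodup _ _).map hs.injective
    · exact (Finset.sort_nodup _ _).filter _

end avg2

/-! ### The retraction onto a skeleton -/

section ret

theorem simpMap_at {p q : ℕ} {v : Fin (p + 1) → Fin (q + 1)} (hv : Function.Injective v) (x : Sx p) (i) :
    (simpMap v x).1 (v i) = x.1 i := by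
  rw [simpMap_apply]
  rw [Finset.sum_eq_single i]
  · simp
  · intro b _ hb
    rw [if_neg (fun e => hb (hv e))]
  · simp

theorem simpMap_off {p q : ℕ} {v : Fin (p + 1) → Fin (q + 1)} (x : Sx p) (j)
    (hj : j ∉ Set.range v) : (simpMap v x).1 j = 0 := by
  rw [simpMap_apply]
  exact Finset.sum_eq_zero fun i _ => if_neg fun e => hj ⟨i, e⟩

/-- a sum over coordinates is invariant under padding by zeros -/
theorem sum_pad {p q : ℕ} {v : Fin (p + 1) → Fin (q + 1)} (hv : Function.Injective v) (x : Sx p)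
    (f : ℝ → ℝ) (hf : f 0 = 0) : ∑ j, f ((simpMap v x).1 j) = ∑ i, f (x.1 i) := by
  classical
  rw [← Finset.sum_subset (Finset.subset_univ (Finset.univ.image v))]
  · rw [Finset.sum_image (fun a _ b _ h => hv h)]
    exact Finset.sum_congr rfl fun i _ => by rw [simpMap_at hv]
  · intro j _ hj
    rw [simpMap_off x j (fun ⟨i, hi⟩ => hj (Finset.mem_image.2 ⟨i, Finset.mem_univ i, hi⟩)), hf]

variable {k : ℕ} (r : ℕ)

/-- number of coordinates above a level -/
def cnt (x : Fin (k + 1) → ℝ) (m : ℝ) : ℕ := (Finset.univ.filter fun i => m < x i).card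

theorem cnt_anti (x : Fin (k + 1) → ℝ) {m m' : ℝ} (h : m ≤ m') : cnt x m' ≤ cnt x m :=
  Finset.card_le_card fun i hi => by
    rw [Finset.mem_filter] at hi ⊢
    exact ⟨hi.1, h.trans_lt hi.2⟩

/-- the `(r+2)`-nd largest coordinate -/
def tau (x : Fin (k + 1) → ℝ) : ℝ := sInf {m : ℝ | 0 ≤ m ∧ cnt x m ≤ r + 1}

theorem tau_ne (x : Fin (k + 1) → ℝ) : {m : ℝ | 0 ≤ m ∧ cnt x m ≤ r + 1}.Nonempty := by
  refine ⟨∑ i, |x i|, Finset.sum_nonneg fun i _ => abs_nonneg _, ?_⟩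
  have : cnt x (∑ i, |x i|) = 0 := by
    rw [cnt, Finset.card_eq_zero, Finset.filter_eq_empty_iff]
    intro i _
    exact not_lt.2 ((le_abs_self _).trans
      (Finset.single_le_sum (fun i _ => abs_nonneg (x i)) (Finset.mem_univ i)))
  omega

theorem tau_nonneg (x : Fin (k + 1) → ℝ) : 0 ≤ tau r x := le_csInf (tau_ne r x) fun _ h => h.1

theorem tau_le {x : Fin (k + 1) → ℝ} {m : ℝ} (h0 : 0 ≤ m) (h : cnt x m ≤ r + 1) : tau r x ≤ m :=
  csInf_le ⟨0, fun _ h => h.1⟩ ⟨h0, h⟩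

theorem tau_cnt (x : Fin (k + 1) → ℝ) : cnt x (tau r x) ≤ r + 1 := by
  by_contra hc
  have hex : ∃ m, tau r x < m ∧ ∀ i, tau r x < x i → m < x i := by
    have hne : (Finset.univ.filter fun i => tau r x < x i).Nonempty := by
      rw [← Finset.card_pos]
      have : (Finset.univ.filter fun i => tau r x < x i).card = cnt x (tau r x) := rfl
      omega
    obtain ⟨i0, hi0, hmin⟩ := Finset.exists_min_image _ x hne
    rw [Finset.mem_filter] at hi0
    refine ⟨(tau r x + x i0) / 2, by linarith [hi0.2], fun i hi => ?_⟩
    have := hmin i (Finset.mem_filter.2 ⟨Finset.mem_univ _, hi⟩)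
    linarith [hi0.2]
  obtain ⟨m, hm, hi⟩ := hex
  obtain ⟨m', ⟨_, hm'⟩, hlt⟩ := exists_lt_of_csInf_lt (tau_ne r x) hm
  have h2 : cnt x (tau r x) ≤ cnt x m := Finset.card_le_card fun i h => by
    rw [Finset.mem_filter] at h ⊢
    exact ⟨h.1, hi i h.2⟩
  have := cnt_anti x hlt.le
  omega

theorem tau_cont : Continuous (tau r : (Fin (k + 1) → ℝ) → ℝ) := by
  refine LipschitzWith.continuous (K := 1) (LipschitzWith.of_le_add fun x y => ?_)
  refine tau_le r (add_nonneg (tau_nonneg r y) dist_nonneg) (le_trans ?_ (tau_cnt r y))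
  refine Finset.card_le_card fun i hi => ?_
  rw [Finset.mem_filter] at hi ⊢
  refine ⟨hi.1, ?_⟩
  have h1 := dist_le_pi_dist x y i
  rw [Real.dist_eq] at h1
  have h2 := le_abs_self (x i - y i)
  linarith [hi.2]

theorem cnt_simpMap {p : ℕ} {v : Fin (p + 1) → Fin (k + 1)} (hv : Function.Injective v) (x : Sx p)
    {m : ℝ} (hm : 0 ≤ m) : cnt (simpMap v x).1 m = cnt x.1 m := by
  classical
  unfold cnt
  rw [← Finset.card_image_of_injective _ hv]
  congr 1
  ext j
  simp only [Finset.mem_filter, Finset.mem_univ, true_and, Finset.mem_image]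
  constructor
  · intro h
    by_cases hj : j ∈ Set.range v
    · obtain ⟨i, rfl⟩ := hj
      rw [simpMap_at hv] at h
      exact ⟨i, h, rfl⟩
    · rw [simpMap_off x j hj] at h
      exact absurd hm (not_le.2 h)
  · rintro ⟨i, h, rfl⟩
    rwa [simpMap_at hv]

theorem tau_simpMap {p : ℕ} {v : Fin (p + 1) → Fin (k + 1)} (hv : Function.Injective v) (x : Sx p) :
    tau r (simpMap v x).1 = tau r x.1 := by
  unfold tau
  congr 1
  ext m
  constructor
  · rintro ⟨h, h'⟩; exact ⟨h, by rwa [cnt_simpMap hv x h] at h'⟩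
  · rintro ⟨h, h'⟩; exact ⟨h, by rwa [cnt_simpMap hv x h]⟩

/-- sum of squares -/
def nsq (x : Sx k) : ℝ := ∑ i, x.1 i ^ 2

theorem nsq_pos (x : Sx k) : 0 < nsq x := by
  obtain ⟨i, hi⟩ : ∃ i, 0 < x.1 i := exists_pos x
  exact Finset.sum_pos' (fun i _ => sq_nonneg _) ⟨i, Finset.mem_univ _, by positivity⟩

theorem nsq_simpMap {p : ℕ} {v : Fin (p + 1) → Fin (k + 1)} (hv : Function.Injective v) (x : Sx p) :
    nsq (simpMap v x) = nsq x := sum_pad hv x (fun t => t ^ 2) (by norm_num)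

theorem nsq_cont : Continuous (nsq : Sx k → ℝ) := by
  unfold nsq
  fun_prop

/-- cut level -/
def lev (z : Sx k × 𝕀) : ℝ := min ((z.2 : ℝ) * nsq z.1 / 2) (tau r z.1.1)

theorem lev_cont : Continuous (lev r : Sx k × 𝕀 → ℝ) := by
  have h1 := nsq_cont (k := k)
  have h2 := tau_cont (k := k) r
  unfold lev
  fun_prop

theorem lev_nonneg (z : Sx k × 𝕀) : 0 ≤ lev r z :=
  le_min (by have := z.2.2.1; have := nsq_pos z.1; positivity) (tau_nonneg r _)

theorem lev_lt (z : Sx k × 𝕀) : lev r z < nsq z.1 := by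
  refine lt_of_le_of_lt (min_le_left _ _) ?_
  have h1 := z.2.2.2
  have h2 := nsq_pos z.1
  have h3 : (z.2 : ℝ) * nsq z.1 ≤ nsq z.1 := mul_le_of_le_one_left h2.le h1
  linarith

/-- denominators -/
def den (z : Sx k × 𝕀) : ℝ := ∑ i, max (z.1.1 i - lev r z) 0

theorem den_cont : Continuous (den r : Sx k × 𝕀 → ℝ) := by
  have h1 := lev_cont (k := k) r
  unfold den
  refine continuous_finsetSum _ fun i _ => Continuous.max (Continuous.sub ?_ h1) continuous_const
  exact (cont_coord i).comp continuous_fst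

theorem den_pos (z : Sx k × 𝕀) : 0 < den r z := by
  have : ∃ i, lev r z < z.1.1 i := by
    by_contra hc
    push Not at hc
    have : nsq z.1 ≤ lev r z := by
      calc nsq z.1 ≤ ∑ i, lev r z * z.1.1 i := Finset.sum_le_sum fun i _ => by
            rw [sq]; exact mul_le_mul_of_nonneg_right (hc i) (z.1.2.1 i)
        _ = lev r z := by rw [← Finset.mul_sum, z.1.2.2, mul_one]
    exact absurd (lev_lt r z) (not_lt.2 this)
  obtain ⟨i, hi⟩ := this
  exact Finset.sum_pos' (fun i _ => le_max_right _ _)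
    ⟨i, Finset.mem_univ _, lt_max_of_lt_left (by linarith)⟩

/-- space component -/
def ry : C(Sx k × 𝕀, Sx k) where
  toFun z := ⟨fun i => max (z.1.1 i - lev r z) 0 / den r z, fun i =>
    div_nonneg (le_max_right _ _) (den_pos r z).le, by
      rw [← Finset.sum_div]
      exact div_self (den_pos r z).ne'⟩
  continuous_toFun := by
    have h1 := lev_cont (k := k) r
    refine Continuous.subtype_mk (continuous_pi fun i => ?_) _
    refine Continuous.div (Continuous.max (Continuous.sub ?_ h1) continuous_const) (den_cont r)
      fun z => (den_pos r z).ne'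
    exact (cont_coord i).comp continuous_fst

/-- time component -/
def rs : C(Sx k × 𝕀, 𝕀) where
  toFun z := Set.projIcc 0 1 zero_le_one ((z.2 : ℝ) - 2 * tau r z.1.1 / nsq z.1)
  continuous_toFun := by
    have h1 := nsq_cont (k := k)
    have h2 := tau_cont (k := k) r
    refine continuous_projIcc.comp (Continuous.sub (by fun_prop) ?_)
    exact Continuous.div (by fun_prop) (by fun_prop) fun z => (nsq_pos z.1).ne'

theorem ry_apply (z : Sx k × 𝕀) (i) : (ry r z).1 i = max (z.1.1 i - lev r z) 0 / den r z := rfl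

theorem rs_pos {z : Sx k × 𝕀} (h : rs r z ≠ 0) : lev r z = tau r z.1.1 := by
  by_contra hc
  apply h
  refine Set.projIcc_of_le_left zero_le_one ?_
  have h2 := nsq_pos z.1
  have : (z.2 : ℝ) * nsq z.1 / 2 ≤ tau r z.1.1 := by
    by_contra h3
    exact hc (min_eq_right (not_le.1 h3).le)
  rw [sub_nonpos, le_div_iff₀ h2]
  linarith

/-- the support has few elements -/
theorem ry_supp {z : Sx k × 𝕀} (h : rs r z ≠ 0) : cnt (ry r z).1 0 ≤ r + 1 := by
  refine le_trans (Finset.card_le_card fun i hi => ?_) (tau_cnt r z.1.1)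
  rw [Finset.mem_filter] at hi ⊢
  refine ⟨hi.1, ?_⟩
  by_contra hc
  rw [ry_apply, rs_pos r h, max_eq_right (by linarith), zero_div] at hi
  exact lt_irrefl _ hi.2

theorem ry_of_lev {z : Sx k × 𝕀} (h : lev r z = 0) : ry r z = z.1 := by
  have hm : ∀ i, max (z.1.1 i - lev r z) 0 = z.1.1 i := fun i => by
    rw [h, sub_zero]; exact max_eq_left (z.1.2.1 i)
  apply Subtype.ext
  funext i
  have hd : den r z = 1 := by
    unfold den
    simp only [hm]
    exact z.1.2.2
  rw [ry_apply, hm, hd, div_one]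

theorem ry_zero (x : Sx k) : ry r (x, 0) = x :=
  ry_of_lev r (le_antisymm ((min_le_left _ _).trans (by simp)) (lev_nonneg r _))

theorem rs_zero (x : Sx k) : rs r (x, 0) = 0 := by
  refine Set.projIcc_of_le_left zero_le_one ?_
  have := nsq_pos x
  have := tau_nonneg r x.1
  simp only [Set.Icc.coe_zero, zero_sub, Left.neg_nonpos_iff]
  positivity

theorem tau_small {x : Sx k} (h : cnt x.1 0 ≤ r + 1) : tau r x.1 = 0 :=
  le_antisymm (tau_le r le_rfl h) (tau_nonneg r _)

theorem ry_small {x : Sx k} (h : cnt x.1 0 ≤ r + 1) (t) : ry r (x, t) = x :=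
  ry_of_lev r (le_antisymm ((min_le_right _ _).trans (tau_small r h).le) (lev_nonneg r _))

theorem rs_small {x : Sx k} (h : cnt x.1 0 ≤ r + 1) (t) : rs r (x, t) = t := by
  show Set.projIcc 0 1 zero_le_one ((t : ℝ) - 2 * tau r x.1 / nsq x) = t
  rw [tau_small r h, mul_zero, zero_div, sub_zero]
  exact Set.projIcc_val _ _

theorem lev_simpMap {p : ℕ} {v : Fin (p + 1) → Fin (k + 1)} (hv : Function.Injective v) (x : Sx p) (t) :
    lev r (simpMap v x, t) = lev r (x, t) := by
  unfold lev
  simp only [tau_simpMap r hv, nsq_simpMap hv]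

theorem rs_simpMap {p : ℕ} {v : Fin (p + 1) → Fin (k + 1)} (hv : Function.Injective v) (x : Sx p) (t) :
    rs r (simpMap v x, t) = rs r (x, t) := by
  show Set.projIcc 0 1 zero_le_one ((t : ℝ) - 2 * tau r (simpMap v x).1 / nsq (simpMap v x)) = _
  rw [tau_simpMap r hv, nsq_simpMap hv]
  rfl

theorem ry_simpMap {p : ℕ} {v : Fin (p + 1) → Fin (k + 1)} (hv : Function.Injective v) (x : Sx p) (t) :
    ry r (simpMap v x, t) = simpMap v (ry r (x, t)) := by
  have hl := lev_simpMap r hv x t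
  have hd : den r (simpMap v x, t) = den r (x, t) := by
    unfold den
    rw [hl]
    exact sum_pad hv x (fun s => max (s - lev r (x, t)) 0)
      (max_eq_right (by linarith [lev_nonneg r (x, t)]))
  apply Subtype.ext
  funext j
  by_cases hj : j ∈ Set.range v
  · obtain ⟨i, rfl⟩ := hj
    rw [simpMap_at hv, ry_apply, ry_apply, hl, hd]
    show max ((simpMap v x).1 (v i) - _) 0 / _ = _
    rw [simpMap_at hv]
  · rw [simpMap_off _ j hj, ry_apply, hl, hd]
    show max ((simpMap v x).1 j - _) 0 / _ = _
    rw [simpMap_off _ j hj, max_eq_right (by linarith [lev_nonneg r (x, t)]), zero_div]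

end ret

/-! ### Extension of homotopies from a skeleton -/

section exten
variable {k r : ℕ}

/-- `y` is supported on the face `v` -/
def inF (v : Fin (r + 1) → Fin (k + 1)) (y : Sx k) : Prop := ∀ j, j ∉ Set.range v → y.1 j = 0

theorem inF_closed (v : Fin (r + 1) → Fin (k + 1)) : IsClosed {y : Sx k | inF v y} := by
  have : {y : Sx k | inF v y} = ⋂ j, ⋂ (_ : j ∉ Set.range v), {y : Sx k | y.1 j = 0} := by
    ext y
    simp [inF]
  rw [this]
  exact isClosed_iInter fun j => isClosed_iInter fun _ => isClosed_eq (cont_coord j) continuous_const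

theorem inF_sum {v : Fin (r + 1) → Fin (k + 1)} (hv : Function.Injective v) (y : Sx k) :
    ∑ l, y.1 (v l) ≤ 1 := by
  classical
  rw [← Finset.sum_image (s := Finset.univ) (g := v) (f := fun j => y.1 j) (fun a _ b _ h => hv h)]
  rw [← y.2.2]
  exact Finset.sum_le_sum_of_subset_of_nonneg (Finset.subset_univ _) fun j _ _ => y.2.1 j

theorem inF_sum_eq {v : Fin (r + 1) → Fin (k + 1)} (hv : Function.Injective v) {y : Sx k}
    (h : inF v y) : ∑ l, y.1 (v l) = 1 := by
  classical
  rw [← Finset.sum_image (s := Finset.univ) (g := v) (f := fun j => y.1 j) (fun a _ b _ h => hv h)]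
  rw [← y.2.2]
  refine Finset.sum_subset (Finset.subset_univ _) fun j _ hj => h j ?_
  rintro ⟨i, rfl⟩
  exact hj (Finset.mem_image_of_mem _ (Finset.mem_univ _))

/-- retraction to a face -/
def pull (v : Fin (r + 1) → Fin (k + 1)) (hv : Function.Injective v) : C(Sx k, Sx r) where
  toFun y := ⟨fun j => y.1 (v j) + (1 - ∑ l, y.1 (v l)) / (r + 1), fun j => by
      have := inF_sum hv y
      have h2 := y.2.1 (v j)
      have : 0 ≤ (1 - ∑ l, y.1 (v l)) / (r + 1) := div_nonneg (by linarith) (by positivity)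
      exact add_nonneg h2 this, by
      rw [Finset.sum_add_distrib, Finset.sum_const, Finset.card_univ, Fintype.card_fin, nsmul_eq_mul]
      push_cast
      field_simp
      ring⟩
  continuous_toFun := by
    have := fun j => cont_coord (p := k) j
    refine Continuous.subtype_mk (continuous_pi fun j => ?_) _
    fun_prop

theorem pull_spec {v : Fin (r + 1) → Fin (k + 1)} (hv : Function.Injective v) {y : Sx k}
    (h : inF v y) : simpMap v (pull v hv y) = y := by
  apply Subtype.ext
  funext j
  by_cases hj : j ∈ Set.range v
  · obtain ⟨i, rfl⟩ := hj
    rw [simpMap_at hv]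
    show y.1 (v i) + (1 - ∑ l, y.1 (v l)) / (r + 1) = _
    rw [inF_sum_eq hv h, sub_self, zero_div, add_zero]
  · rw [simpMap_off _ j hj, h j hj]

theorem exists_face (hk : r ≤ k) {y : Sx k} (h : cnt y.1 0 ≤ r + 1) :
    ∃ v : Fin (r + 1) → Fin (k + 1), StrictMono v ∧ inF v y := by
  obtain ⟨u, hu1, _, hu3⟩ := Finset.exists_subsuperset_card_eq
    (Finset.subset_univ (Finset.univ.filter fun i => 0 < y.1 i)) h
    (by rw [Finset.card_univ, Fintype.card_fin]; omega)
  refine ⟨u.orderEmbOfFin hu3, (u.orderEmbOfFin hu3).strictMono, fun j hj => ?_⟩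
  rw [Finset.range_orderEmbOfFin] at hj
  by_contra hc
  exact hj (hu1 (Finset.mem_filter.2 ⟨Finset.mem_univ _, lt_of_le_of_ne (y.2.1 j) (Ne.symm hc)⟩))

theorem face_unique {v v' : Fin (r + 1) → Fin (k + 1)} (hv : StrictMono v) (hv' : StrictMono v')
    {z z' : Sx r} (h : simpMap v z = simpMap v' z') (hz : ¬ bdry z) : v = v' := by
  classical
  refine (StrictMono.range_inj hv hv').1 ?_
  have hsub : Finset.univ.image v ⊆ Finset.univ.image v' := by
    intro j hj
    obtain ⟨i, _, rfl⟩ := Finset.mem_image.1 hj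
    by_contra hc
    have h1 : (simpMap v' z').1 (v i) = 0 := simpMap_off _ _ fun ⟨l, hl⟩ =>
      hc (Finset.mem_image.2 ⟨l, Finset.mem_univ _, hl⟩)
    rw [← h, simpMap_at hv.injective] at h1
    exact hz ⟨i, h1⟩
  have := Finset.eq_of_subset_of_card_le hsub (by
    rw [Finset.card_image_of_injective _ hv.injective, Finset.card_image_of_injective _ hv'.injective])
  have h3 := congrArg (fun s : Finset (Fin (k + 1)) => (s : Set (Fin (k + 1)))) this
  simpa using h3

theorem face_inj {v : Fin (r + 1) → Fin (k + 1)} (hv : StrictMono v)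
    {z z' : Sx r} (h : simpMap v z = simpMap v z') : z = z' := by
  apply Subtype.ext
  funext i
  rw [← simpMap_at hv.injective z i, h, simpMap_at hv.injective]

/-- compatibility of the homotopies on faces -/
structure Good (σ : Sx k → X) (Q : (Fin (r + 1) → Fin (k + 1)) → Sx r × 𝕀 → X) : Prop where
  e0 : ∀ v, StrictMono v → ∀ z, Q v (z, 0) = σ (simpMap v z)
  e1 : ∀ v, StrictMono v → ∀ z s, bdry z → Q v (z, s) = σ (simpMap v z)

open scoped Classical in
/-- the extension -/
def extF (σ : Sx k → X) (Q : (Fin (r + 1) → Fin (k + 1)) → Sx r × 𝕀 → X) (p : Sx k × 𝕀) : X :=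
  if h : rs r p ≠ 0 ∧ ∃ v : Fin (r + 1) → Fin (k + 1), StrictMono v ∧ ∃ z, simpMap v z = ry r p then
    Q h.2.choose (h.2.choose_spec.2.choose, rs r p) else σ (ry r p)

variable {σ : Sx k → X} {Q : (Fin (r + 1) → Fin (k + 1)) → Sx r × 𝕀 → X}

theorem extF_zero {p : Sx k × 𝕀} (h : rs r p = 0) : extF σ Q p = σ (ry r p) :=
  dif_neg fun h' => h'.1 h

theorem extF_face (hG : Good σ Q) {p : Sx k × 𝕀} {v : Fin (r + 1) → Fin (k + 1)}
    (hv : StrictMono v) {z : Sx r} (hz : simpMap v z = ry r p) : extF σ Q p = Q v (z, rs r p) := by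
  by_cases h : rs r p = 0
  · rw [extF_zero h, h, hG.e0 v hv, hz]
  · have h' : rs r p ≠ 0 ∧ ∃ v : Fin (r + 1) → Fin (k + 1), StrictMono v ∧ ∃ z, simpMap v z = ry r p :=
      ⟨h, v, hv, z, hz⟩
    unfold extF
    rw [dif_pos h']
    have hv' := h'.2.choose_spec.1
    have hz' := h'.2.choose_spec.2.choose_spec
    generalize h'.2.choose_spec.2.choose = z' at hz' ⊢
    generalize h'.2.choose = v' at hv' hz' ⊢
    have e : simpMap v z = simpMap v' z' := hz.trans hz'.symm
    by_cases hvv : v = v'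
    · subst hvv
      rw [face_inj hv e]
    · have b1 : bdry z := by
        by_contra hc
        exact hvv (face_unique hv hv' e hc)
      have b2 : bdry z' := by
        by_contra hc
        exact hvv (face_unique hv' hv e.symm hc).symm
      rw [hG.e1 v hv _ _ b1, hG.e1 v' hv' _ _ b2, e]

theorem extF_mem {A : Set X} (h1 : ∀ x, σ x ∈ A) (h2 : ∀ v, StrictMono v → ∀ z, Q v z ∈ A) (p) :
    extF σ Q p ∈ A := by
  unfold extF
  split_ifs with h
  · exact h2 _ h.2.choose_spec.1 _
  · exact h1 _

theorem extF_cont {T : Type} [TopologicalSpace T] (hk : r ≤ k) (σ : C(T × Sx k, X))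
    (Q : (Fin (r + 1) → Fin (k + 1)) → C(T × (Sx r × 𝕀), X))
    (hG : ∀ u, Good (fun x => σ (u, x)) (fun v z => Q v (u, z))) :
    Continuous fun p : T × (Sx k × 𝕀) => extF (fun x => σ (p.1, x)) (fun v z => Q v (p.1, z)) p.2 := by
  let S : Option {v : Fin (r + 1) → Fin (k + 1) // StrictMono v} → Set (T × (Sx k × 𝕀)) := fun o =>
    match o with
    | none => {p | rs r p.2 = 0}
    | some v => {p | inF v.1 (ry r p.2)}
  refine LocallyFinite.continuous (f := S) (locallyFinite_of_finite S) ?_ ?_ ?_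
  · rw [Set.eq_univ_iff_forall]
    intro p
    rw [Set.mem_iUnion]
    by_cases h : rs r p.2 = 0
    · exact ⟨none, h⟩
    · obtain ⟨v, hv, hy⟩ := exists_face hk (ry_supp r h)
      exact ⟨some ⟨v, hv⟩, hy⟩
  · rintro (_ | v)
    · exact isClosed_eq (by fun_prop) continuous_const
    · exact (inF_closed v.1).preimage (by fun_prop : Continuous fun p : T × (Sx k × 𝕀) => ry r p.2)
  · rintro (_ | v)
    · refine ContinuousOn.congr (f := fun p => σ (p.1, ry r p.2)) (by fun_prop) ?_
      intro p hp
      exact extF_zero hp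
    · refine ContinuousOn.congr
        (f := fun p => Q v.1 (p.1, (pull v.1 v.2.injective (ry r p.2), rs r p.2))) (by fun_prop) ?_
      intro p hp
      exact extF_face (hG p.1) v.2 (pull_spec v.2.injective hp)

theorem extF_nat {p : ℕ} (hp : r ≤ p) (hG : Good σ Q) {δ : Fin (p + 1) → Fin (k + 1)}
    (hδ : StrictMono δ) (x : Sx p) (t : 𝕀) :
    extF (fun x => σ (simpMap δ x)) (fun v : Fin (r + 1) → Fin (p + 1) => Q (δ ∘ v)) (x, t) =
      extF σ Q (simpMap δ x, t) := by
  have hc : ∀ (v : Fin (r + 1) → Fin (p + 1)) (z : Sx r),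
      simpMap δ (simpMap v z) = simpMap (δ ∘ v) z := fun v z => by
    rw [← simpMap_comp]; rfl
  have hG' : Good (fun x => σ (simpMap δ x)) (fun v : Fin (r + 1) → Fin (p + 1) => Q (δ ∘ v)) := by
    refine ⟨fun v hv z => ?_, fun v hv z s hz => ?_⟩
    · rw [hc]; exact hG.e0 _ (hδ.comp hv) z
    · rw [hc]; exact hG.e1 _ (hδ.comp hv) z s hz
  by_cases h : rs r (x, t) = 0
  · rw [extF_zero h, extF_zero (by rw [rs_simpMap r hδ.injective, h]), ry_simpMap r hδ.injective]
  · obtain ⟨v, hv, hy⟩ := exists_face hp (ry_supp r h)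
    have e := pull_spec hv.injective hy
    rw [extF_face hG' hv e, extF_face hG (hδ.comp hv) (z := pull v hv.injective (ry r (x, t))),
      rs_simpMap r hδ.injective]
    rw [ry_simpMap r hδ.injective, ← hc, e]

theorem extF_start (x : Sx k) : extF σ Q (x, 0) = σ x := by
  rw [extF_zero (rs_zero r x), ry_zero]

end exten

/-! ### Theorem B : making a bounded cocycle vanish on an amenable subspace -/

section thmB
variable {A : Set X} {k r n : ℕ}

open scoped Classical in
/-- the homotopy of a face, stationary unless the face lies in `A` -/
def qX (A : Set X) (ρ : C(Sx r, X)) (g : KG r A) : C(Sx r × 𝕀, X) :=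
  if h : ∀ x, ρ x ∈ A then
    (subInc A).comp (kq ⟨fun x => ⟨ρ x, h x⟩, ρ.continuous.subtype_mk _⟩ g) else ρ.comp ContinuousMap.fst

theorem qX_zero (ρ : C(Sx r, X)) (g : KG r A) (x) : qX A ρ g (x, 0) = ρ x := by
  unfold qX
  split_ifs with h
  · exact congrArg Subtype.val (kq_zero _ g x)
  · rfl

theorem qX_bdry (ρ : C(Sx r, X)) (g : KG r A) (x s) (hx : bdry x) : qX A ρ g (x, s) = ρ x := by
  unfold qX
  split_ifs with h
  · exact congrArg Subtype.val (kq_bdry _ g x s hx)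
  · rfl

theorem qX_mem (ρ : C(Sx r, X)) (g : KG r A) (hρ : ∀ x, ρ x ∈ A) (z) : qX A ρ g z ∈ A := by
  unfold qX
  rw [dif_pos hρ]
  exact Subtype.property _

theorem qX_of (ρ : C(Sx r, A)) (g : KG r A) (z) :
    qX A ((subInc A).comp ρ) g z = (kq ρ g z).1 := by
  have h : ∀ x, ((subInc A).comp ρ) x ∈ A := fun x => (ρ x).2
  unfold qX
  rw [dif_pos h]
  rfl

/-- index set of faces -/
abbrev FI (r k : ℕ) : Type := Lex (Fin (r + 1) → Fin (k + 1))

theorem good_q (σ : C(Sx k, X)) (g : FI r k → KG r A) :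
    Good (fun x => σ x) (fun v z => qX A (σ.comp (simpMap v)) (g (toLex v)) z) :=
  ⟨fun _ _ z => qX_zero _ _ z, fun _ _ z s hz => qX_bdry _ _ z s hz⟩

/-- the deformation of a simplex -/
def PP (hk : r ≤ k) (σ : C(Sx k, X)) (g : FI r k → KG r A) : C(Sx k × 𝕀, X) where
  toFun p := extF (fun x => σ x) (fun v z => qX A (σ.comp (simpMap v)) (g (toLex v)) z) p
  continuous_toFun := by
    have := extF_cont (T := Unit) hk (σ.comp ContinuousMap.snd)
      (fun v => (qX A (σ.comp (simpMap v)) (g (toLex v))).comp ContinuousMap.snd) fun _ => good_q σ g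
    exact this.comp (by fun_prop : Continuous fun p : Sx k × 𝕀 => ((), p))

theorem PP_apply (hk : r ≤ k) (σ : C(Sx k, X)) (g : FI r k → KG r A) (p : Sx k × 𝕀) :
    PP hk σ g p = extF (fun x => σ x) (fun v z => qX A (σ.comp (simpMap v)) (g (toLex v)) z) p := rfl

theorem PP_zero (hk : r ≤ k) (σ : C(Sx k, X)) (g : FI r k → KG r A) : slice (PP hk σ g) 0 = σ := by
  ext x
  rw [slice_apply, PP_apply]
  exact extF_start (X := X) x

theorem PP_mem (hk : r ≤ k) (σ : C(Sx k, X)) (g : FI r k → KG r A) (h : ∀ x, σ x ∈ A) (p) :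
    PP hk σ g p ∈ A := by
  rw [PP_apply]
  exact extF_mem h (fun v _ z => qX_mem (σ.comp (simpMap v)) _ (fun _ => h _) z) p

/-- composing faces -/
def fcomp {p : ℕ} (δ : Fin (p + 1) → Fin (k + 1)) : FI r p → FI r k := fun v => toLex (δ ∘ ofLex v)

theorem fcomp_mono {p : ℕ} {δ : Fin (p + 1) → Fin (k + 1)} (hδ : StrictMono δ) :
    StrictMono (fcomp δ : FI r p → FI r k) := by
  rintro v w ⟨i, h1, h2⟩
  exact ⟨i, fun j hj => congrArg δ (h1 j hj), hδ h2⟩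

theorem PP_face (hk : r ≤ k) (σ : C(Sx (k + 1), X)) (g : FI r (k + 1) → KG r A) (i) :
    pface (PP (hk.trans k.le_succ) σ g) i = PP hk (σ.comp (faceMap k i)) (g ∘ fcomp i.succAbove) := by
  ext ⟨x, t⟩
  exact (extF_nat hk (good_q σ g) (Fin.strictMono_succAbove i) x t).symm.trans (by
    have : ∀ v : Fin (r + 1) → Fin (k + 1), σ.comp (simpMap (i.succAbove ∘ v)) =
        (σ.comp (faceMap k i)).comp (simpMap v) := fun v => by
      rw [← simpMap_comp]; rfl
    rw [PP_apply]
    simp only [this]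
    rfl)

/-- invariance under homotopies in `A` relative to the `(r-1)`-skeleton -/
def DD (A : Set X) (r : ℕ) (φ : SingularChain ℝ X k →ₗ[ℝ] ℝ) : Prop :=
  ∀ H : C(Sx k × 𝕀, X), (∀ p, H p ∈ A) → (∀ x t, cnt x.1 0 ≤ r → H (x, t) = H (x, 0)) →
    φ (Finsupp.single (slice H 0) 1) = φ (Finsupp.single (slice H 1) 1)

theorem cnt_face (i : Fin (n + 2)) (x : Sx n) : cnt (faceMap n i x).1 0 ≤ n + 1 := by
  classical
  have : (faceMap n i x).1 i = 0 := by
    rw [faceMap_eq]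
    exact simpMap_off _ _ (by simp)
  unfold cnt
  refine (Finset.card_le_card (t := Finset.univ.erase i) fun j hj => ?_).trans ?_
  · rw [Finset.mem_filter] at hj
    refine Finset.mem_erase.2 ⟨?_, Finset.mem_univ _⟩
    rintro rfl
    exact absurd hj.2 (by rw [this]; exact lt_irrefl _)
  · rw [Finset.card_erase_of_mem (Finset.mem_univ _), Finset.card_univ, Fintype.card_fin]; omega

theorem DD_top (φ : SingularChain ℝ X (n + 1) →ₗ[ℝ] ℝ)
    (hφ : ∀ c : SingularChain ℝ X (n + 2), φ (bd c) = 0) : DD A (n + 1) φ := by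
  intro H _ hH
  let H0 : C(Sx (n + 1) × 𝕀, X) := (slice H 0).comp ContinuousMap.fst
  have hf : ∀ i, pface H0 i = pface H i := fun i => by
    ext ⟨x, t⟩
    exact (hH _ t (cnt_face i x)).symm
  have h1 := hφ (prism H)
  have h2 := hφ (prism H0)
  rw [bd_prism, map_sub, map_sub] at h1 h2
  simp only [hf] at h2
  have h3 : slice H0 0 = slice H0 1 := rfl
  rw [h3] at h2
  linarith

theorem DD_const (hA : Amen A) (φ : SingularChain ℝ X k →ₗ[ℝ] ℝ) (h : DD A 0 φ) :
    ∃ a, ∀ σ : C(Sx k, X), (∀ t, σ t ∈ A) → φ (Finsupp.single σ 1) = a := by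
  have := hA.1
  obtain ⟨a0⟩ := (inferInstance : Nonempty A)
  refine ⟨φ (Finsupp.single (ContinuousMap.const _ a0.1) 1), fun σ hσ => ?_⟩
  have hn : ∀ (x : Sx k) (P : Prop), cnt x.1 0 ≤ 0 → P := fun x P hx => by
    obtain ⟨i, hi⟩ := exists_pos x
    have : 0 < cnt x.1 0 := Finset.card_pos.2 ⟨i, Finset.mem_filter.2 ⟨Finset.mem_univ _, hi⟩⟩
    omega
  let m : C(Sx k × 𝕀, Sx k) := ⟨fun p => ⟨fun i => (1 - (p.2 : ℝ)) * p.1.1 i + p.2 * (bary k).1 i,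
    fun i => add_nonneg (mul_nonneg (sub_nonneg.2 p.2.2.2) (p.1.2.1 i)) (mul_nonneg p.2.2.1 ((bary k).2.1 i)), by
      have h1 := p.1.2.2
      have h2 := (bary k).2.2
      rw [Finset.sum_add_distrib, ← Finset.mul_sum, ← Finset.mul_sum, h1, h2]; ring⟩, by
    refine Continuous.subtype_mk (continuous_pi fun j => ?_) _
    exact ((continuous_const.sub (continuous_subtype_val.comp continuous_snd)).mul
      ((cont_coord j).comp continuous_fst)).add
      ((continuous_subtype_val.comp continuous_snd).mul continuous_const)⟩
  have e1 := h (σ.comp m) (fun p => hσ _) (fun x t hx => hn x _ hx)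
  have s0 : slice (σ.comp m) 0 = σ := by
    ext x
    show σ (m (x, 0)) = σ x
    congr 1
    apply Subtype.ext
    funext i
    show (1 - ((0 : 𝕀) : ℝ)) * x.1 i + ((0 : 𝕀) : ℝ) * (bary k).1 i = _
    simp
  have s1 : slice (σ.comp m) 1 = ContinuousMap.const _ (σ (bary k)) := by
    ext x
    show σ (m (x, 1)) = σ (bary k)
    congr 1
    apply Subtype.ext
    funext i
    show (1 - ((1 : 𝕀) : ℝ)) * x.1 i + ((1 : 𝕀) : ℝ) * (bary k).1 i = _
    simp
  rw [s0, s1] at e1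
  rw [e1]
  obtain ⟨γ⟩ := PathConnectedSpace.joined (⟨σ (bary k), hσ _⟩ : A) a0
  have e2 := h ((subInc A).comp (γ.toContinuousMap.comp ContinuousMap.snd)) (fun p => (γ p.2).2)
    (fun x t hx => hn x _ hx)
  have s2 : slice ((subInc A).comp (γ.toContinuousMap.comp (ContinuousMap.snd : C(Sx k × 𝕀, _)))) 0 =
      ContinuousMap.const _ (σ (bary k)) := by
    ext x
    exact congrArg Subtype.val γ.source
  have s3 : slice ((subInc A).comp (γ.toContinuousMap.comp (ContinuousMap.snd : C(Sx k × 𝕀, _)))) 1 =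
      ContinuousMap.const _ a0.1 := by
    ext x
    exact congrArg Subtype.val γ.target
  rwa [s2, s3] at e2

end thmB

section thmB2
variable {A : Set X} {k r n : ℕ}

theorem cnt_bdry (v : Fin (r + 1) → Fin (k + 1)) {z : Sx r} (hz : bdry z) : cnt (simpMap v z).1 0 ≤ r := by
  classical
  obtain ⟨i0, hi0⟩ := hz
  have h : (Finset.univ.filter fun j => 0 < (simpMap v z).1 j) ⊆ (Finset.univ.erase i0).image v := by
    intro j hj
    by_contra hc
    have : (simpMap v z).1 j = 0 := by
      rw [simpMap_apply]
      refine Finset.sum_eq_zero fun i _ => ?_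
      split_ifs with h
      · by_contra h2
        exact hc (Finset.mem_image.2 ⟨i, Finset.mem_erase.2 ⟨fun e => h2 (e ▸ hi0), Finset.mem_univ _⟩, h⟩)
      · rfl
    exact absurd (Finset.mem_filter.1 hj).2 (by rw [this]; exact lt_irrefl _)
  refine (Finset.card_le_card h).trans (Finset.card_image_le.trans ?_)
  rw [Finset.card_erase_of_mem (Finset.mem_univ _), Finset.card_univ, Fintype.card_fin]; omega

theorem exists_theta (hk : r ≤ k) (H : C(Sx k × 𝕀, X)) (hA : ∀ p, H p ∈ A)
    (hH : ∀ x t, cnt x.1 0 ≤ r → H (x, t) = H (x, 0)) :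
    ∃ a : FI r k → KG r A, ∀ g : FI r k → KG r A, ∃ θ : C(Sx k × 𝕀, X), (∀ p, θ p ∈ A) ∧
      (∀ x t, cnt x.1 0 ≤ r + 1 → θ (x, t) = θ (x, 0)) ∧
      slice θ 0 = slice (PP hk (slice H 0) (a * g)) 1 ∧ slice θ 1 = slice (PP hk (slice H 1) g) 1 := by
  let HA : (Fin (r + 1) → Fin (k + 1)) → C(𝕀 × Sx r, A) := fun v =>
    ⟨fun p => ⟨H (simpMap v p.2, p.1), hA _⟩, by
      refine Continuous.subtype_mk ?_ _
      fun_prop⟩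
  have hHA : ∀ v u x, (HA v (u, x)).1 = H (simpMap v x, u) := fun v u x => rfl
  have h1 : ∀ v, ∀ u x, bdry x → HA v (u, x) = HA v (0, x) := fun v u x hx =>
    Subtype.ext (hH _ u (cnt_bdry v hx))
  choose a ha using fun v => kq_K (HA v) (h1 v)
  refine ⟨fun v => a (ofLex v), fun g => ?_⟩
  choose Q hQ0 hQ1 hQs hQb hQt using fun v => ha v (g (toLex v))
  let S : C(𝕀 × Sx k, X) := ⟨fun p => H (p.2, hlf p.1), by
    have := hlf_cont
    fun_prop⟩
  have hG : ∀ u, Good (fun x => S (u, x)) (fun v z => ((subInc A).comp (Q v)) (u, z)) := by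
    intro u
    refine ⟨fun v hv z => ?_, fun v hv z s hz => ?_⟩
    · exact congrArg Subtype.val (hQs v u z)
    · exact (congrArg Subtype.val (hQb v u z s hz)).trans (hH _ _ (cnt_bdry v hz)).symm
  have hc := extF_cont hk S (fun v => (subInc A).comp (Q v)) hG
  let θ : C(Sx k × 𝕀, X) := ⟨fun p => extF (fun x => S (p.2, x))
    (fun v z => ((subInc A).comp (Q v)) (p.2, z)) (p.1, 1),
    hc.comp (by fun_prop : Continuous fun p : Sx k × 𝕀 => (p.2, (p.1, (1 : 𝕀))))⟩
  have hθ : ∀ x u, θ (x, u) = extF (fun x => S (u, x))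
    (fun v z => ((subInc A).comp (Q v)) (u, z)) (x, 1) := fun _ _ => rfl
  refine ⟨θ, fun p => ?_, fun x t hx => ?_, ?_, ?_⟩
  · obtain ⟨x, u⟩ := p
    rw [hθ]
    exact extF_mem (fun x => hA (x, hlf u)) (fun v _ z => (Q v (u, z)).2) _
  · obtain ⟨v, hv, hy⟩ := exists_face hk hx
    have e : simpMap v (pull v hv.injective x) = ry r (x, 1) := by
      rw [pull_spec hv.injective hy, ry_small r hx]
    rw [hθ, hθ, extF_face (hG t) hv e, extF_face (hG 0) hv e, rs_small r hx]
    exact congrArg Subtype.val (hQt v t _)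
  · ext x
    rw [slice_apply, slice_apply, hθ, PP_apply]
    have e1 : (fun x => S (0, x)) = fun x => slice H 0 x := by
      funext x
      show H (x, hlf 0) = H (x, 0)
      rw [hlf_zero]
    have e2 : (fun v z => ((subInc A).comp (Q v)) (0, z)) = fun v z =>
        qX A ((slice H 0).comp (simpMap v)) (((fun v => a (ofLex v)) * g : FI r k → KG r A) (toLex v)) z := by
      funext v z
      exact (congrArg Subtype.val (hQ0 v z)).trans (qX_of ((HA v).curry 0) _ z).symm
    rw [e1, e2]
  · ext x
    rw [slice_apply, slice_apply, hθ, PP_apply]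
    have e1 : (fun x => S (1, x)) = fun x => slice H 1 x := by
      funext x
      show H (x, hlf 1) = H (x, 1)
      rw [hlf_one]
    have e2 : (fun v z => ((subInc A).comp (Q v)) (1, z)) = fun v z =>
        qX A ((slice H 1).comp (simpMap v)) (g (toLex v)) z := by
      funext v z
      exact (congrArg Subtype.val (hQ1 v z)).trans (qX_of ((HA v).curry 1) _ z).symm
    rw [e1, e2]

theorem stepB (hA : Amen A) (hr : r ≤ n) (φ : SingularChain ℝ X (n + 1) →ₗ[ℝ] ℝ)
    (hφ : ∀ c : SingularChain ℝ X (n + 2), φ (bd c) = 0)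
    (h1 : ∀ σ, |φ (Finsupp.single σ 1)| ≤ 1) (hD : DD A (r + 1) φ) :
    ∃ (ψ : SingularChain ℝ X n →ₗ[ℝ] ℝ) (K : ℝ), (∀ σ, |ψ (Finsupp.single σ 1)| ≤ K) ∧
      (∀ σ, |(φ - ψ ∘ₗ bd) (Finsupp.single σ 1)| ≤ 1) ∧ DD A r (φ - ψ ∘ₗ bd) := by
  obtain ⟨M⟩ := kg_mean (r := r) hA
  let ψ : SingularChain ℝ X n →ₗ[ℝ] ℝ := Finsupp.linearCombination ℝ
    (fun σ => av M (fun g : FI r n → KG r A => φ (prism (PP hr σ g))))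
  have hψ : ∀ σ, ψ (Finsupp.single σ 1) = av M (fun g : FI r n → KG r A => φ (prism (PP hr σ g))) :=
    fun σ => by simp [ψ]
  have hr' : r ≤ n + 1 := hr.trans n.le_succ
  have key : ∀ σ, (φ - (-ψ) ∘ₗ bd) (Finsupp.single σ 1) =
      av M (fun g : FI r (n + 1) → KG r A => φ (Finsupp.single (slice (PP hr' σ g) 1) 1)) := by
    intro σ
    have e : ∀ g : FI r (n + 1) → KG r A, φ (Finsupp.single (slice (PP hr' σ g) 1) 1) =
        φ (Finsupp.single σ 1) + ∑ i : Fin (n + 2), (-1 : ℝ) ^ (i : ℕ) *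
          φ (prism (PP hr (σ.comp (faceMap n i)) (g ∘ fcomp i.succAbove))) := by
      intro g
      have := hφ (prism (PP hr' σ g))
      rw [bd_prism, map_sub, map_sub, PP_zero, map_sum] at this
      simp only [map_smul, smul_eq_mul, PP_face hr] at this
      linarith
    simp only [e]
    rw [av_add, av_const, av_sum]
    simp only [av_smul]
    have e2 : ∀ i : Fin (n + 2), av M (fun g : FI r (n + 1) → KG r A =>
        φ (prism (PP hr (σ.comp (faceMap n i)) (g ∘ fcomp i.succAbove)))) =
        ψ (Finsupp.single (σ.comp (faceMap n i)) 1) := fun i => by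
      rw [hψ]
      exact av_marg M (fcomp i.succAbove) (fcomp_mono (Fin.strictMono_succAbove i))
        (fun g => φ (prism (PP hr (σ.comp (faceMap n i)) g)))
    simp only [e2]
    rw [LinearMap.sub_apply, LinearMap.comp_apply, LinearMap.neg_apply, sub_neg_eq_add, bd_single]
    rw [map_sum]
    simp only [map_smul, smul_eq_mul]
  refine ⟨-ψ, prC n, fun σ => ?_, fun σ => ?_, ?_⟩
  · rw [LinearMap.neg_apply, abs_neg, hψ]
    refine av_bound M _ _ fun g => ?_
    simpa using prism_bound φ h1 (PP hr σ g)
  · rw [key]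
    exact av_bound M _ _ fun g => h1 _
  · intro H hHA hH
    rw [key, key]
    obtain ⟨a, ha⟩ := exists_theta hr' H hHA hH
    rw [← av_inv M _ 1 (fun g => h1 _) a]
    congr 1
    funext g
    obtain ⟨θ, t1, t2, t3, t4⟩ := ha g
    have := hD θ t1 t2
    rwa [t3, t4] at this

theorem thmB (hA : Amen A) (φ : SingularChain ℝ X (n + 1) →ₗ[ℝ] ℝ)
    (hφ : ∀ c : SingularChain ℝ X (n + 2), φ (bd c) = 0)
    (h1 : ∀ σ, |φ (Finsupp.single σ 1)| ≤ 1) :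
    ∃ (ψ : SingularChain ℝ X n →ₗ[ℝ] ℝ) (K : ℝ), (∀ σ, |ψ (Finsupp.single σ 1)| ≤ K) ∧
      (∀ σ, |φ (Finsupp.single σ 1) - ψ (bd (Finsupp.single σ 1))| ≤ 1) ∧
      (∀ σ : C(Sx (n + 1), X), (∀ t, σ t ∈ A) → φ (Finsupp.single σ 1) -
        ψ (bd (Finsupp.single σ 1)) = 0) := by
  have main : ∀ r, r ≤ n + 1 → ∀ φ : SingularChain ℝ X (n + 1) →ₗ[ℝ] ℝ,
      (∀ c : SingularChain ℝ X (n + 2), φ (bd c) = 0) →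
      (∀ σ, |φ (Finsupp.single σ 1)| ≤ 1) → DD A r φ →
      ∃ (ψ : SingularChain ℝ X n →ₗ[ℝ] ℝ) (K : ℝ), (∀ σ, |ψ (Finsupp.single σ 1)| ≤ K) ∧
      (∀ σ, |φ (Finsupp.single σ 1) - ψ (bd (Finsupp.single σ 1))| ≤ 1) ∧
      (∀ σ : C(Sx (n + 1), X), (∀ t, σ t ∈ A) → φ (Finsupp.single σ 1) -
        ψ (bd (Finsupp.single σ 1)) = 0) := by
    intro r
    induction r with
    | zero =>
      intro _ φ hφ h1 hD
      obtain ⟨a, ha⟩ := DD_const hA φ hD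
      exact alternate φ hφ h1 a ha
    | succ r ih =>
      intro hr φ hφ h1 hD
      obtain ⟨ψ, K, a1, a2, a3⟩ := stepB hA (by omega) φ hφ h1 hD
      obtain ⟨ψ', K', b1, b2, b3⟩ := ih (by omega) (φ - ψ ∘ₗ bd) (fun c => by
        rw [LinearMap.sub_apply, LinearMap.comp_apply, bd_bd, hφ]; simp) a2 a3
      have e : ∀ c, (φ - ψ ∘ₗ bd) c - ψ' (bd c) = φ c - (ψ + ψ') (bd c) := fun c => by
        simp only [LinearMap.sub_apply, LinearMap.comp_apply, LinearMap.add_apply]; ring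
      refine ⟨ψ + ψ', K + K', fun σ => ?_, fun σ => ?_, fun σ hσ => ?_⟩
      · rw [LinearMap.add_apply]
        exact (abs_add_le _ _).trans (add_le_add (a1 σ) (b1 σ))
      · rw [← e]; exact b2 σ
      · rw [← e]; exact b3 σ hσ
  exact main (n + 1) le_rfl φ hφ h1 (DD_top φ hφ)

end thmB2

/-! ### Vanishing of homology of subsets, Mayer-Vietoris -/

section hz

/-- the homology of the subspace `A` vanishes in degree `j` -/
def Hz (R : Type) [CommRing R] (A : Set X) : ℕ → Prop
  | 0 => ∀ c ∈ con R A 0, ∃ b ∈ con R A 1, bd b = c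
  | j + 1 => ∀ c ∈ con R A (j + 1), bd c = 0 → ∃ b ∈ con R A (j + 2), bd b = c

theorem hz_bd {A : Set X} {j : ℕ} (h : Hz R A j) (a : SingularChain R X (j + 1))
    (ha : bd a ∈ con R A j) : ∃ w ∈ con R A (j + 1), bd w = bd a := by
  cases j with
  | zero => exact h _ ha
  | succ j => exact h _ ha (bd_bd a)

theorem hz_empty (j : ℕ) : Hz R (∅ : Set X) j := by
  cases j with
  | zero => exact fun c hc => ⟨0, Submodule.zero_mem _, by rw [con_empty hc, map_zero]⟩
  | succ j => exact fun c hc _ => ⟨0, Submodule.zero_mem _, by rw [con_empty hc, map_zero]⟩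

theorem sd_hom {j : ℕ} (N : ℕ) (c : SingularChain R X (j + 1)) (h : bd c = 0) :
    c = sdN N c - bd (sdD N c) := by
  rw [sdN_homotopy, h, map_zero]; abel

theorem mv1 {U V : Set X} (hU : IsOpen U) (hV : IsOpen V) {j : ℕ} (h1 : Hz R U (j + 1))
    (h2 : Hz R V (j + 1)) (h3 : Hz R (U ∩ V) j) : Hz R (U ∪ V) (j + 1) := by
  intro c hc hb
  obtain ⟨N, hN⟩ := small hU hV hc
  obtain ⟨a, ha, b, hb', hab⟩ := Submodule.mem_sup.1 (hN N le_rfl)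
  have e : bd a + bd b = 0 := by rw [← map_add, hab, bd_sdN, hb, map_zero]
  have hin : bd a ∈ con R (U ∩ V) j := con_inter (bd_con ha) (by
    rw [eq_neg_of_add_eq_zero_left e]
    exact Submodule.neg_mem _ (bd_con hb'))
  obtain ⟨w, hw, hw'⟩ := hz_bd h3 a hin
  obtain ⟨p, hp, hp'⟩ := h1 (a - w) (Submodule.sub_mem _ ha (con_mono Set.inter_subset_left hw))
    (by rw [map_sub, hw', sub_self])
  obtain ⟨q, hq, hq'⟩ := h2 (b + w) (Submodule.add_mem _ hb' (con_mono Set.inter_subset_right hw))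
    (by rw [map_add, hw', add_comm, e])
  refine ⟨p + q - sdD N c, Submodule.sub_mem _ (Submodule.add_mem _
    (con_mono Set.subset_union_left hp) (con_mono Set.subset_union_right hq)) (sdD_con N hc), ?_⟩
  conv_rhs => rw [sd_hom N c hb]
  rw [map_sub, map_add, hp', hq', ← hab]
  abel

theorem mv2 {U V : Set X} (hU : IsOpen U) (hV : IsOpen V) {j : ℕ} (h1 : Hz R U (j + 1))
    (h2 : Hz R V (j + 1)) (h3 : Hz R (U ∪ V) (j + 2)) : Hz R (U ∩ V) (j + 1) := by
  intro c hc hb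
  obtain ⟨u, hu, hu'⟩ := h1 c (con_mono Set.inter_subset_left hc) hb
  obtain ⟨v, hv, hv'⟩ := h2 c (con_mono Set.inter_subset_right hc) hb
  obtain ⟨w, hw, hw'⟩ := h3 (u - v) (Submodule.sub_mem _ (con_mono Set.subset_union_left hu)
    (con_mono Set.subset_union_right hv)) (by rw [map_sub, hu', hv', sub_self])
  obtain ⟨N, hN⟩ := small hU hV hw
  obtain ⟨a, ha, b, hb', hab⟩ := Submodule.mem_sup.1 (hN N le_rfl)
  have e : sdN N u - bd a = sdN N v + bd b := by
    have : bd a + bd b = sdN N u - sdN N v := by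
      rw [← map_add, hab, bd_sdN, hw', map_sub]
    have h2 : sdN N u = (bd a + bd b) + sdN N v := by rw [this]; abel
    rw [h2]; abel
  refine ⟨sdN N u - bd a - sdD N c, Submodule.sub_mem _ (con_inter
    (Submodule.sub_mem _ (sdN_con N hu) (bd_con ha)) ?_) (sdD_con N hc), ?_⟩
  · rw [e]
    exact Submodule.add_mem _ (sdN_con N hv) (bd_con hb')
  · rw [map_sub, map_sub, bd_sdN, hu', bd_bd, sub_zero]
    exact (sd_hom N c hb).symm

/-- every chain has compact support -/
theorem con_compact {A : Set X} {j : ℕ} {c : SingularChain R X j} (hc : c ∈ con R A j) :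
    ∃ K : Set X, IsCompact K ∧ K ⊆ A ∧ c ∈ con R K j := by
  refine ⟨⋃ σ ∈ c.support, Set.range σ, ?_, ?_, ?_⟩
  · refine c.support.isCompact_biUnion fun σ _ => ?_
    exact isCompact_range σ.continuous
  · refine Set.iUnion₂_subset fun σ hσ => ?_
    rintro _ ⟨t, rfl⟩
    exact mem_con.1 hc σ hσ t
  · exact mem_con.2 fun σ hσ t => Set.mem_biUnion hσ ⟨t, rfl⟩

theorem bd_const (p : X) (j : ℕ) :
    bd (Finsupp.single (ContinuousMap.const (Sx (j + 1)) p) (1 : R)) =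
      if Even (j + 2) then 0 else Finsupp.single (ContinuousMap.const (Sx j) p) 1 := by
  rw [bd_single]
  have : ∀ i : Fin (j + 2), (ContinuousMap.const (Sx (j + 1)) p).comp (faceMap j i) =
    ContinuousMap.const (Sx j) p := fun i => rfl
  simp only [this]
  rw [← Finset.sum_smul, Fin.sum_neg_one_pow]
  split_ifs <;> simp

theorem pf_const (p : Y) {j : ℕ} (c : SingularChain R X j) :
    ∃ r : R, pf (ContinuousMap.const X p) c = r • Finsupp.single (ContinuousMap.const (Sx j) p) 1 := by
  induction c using Finsupp.induction_linear with
  | zero => exact ⟨0, by simp⟩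
  | add a b ha hb =>
    obtain ⟨r, hr⟩ := ha
    obtain ⟨s, hs⟩ := hb
    exact ⟨r + s, by rw [map_add, hr, hs, add_smul]⟩
  | single σ r =>
    refine ⟨r, ?_⟩
    rw [pf_single, Finsupp.smul_single, smul_eq_mul, mul_one]
    rfl

/-- cycles of positive degree pushed to a point bound there -/
theorem const_bd (p : Y) {j : ℕ} (c : SingularChain R X (j + 1)) (hc : bd c = 0) :
    ∃ b ∈ con R {p} (j + 2), bd b = pf (ContinuousMap.const X p) c := by
  obtain ⟨r, hr⟩ := pf_const p c
  by_cases he : Even (j + 2)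
  · refine ⟨r • Finsupp.single (ContinuousMap.const _ p) 1,
      Submodule.smul_mem _ _ (single_mem_con (fun _ => rfl) _), ?_⟩
    rw [map_smul, bd_const, if_neg (by rw [Nat.even_add_one]; simpa using he), hr]
  · have h0 : bd (pf (ContinuousMap.const X p) c) = 0 := by rw [bd_pf, hc, map_zero]
    rw [hr, map_smul, bd_const, if_neg he, Finsupp.smul_single, smul_eq_mul, mul_one,
      Finsupp.single_eq_zero] at h0
    exact ⟨0, Submodule.zero_mem _, by rw [hr, h0, zero_smul, map_zero]⟩

theorem hz_convex {m : ℕ} {E : Set (Fin m → ℝ)} (hE : Convex ℝ E) (j : ℕ) : Hz R E (j + 1) := by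
  rcases E.eq_empty_or_nonempty with rfl | ⟨p, hp⟩
  · exact hz_empty _
  intro c hc hb
  let F : C((Fin m → ℝ) × 𝕀, Fin m → ℝ) := ⟨fun x => (1 - (x.2 : ℝ)) • x.1 + (x.2 : ℝ) • p, by fun_prop⟩
  obtain ⟨b, hb1, hb2⟩ := const_bd p c hb
  have h1 : slice F 1 = ContinuousMap.const _ p := by
    ext x i
    simp [slice_apply, F]
  have h0 : slice F 0 = ContinuousMap.id _ := by
    ext x i
    simp [slice_apply, F]
  have := bd_hop F c
  rw [hb, map_zero, sub_zero, h1, h0, pf_id] at this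
  refine ⟨b - hop F c, Submodule.sub_mem _ (con_mono (by simpa using hp) hb1) (hop_con ?_ hc), ?_⟩
  · intro x hx s
    exact hE hx hp (sub_nonneg.2 s.2.2) s.2.1 (by ring)
  · rw [map_sub, hb2, this]; abel

theorem hz_side {m : ℕ} (a b : Fin m → ℝ) (hab : a ≤ b) (k : ℕ) (hk : k ≤ m) :
    ∀ (C : Set (Fin m → ℝ)), IsOpen C → Convex ℝ C → ∀ j, k ≤ j →
      Hz R {x | x ∈ C ∧ ∃ i : Fin m, i.1 < k ∧ (x i < a i ∨ b i < x i)} j := by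
  have hop : ∀ (C : Set (Fin m → ℝ)) (k : ℕ), IsOpen C →
      IsOpen {x | x ∈ C ∧ ∃ i : Fin m, i.1 < k ∧ (x i < a i ∨ b i < x i)} := by
    intro C k hC
    have : {x | x ∈ C ∧ ∃ i : Fin m, i.1 < k ∧ (x i < a i ∨ b i < x i)} =
        C ∩ ⋃ i : Fin m, ⋃ (_ : i.1 < k), ({x | x i < a i} ∪ {x | b i < x i}) := by
      ext x; simp
    rw [this]
    refine hC.inter (isOpen_iUnion fun i => isOpen_iUnion fun _ => ?_)
    exact (isOpen_lt (continuous_apply i) continuous_const).union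
      (isOpen_lt continuous_const (continuous_apply i))
  induction k with
  | zero =>
    intro C _ _ j _
    have : {x | x ∈ C ∧ ∃ i : Fin m, i.1 < 0 ∧ (x i < a i ∨ b i < x i)} = ∅ := by ext x; simp
    rw [this]
    exact hz_empty j
  | succ k ih =>
    intro C hC hC' j hj
    obtain ⟨j, rfl⟩ : ∃ j', j = j' + 1 := ⟨j - 1, by omega⟩
    let i0 : Fin m := ⟨k, hk⟩
    let U : Set (Fin m → ℝ) := {x | x ∈ C ∧ ∃ i : Fin m, i.1 < k ∧ (x i < a i ∨ b i < x i)}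
    let L : Set (Fin m → ℝ) := C ∩ {x | x i0 < a i0}
    let Rr : Set (Fin m → ℝ) := C ∩ {x | b i0 < x i0}
    have oL : IsOpen L := hC.inter (isOpen_lt (continuous_apply i0) continuous_const)
    have oR : IsOpen Rr := hC.inter (isOpen_lt continuous_const (continuous_apply i0))
    have cL : Convex ℝ L := hC'.inter (convex_halfSpace_lt (LinearMap.proj i0 : (Fin m → ℝ) →ₗ[ℝ] ℝ).isLinear _)
    have cR : Convex ℝ Rr := hC'.inter (convex_halfSpace_gt (LinearMap.proj i0 : (Fin m → ℝ) →ₗ[ℝ] ℝ).isLinear _)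
    have hU : Hz R U (j + 1) := ih (by omega) C hC hC' _ (by omega)
    have e1 : U ∩ L = {x | x ∈ L ∧ ∃ i : Fin m, i.1 < k ∧ (x i < a i ∨ b i < x i)} := by
      ext x
      exact ⟨fun ⟨⟨_, h2⟩, h3⟩ => ⟨h3, h2⟩, fun ⟨h3, h2⟩ => ⟨⟨h3.1, h2⟩, h3⟩⟩
    have hUL : Hz R (U ∪ L) (j + 1) := mv1 (hop C k hC) oL hU (hz_convex cL j) (by
      rw [e1]; exact ih (by omega) L oL cL j (by omega))
    have e2 : (U ∪ L) ∩ Rr = {x | x ∈ Rr ∧ ∃ i : Fin m, i.1 < k ∧ (x i < a i ∨ b i < x i)} := by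
      ext x
      have := hab i0
      have h2 : x i0 < a i0 → b i0 < x i0 → False := fun h h' => by linarith
      constructor
      · rintro ⟨⟨_, h3⟩ | ⟨_, h3⟩, h5⟩
        · exact ⟨h5, h3⟩
        · exact (h2 h3 h5.2).elim
      · exact fun ⟨h3, h4⟩ => ⟨Or.inl ⟨h3.1, h4⟩, h3⟩
    have hF : Hz R ((U ∪ L) ∪ Rr) (j + 1) := mv1 ((hop C k hC).union oL) oR hUL (hz_convex cR j) (by
      rw [e2]; exact ih (by omega) Rr oR cR j (by omega))
    convert hF using 1
    ext x
    simp only [U, L, Rr, Set.mem_inter_iff, Set.mem_union, Set.mem_ofPred_eq]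
    constructor
    · rintro ⟨h1, i, h2, h3⟩
      rcases Nat.lt_succ_iff_lt_or_eq.1 h2 with h | h
      · exact Or.inl (Or.inl ⟨h1, i, h, h3⟩)
      · obtain rfl : i = i0 := Fin.ext h
        tauto
    · rintro ((⟨h1, i, h2, h3⟩ | ⟨h1, h2⟩) | ⟨h1, h2⟩)
      · exact ⟨h1, i, by omega, h3⟩
      · exact ⟨h1, i0, Nat.lt_succ_self k, Or.inl h2⟩
      · exact ⟨h1, i0, Nat.lt_succ_self k, Or.inr h2⟩

theorem hz_box {m : ℕ} (hm : 1 ≤ m) {E : Set (Fin m → ℝ)} (hE : IsOpen E) (hE' : Convex ℝ E)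
    (a b : Fin m → ℝ) (j : ℕ) (hj : m ≤ j) : Hz R (E \ Set.Icc a b) j := by
  by_cases hab : a ≤ b
  · convert hz_side a b hab m le_rfl E hE hE' j hj using 1
    ext x
    simp only [Set.mem_sdiff, Set.mem_Icc, Set.mem_ofPred_eq, Pi.le_def, Fin.is_lt, true_and]
    rw [← forall_and, not_forall]
    refine and_congr_right fun _ => exists_congr fun i => ?_
    rw [not_and_or, not_le, not_le]
  · rw [Set.Icc_eq_empty hab, Set.sdiff_empty]
    obtain ⟨j, rfl⟩ : ∃ j', j = j' + 1 := ⟨j - 1, by omega⟩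
    exact hz_convex hE' j

theorem hz_boxes {m : ℕ} (hm : 1 ≤ m) {E : Set (Fin m → ℝ)} (hE : IsOpen E) (hE' : Convex ℝ E)
    (l : ℕ) : ∀ (B : Fin l → (Fin m → ℝ) × (Fin m → ℝ)) (j : ℕ), m ≤ j →
      Hz R (E \ ⋃ i, Set.Icc (B i).1 (B i).2) j := by
  have hcl : ∀ (l : ℕ) (B : Fin l → (Fin m → ℝ) × (Fin m → ℝ)), IsClosed (⋃ i, Set.Icc (B i).1 (B i).2) :=
    fun l B => isClosed_iUnion_of_finite fun i => isClosed_Icc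
  induction l with
  | zero =>
    intro B j hj
    obtain ⟨j, rfl⟩ : ∃ j', j = j' + 1 := ⟨j - 1, by omega⟩
    simpa using hz_convex (R := R) hE' j
  | succ l ih =>
    intro B j hj
    obtain ⟨j, rfl⟩ : ∃ j', j = j' + 1 := ⟨j - 1, by omega⟩
    let B' : Fin l → (Fin m → ℝ) × (Fin m → ℝ) := fun i => B i.succ
    let B2 : Fin l → (Fin m → ℝ) × (Fin m → ℝ) := fun i => ((B 0).1 ⊔ (B i.succ).1, (B 0).2 ⊓ (B i.succ).2)
    have h1 := ih B' (j + 1) hj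
    have h2 := hz_box (R := R) hm hE hE' (B 0).1 (B 0).2 (j + 1) hj
    have h3 := ih B2 (j + 2) (by omega)
    have e3 : (E \ ⋃ i, Set.Icc (B' i).1 (B' i).2) ∪ (E \ Set.Icc (B 0).1 (B 0).2) =
        E \ ⋃ i, Set.Icc (B2 i).1 (B2 i).2 := by
      have : ∀ i, Set.Icc (B2 i).1 (B2 i).2 = Set.Icc (B 0).1 (B 0).2 ∩ Set.Icc (B' i).1 (B' i).2 :=
        fun i => Set.Icc_inter_Icc.symm
      simp only [this]
      rw [← Set.inter_iUnion, Set.sdiff_inter, Set.union_comm]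
    rw [← e3] at h3
    have := mv2 (hE.sdiff (hcl l B')) (hE.sdiff isClosed_Icc) h1 h2 h3
    convert this using 1
    ext x
    simp only [Set.mem_sdiff, Set.mem_inter_iff, Set.mem_iUnion, Fin.exists_fin_succ, B']
    tauto

/-- open subsets of `ℝᵐ` have no homology in degrees `≥ m` -/
theorem hz_open {m : ℕ} (hm : 1 ≤ m) {O : Set (Fin m → ℝ)} (hO : IsOpen O) (j : ℕ) (hj : m ≤ j) :
    Hz R O j := by
  obtain ⟨j, rfl⟩ : ∃ j', j = j' + 1 := ⟨j - 1, by omega⟩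
  intro c hc hb
  obtain ⟨K, hK, hKO, hcK⟩ := con_compact hc
  obtain ⟨r, hr⟩ := hK.isBounded.subset_ball (0 : Fin m → ℝ)
  have hcomp : IsCompact (Metric.closedBall (0 : Fin m → ℝ) r \ O) :=
    (isCompact_closedBall _ _).diff hO
  have hloc : ∀ x ∈ Metric.closedBall (0 : Fin m → ℝ) r \ O, ∃ ε > 0, Disjoint (Metric.closedBall x ε) K := by
    intro x hx
    have : Kᶜ ∈ 𝓝 x := hK.isClosed.isOpen_compl.mem_nhds fun h => hx.2 (hKO h)
    obtain ⟨ε, h1, h2⟩ := Metric.nhds_basis_closedBall.mem_iff.1 this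
    exact ⟨ε, h1, Set.disjoint_left.2 fun y hy hy' => h2 hy hy'⟩
  choose! ε hε hd using hloc
  obtain ⟨t, ht, hcov⟩ := hcomp.elim_nhds_subcover (fun x => Metric.closedBall x (ε x))
    fun x hx => Metric.closedBall_mem_nhds x (hε x hx)
  let B : Fin t.card → (Fin m → ℝ) × (Fin m → ℝ) := fun i =>
    ((fun l => (t.equivFin.symm i).1 l - ε (t.equivFin.symm i).1),
      (fun l => (t.equivFin.symm i).1 l + ε (t.equivFin.symm i).1))
  have hB : ∀ i, Set.Icc (B i).1 (B i).2 = Metric.closedBall (t.equivFin.symm i).1 (ε (t.equivFin.symm i).1) := by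
    intro i
    rw [closedBall_pi _ (hε _ (ht _ (t.equivFin.symm i).2)).le]
    simp only [Real.closedBall_eq_Icc]
    exact (Set.pi_univ_Icc _ _).symm
  have hU : (⋃ i, Set.Icc (B i).1 (B i).2) = ⋃ x ∈ t, Metric.closedBall x (ε x) := by
    simp only [hB]
    ext y
    simp only [Set.mem_iUnion]
    constructor
    · rintro ⟨i, hi⟩
      exact ⟨_, (t.equivFin.symm i).2, hi⟩
    · rintro ⟨x, hx, hy⟩
      exact ⟨t.equivFin ⟨x, hx⟩, by simpa using hy⟩
  have hH := hz_boxes (R := R) hm (E := Metric.ball 0 r) Metric.isOpen_ball (convex_ball _ _) t.card B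
    (j + 1) hj
  rw [hU] at hH
  have hsub : K ⊆ Metric.ball 0 r \ ⋃ x ∈ t, Metric.closedBall x (ε x) := by
    intro x hx
    refine ⟨hr hx, fun h => ?_⟩
    obtain ⟨y, hy, hxy⟩ := Set.mem_iUnion₂.1 h
    exact Set.disjoint_left.1 (hd y (ht y hy)) hxy hx
  obtain ⟨b, hb1, hb2⟩ := hH c (con_mono hsub hcK) hb
  refine ⟨b, con_mono ?_ hb1, hb2⟩
  rintro x ⟨hx1, hx2⟩
  by_contra hx
  exact hx2 (hcov ⟨Metric.ball_subset_closedBall hx1, hx⟩)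

end hz

/-! ### Charts, local homotopies and cycles missing a point -/

section thmL

theorem lift_chain {f : C(X, Y)} {A : Set X} {B : Set Y} {n : ℕ}
    (h : ∀ σ : C(Sx n, Y), (∀ t, σ t ∈ B) → ∃ τ : C(Sx n, X), (∀ t, τ t ∈ A) ∧ f.comp τ = σ)
    {c : SingularChain R Y n} (hc : c ∈ con R B n) : ∃ c' ∈ con R A n, pf f c' = c := by
  refine map_con LinearMap.id (Submodule.map (pf f) (con R A n)) (fun σ hσ => ?_) hc
  obtain ⟨τ, h1, h2⟩ := h σ hσ
  exact ⟨Finsupp.single τ 1, single_mem_con h1 _, by rw [pf_single, h2]; rfl⟩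

theorem lift_emb {f : C(X, Y)} (hf : Topology.IsEmbedding f) {A : Set X} {n : ℕ}
    {c : SingularChain R Y n} (hc : c ∈ con R (f '' A) n) : ∃ c' ∈ con R A n, pf f c' = c := by
  refine lift_chain (fun σ hσ => ?_) hc
  choose g hg hg' using hσ
  refine ⟨⟨g, hf.continuous_iff.2 ?_⟩, hg, ?_⟩
  · have : f ∘ g = σ := funext hg'
    rw [this]; exact σ.continuous
  · ext t; exact hg' t

theorem hz_emb {f : C(X, Y)} (hf : Topology.IsEmbedding f) {A : Set X} {j : ℕ} (h : Hz R A j) :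
    Hz R (f '' A) j := by
  cases j with
  | zero =>
    intro c hc
    obtain ⟨c', h1, rfl⟩ := lift_emb hf hc
    obtain ⟨b, h2, rfl⟩ := h c' h1
    exact ⟨pf f b, pf_con (B := f '' A) (fun x hx => ⟨x, hx, rfl⟩) h2, bd_pf _ _⟩
  | succ j =>
    intro c hc hb
    obtain ⟨c', h1, rfl⟩ := lift_emb hf hc
    obtain ⟨b, h2, rfl⟩ := h c' h1 (pf_inj hf.injective (by rw [← bd_pf, hb, map_zero]))
    exact ⟨pf f b, pf_con (B := f '' A) (fun x hx => ⟨x, hx, rfl⟩) h2, bd_pf _ _⟩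

/-- extending a compactly supported homotopy along an open embedding -/
theorem loc_homotopy {Z : Type} [TopologicalSpace Z] [T2Space X] (ι : C(Z, X))
    (hι : Topology.IsOpenEmbedding ι) {K : Set Z} (hK : IsCompact K) (h : C(Z × 𝕀, Z))
    (hh : ∀ z, z ∉ K → ∀ t, h (z, t) = z) :
    ∃ F : C(X × 𝕀, X), (∀ z t, F (ι z, t) = ι (h (z, t))) ∧ ∀ x, x ∉ ι '' K → ∀ t, F (x, t) = x := by
  classical
  let F : X × 𝕀 → X := fun p => if hx : p.1 ∈ Set.range ι then ι (h (hx.choose, p.2)) else p.1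
  have h1 : ∀ z t, F (ι z, t) = ι (h (z, t)) := by
    intro z t
    have hx : ι z ∈ Set.range ι := ⟨z, rfl⟩
    have : F (ι z, t) = ι (h (hx.choose, t)) := dif_pos hx
    rw [this, hι.injective hx.choose_spec]
  have h2 : ∀ x, x ∉ ι '' K → ∀ t, F (x, t) = x := by
    intro x hx t
    by_cases hr : x ∈ Set.range ι
    · obtain ⟨z, rfl⟩ := hr
      rw [h1, hh z (fun hz => hx ⟨z, hz, rfl⟩)]
    · exact dif_neg hr
  refine ⟨⟨F, ?_⟩, h1, h2⟩
  rw [continuous_iff_continuousAt]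
  rintro ⟨x, t⟩
  by_cases hr : x ∈ Set.range ι
  · obtain ⟨z, rfl⟩ := hr
    have he : Topology.IsOpenEmbedding (Prod.map ι (id : 𝕀 → 𝕀)) := hι.prodMap .id
    have := he.continuousAt_iff (g := F) (x := (z, t))
    refine this.1 ?_
    have e : F ∘ Prod.map ι (id : 𝕀 → 𝕀) = ι ∘ h := by
      ext ⟨z, t⟩; exact h1 z t
    rw [e]
    exact (ι.continuous.comp h.continuous).continuousAt
  · have hx : x ∉ ι '' K := fun ⟨z, _, hz⟩ => hr ⟨z, hz⟩
    have ho : IsOpen (ι '' K)ᶜ := (hK.image ι.continuous).isClosed.isOpen_compl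
    have : F =ᶠ[𝓝 (x, t)] Prod.fst := by
      filter_upwards [(ho.preimage continuous_fst).mem_nhds hx] with p hp
      exact h2 p.1 hp p.2
    exact continuousAt_fst.congr this.symm

/-- `X` is locally modelled on `ℝᵐ` -/
def EChart (m : ℕ) (X : Type) [TopologicalSpace X] : Prop :=
  ∀ a : X, ∃ χ : C(Fin m → ℝ, X), Topology.IsOpenEmbedding χ ∧ χ 0 = a

/-- `y` is homologous to a chain missing `K` -/
def Miss {k : ℕ} (y : SingularChain R X (k + 1)) (K : Set X) : Prop :=
  ∃ (y' : SingularChain R X (k + 1)) (w : SingularChain R X (k + 2)), y' ∈ con R Kᶜ (k + 1) ∧ y' = y + bd w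

theorem miss_push {k m : ℕ} [T2Space X] (χ : C(Fin m → ℝ, X)) (hχ : Topology.IsOpenEmbedding χ)
    {y : SingularChain R X (k + 1)} (hy : bd y = 0) {β : Fin m → ℝ} (hβ : ‖β‖ ≤ 1 / 2)
    (h : Miss y {χ β}) : Miss y (χ '' Metric.closedBall 0 (1 / 2)) := by
  obtain ⟨y', w, h1, h2⟩ := h
  obtain ⟨Q, hQ, hQs, hyQ⟩ := con_compact h1
  have hn : χ ⁻¹' Qᶜ ∈ 𝓝 β := by
    refine (hQ.isClosed.isOpen_compl.preimage χ.continuous).mem_nhds ?_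
    exact fun hb => hQs hb rfl
  obtain ⟨δ0, hδ0, hball⟩ := Metric.mem_nhds_iff.1 hn
  let δ := min δ0 1
  have hδ : 0 < δ := lt_min hδ0 one_pos
  let lam : (Fin m → ℝ) → ℝ := fun z => max 1 (2 / max ‖z - β‖ δ)
  have hlc : Continuous lam := by
    refine continuous_const.max (Continuous.div continuous_const (by fun_prop) fun z => ?_)
    exact (lt_max_of_lt_right hδ).ne'
  let h : C((Fin m → ℝ) × 𝕀, Fin m → ℝ) :=
    ⟨fun p => β + (1 + (p.2 : ℝ) * (lam p.1 - 1)) • (p.1 - β), by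
      have := hlc.comp (continuous_fst : Continuous (Prod.fst : (Fin m → ℝ) × 𝕀 → _))
      have h' : Continuous fun p : (Fin m → ℝ) × 𝕀 => lam p.1 := this
      fun_prop⟩
  have hh : ∀ z, z ∉ Metric.closedBall β 2 → ∀ t, h (z, t) = z := by
    intro z hz t
    rw [Metric.mem_closedBall, dist_eq_norm, not_le] at hz
    have : lam z = 1 := by
      refine max_eq_left ?_
      rw [div_le_one (lt_max_of_lt_right hδ)]
      exact le_max_of_le_left hz.le
    change β + (1 + (t : ℝ) * (lam z - 1)) • (z - β) = z
    rw [this]; simp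
  obtain ⟨F, hF1, hF2⟩ := loc_homotopy χ hχ (isCompact_closedBall β 2) h hh
  have h0 : slice F 0 = ContinuousMap.id X := by
    ext x
    change F (x, 0) = x
    by_cases hx : x ∈ Set.range χ
    · obtain ⟨z, rfl⟩ := hx
      rw [hF1]
      congr 1
      change β + (1 + ((0 : 𝕀) : ℝ) * (lam z - 1)) • (z - β) = z
      simp
    · exact hF2 _ (fun ⟨z, _, hz⟩ => hx ⟨z, hz⟩) _
  have hy' : bd y' = 0 := by rw [h2, map_add, hy, bd_bd, add_zero]
  have hb := bd_hop F y'
  rw [h0, pf_id, hy', map_zero, sub_zero] at hb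
  refine ⟨pf (slice F 1) y', w + hop F y', pf_con (A := Q) ?_ hyQ, ?_⟩
  · rintro x hx ⟨z', hz', hzz⟩
    change _ = F (x, 1) at hzz
    by_cases hr : x ∈ Set.range χ
    · obtain ⟨z, rfl⟩ := hr
      rw [hF1] at hzz
      have e := hχ.injective hzz
      have hzd : δ ≤ ‖z - β‖ := by
        by_contra hc
        have hz : z ∈ Metric.ball β δ0 := by
          rw [Metric.mem_ball, dist_eq_norm]
          exact (not_le.1 hc).trans_le (min_le_left _ _)
        exact hball hz hx
      have e2 : z' = β + lam z • (z - β) := by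
        rw [e]
        change β + (1 + ((1 : 𝕀) : ℝ) * (lam z - 1)) • (z - β) = _
        simp
      have hpos : 0 < ‖z - β‖ := hδ.trans_le hzd
      have hl : 2 ≤ ‖lam z • (z - β)‖ := by
        have h3 : lam z = max 1 (2 / ‖z - β‖) := by
          simp only [lam, max_eq_left hzd]
        have h4 : 2 / ‖z - β‖ ≤ lam z := h3 ▸ le_max_right _ _
        rw [norm_smul, Real.norm_eq_abs, abs_of_nonneg (h4.trans' (by positivity))]
        calc (2 : ℝ) = 2 / ‖z - β‖ * ‖z - β‖ := by field_simp
          _ ≤ _ := by gcongr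
      have h5 : ‖lam z • (z - β)‖ ≤ ‖z'‖ + ‖β‖ := by
        have : lam z • (z - β) = z' - β := by rw [e2]; abel
        rw [this]; exact norm_sub_le _ _
      have h6 : ‖z'‖ ≤ 1 / 2 := by simpa using hz'
      linarith
    · rw [hF2 x (fun ⟨z, _, hz⟩ => hr ⟨z, hz⟩)] at hzz
      exact hr ⟨z', hzz⟩
  · rw [map_add, hb, h2]; abel

theorem miss_union {k : ℕ} (χ : C(Fin (k + 1) → ℝ, X)) (hχ : Topology.IsOpenEmbedding χ)
    {y : SingularChain R X (k + 1)} (hy : bd y = 0) {K L : Set X} (hK : IsClosed K) (hL : IsClosed L)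
    (hKχ : K ⊆ Set.range χ) (h1 : Miss y L) (h2 : Miss y K) : Miss y (L ∪ K) := by
  obtain ⟨yL, wL, hL1, hL2⟩ := h1
  obtain ⟨yK, wK, hK1, hK2⟩ := h2
  have hyK : bd yK = 0 := by rw [hK2, map_add, hy, bd_bd, add_zero]
  have hJ : IsClosed (L ∩ K) := hL.inter hK
  have hu : wK - wL ∈ con R (Set.range χ ∪ (L ∩ K)ᶜ) (k + 2) := by
    refine con_mono ?_ (con_univ _)
    intro x _
    by_cases hx : x ∈ L ∩ K
    · exact Or.inl (hKχ hx.2)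
    · exact Or.inr hx
  obtain ⟨N, hN⟩ := small hχ.isOpen_range hJ.isOpen_compl hu
  obtain ⟨a, ha, b, hb, hab⟩ := Submodule.mem_sup.1 (hN N le_rfl)
  have e1 : bd a + bd b = sdN N yK - sdN N yL := by
    rw [← map_add, hab, bd_sdN, ← map_sub, hK2, hL2]
    congr 1
    rw [map_sub]; abel
  have hba : bd a ∈ con R (Set.range χ ∩ (L ∩ K)ᶜ) (k + 1) := by
    refine con_inter (bd_con ha) ?_
    rw [eq_sub_of_add_eq e1]
    refine Submodule.sub_mem _ (Submodule.sub_mem _ (sdN_con N ?_) (sdN_con N ?_)) (bd_con hb)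
    · exact con_mono (Set.compl_subset_compl.2 Set.inter_subset_right) hK1
    · exact con_mono (Set.compl_subset_compl.2 Set.inter_subset_left) hL1
  have hz : Hz R (Set.range χ ∩ (L ∩ K)ᶜ) (k + 1) := by
    have := hz_emb hχ.isEmbedding (hz_open (R := R) (m := k + 1) (by omega)
      (hJ.isOpen_compl.preimage χ.continuous) (k + 1) le_rfl)
    rwa [Set.image_preimage_eq_range_inter] at this
  obtain ⟨a', ha', hba'⟩ := hz_bd hz a hba
  have hs : a' + b ∈ con R (Kᶜ ∪ Lᶜ) (k + 2) := by
    have : Kᶜ ∪ Lᶜ = (L ∩ K)ᶜ := by rw [Set.compl_inter, Set.union_comm]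
    rw [this]
    exact Submodule.add_mem _ (con_mono Set.inter_subset_right ha') hb
  obtain ⟨N', hN'⟩ := small hK.isOpen_compl hL.isOpen_compl hs
  obtain ⟨sK, hsK, sL, hsL, hss⟩ := Submodule.mem_sup.1 (hN' N' le_rfl)
  have e2 : bd sK + bd sL = sdN N' (sdN N yK) - sdN N' (sdN N yL) := by
    rw [← map_add, hss, bd_sdN, map_add, hba', e1, map_sub]
  have e3 : sdN N' (sdN N yK) - bd sK = sdN N' (sdN N yL) + bd sL := by
    have : sdN N' (sdN N yK) = (bd sK + bd sL) + sdN N' (sdN N yL) := by rw [e2]; abel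
    rw [this]; abel
  have hyK' : bd (sdN N yK) = 0 := by rw [bd_sdN, hyK, map_zero]
  refine ⟨sdN N' (sdN N yK) - bd sK, wK + sdD N yK + sdD N' (sdN N yK) - sK, ?_, ?_⟩
  · rw [Set.compl_union]
    refine con_inter ?_ (Submodule.sub_mem _ (sdN_con _ (sdN_con _ hK1)) (bd_con hsK))
    rw [e3]
    exact Submodule.add_mem _ (sdN_con _ (sdN_con _ hL1)) (bd_con hsL)
  · have f1 := sd_hom N yK hyK
    have f2 := sd_hom N' (sdN N yK) hyK'
    have f3 : sdN N' (sdN N yK) = sdN N yK + bd (sdD N' (sdN N yK)) := eq_add_of_sub_eq f2.symm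
    have f4 : sdN N yK = yK + bd (sdD N yK) := eq_add_of_sub_eq f1.symm
    have f5 : bd (wK + sdD N yK + sdD N' (sdN N yK) - sK) =
        bd wK + bd (sdD N yK) + bd (sdD N' (sdN N yK)) - bd sK := by
      rw [map_sub, map_add, map_add]
    rw [f5, f3]
    have f6 : ∀ u v : SingularChain R X (k + 1), sdN N yK + u - v = y + (bd wK + bd (sdD N yK) + u - v) := by
      intro u v
      rw [f4, hK2]; abel
    exact f6 _ _

/-- on a compact connected manifold without boundary, top-dimensional cycles missing a point bound -/
theorem thmL {k : ℕ} [T2Space X] [CompactSpace X] [PreconnectedSpace X] (hX : EChart (k + 1) X)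
    {y : SingularChain R X (k + 1)} (hy : bd y = 0) {p : X} (hp : y ∈ con R {p}ᶜ (k + 1)) :
    ∃ b : SingularChain R X (k + 2), bd b = y := by
  choose χ hχ hχ0 using hX
  let Nb : X → Set X := fun a => χ a '' Metric.closedBall 0 (1 / 2)
  have hNb : ∀ a, Nb a ∈ 𝓝 a := by
    intro a
    have := (hχ a).image_mem_nhds.2 (Metric.closedBall_mem_nhds (0 : Fin (k + 1) → ℝ) (ε := 1 / 2) (by norm_num))
    rwa [hχ0] at this
  have mono : ∀ {K K' : Set X}, K' ⊆ K → Miss y K → Miss y K' := by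
    rintro K K' h ⟨y', w, h1, h2⟩
    exact ⟨y', w, con_mono (Set.compl_subset_compl.2 h) h1, h2⟩
  let S : Set X := {a | Miss y {a}}
  have key : ∀ a b, b ∈ Nb a → b ∈ S → Miss y (Nb a) := by
    rintro a _ ⟨β, hβ, rfl⟩ hb
    exact miss_push (χ a) (hχ a) hy (by simpa using hβ) hb
  have hsub : ∀ a, Miss y (Nb a) → Nb a ⊆ S := fun a h b hb => mono (by simpa using hb) h
  have hSo : IsOpen S := isOpen_iff_mem_nhds.2 fun a ha =>
    Filter.mem_of_superset (hNb a) (hsub a (key a a (mem_of_mem_nhds (hNb a)) ha))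
  have hSc : IsOpen Sᶜ := by
    refine isOpen_iff_mem_nhds.2 fun a ha => Filter.mem_of_superset (hNb a) fun b hb hbS => ?_
    exact ha (hsub a (key a b hb hbS) (mem_of_mem_nhds (hNb a)))
  have hS : S = Set.univ := IsClopen.eq_univ ⟨isOpen_compl_iff.1 hSc, hSo⟩
    ⟨p, y, 0, hp, by rw [map_zero, add_zero]⟩
  have hall : ∀ a, Miss y (Nb a) := fun a =>
    key a a (mem_of_mem_nhds (hNb a)) (hS ▸ Set.mem_univ a)
  have hcl : ∀ a, IsClosed (Nb a) := fun a =>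
    ((isCompact_closedBall _ _).image (χ a).continuous).isClosed
  obtain ⟨t, -, ht⟩ := isCompact_univ.elim_nhds_subcover Nb fun a _ => hNb a
  have hfin : ∀ t : Finset X, Miss y (⋃ a ∈ t, Nb a) := by
    classical
    intro t
    induction t using Finset.induction_on with
    | empty => exact ⟨y, 0, by simpa using con_univ y, by rw [map_zero, add_zero]⟩
    | insert a t _ ih =>
      rw [Finset.set_biUnion_insert, Set.union_comm]
      exact miss_union (χ a) (hχ a) hy (hcl a) (t.finite_toSet.isClosed_biUnion fun i _ => hcl i)
        (Set.image_subset_range _ _) ih (hall a)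
  obtain ⟨y', w, h1, h2⟩ := mono ht (hfin t)
  rw [Set.compl_univ] at h1
  rw [con_empty h1] at h2
  exact ⟨-w, by rw [map_neg, ← add_eq_zero_iff_neg_eq', ← h2]⟩

end thmL

/-! ### Pushing a collar into the boundary -/

section push

theorem mem_hs {m : ℕ} {x : Fin (m + 1) → ℝ} : x ∈ HalfSpace (m + 1) ↔ 0 ≤ x 0 :=
  ⟨fun h => h (Nat.succ_pos m), fun h _ => h⟩

theorem mem_hsb {m : ℕ} {x : Fin (m + 1) → ℝ} : x ∈ HalfSpaceBoundary (m + 1) ↔ x 0 = 0 :=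
  ⟨fun ⟨_, h⟩ => h, fun h => ⟨Nat.succ_pos m, h⟩⟩

theorem closed_hs (m : ℕ) : IsClosed (HalfSpace (m + 1)) := by
  have : HalfSpace (m + 1) = {x | 0 ≤ x 0} := by ext x; exact mem_hs
  rw [this]
  exact isClosed_le continuous_const (continuous_apply 0)

variable {m : ℕ}

/-- charts of a manifold, in a convenient form -/
theorem chart (N : OCCManifold (m + 1)) (x : N.carrier) :
    ∃ (V : Set (HalfSpace (m + 1))) (ι : C(V, N.carrier)) (v : V), IsOpen V ∧ Topology.IsOpenEmbedding ι ∧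
      ι v = x ∧ ∀ z : V, ι z ∈ N.boundary ↔ z.1.1 0 = 0 := by
  obtain ⟨U, V, φ, hx, hU, hV, hb⟩ := N.charts x
  refine ⟨V, ⟨fun z => (φ.symm z).1, by fun_prop⟩, φ ⟨x, hx⟩, hV,
    hU.isOpenEmbedding_subtypeVal.comp φ.symm.isOpenEmbedding, ?_, ?_⟩
  · change (φ.symm (φ ⟨x, hx⟩)).1 = x
    rw [Homeomorph.symm_apply_apply]
  · intro z
    change (φ.symm z).1 ∈ N.boundary ↔ _
    rw [hb, Homeomorph.apply_symm_apply, mem_hsb]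

theorem closed_bdry (N : OCCManifold (m + 1)) : IsClosed N.boundary := by
  rw [← isOpen_compl_iff, isOpen_iff_mem_nhds]
  intro x hx
  obtain ⟨V, ι, v, hV, hι, rfl, hb⟩ := chart N x
  have ho : IsOpen {z : V | z.1.1 0 ≠ 0} := by
    refine isOpen_ne_fun ?_ continuous_const
    exact (continuous_apply 0).comp (continuous_subtype_val.comp continuous_subtype_val)
  refine Filter.mem_of_superset ((hι.isOpenMap _ ho).mem_nhds ⟨v, ?_, rfl⟩) ?_
  · exact fun h => hx ((hb v).2 h)
  · rintro _ ⟨z, hz, rfl⟩ h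
    exact hz ((hb z).1 h)

theorem interior_pt (N : OCCManifold (m + 1)) : ∃ x, x ∉ N.boundary := by
  have := N.connected
  obtain ⟨x⟩ : Nonempty N.carrier := inferInstance
  obtain ⟨V, ι, v, hV, hι, rfl, hb⟩ := chart N x
  obtain ⟨ε, hε, hball⟩ := Metric.isOpen_iff.1 hV v.1 v.2
  let w : Fin (m + 1) → ℝ := fun i => v.1.1 i + ε / 2
  have h0 : 0 ≤ v.1.1 0 := mem_hs.1 v.1.2
  have hw : w ∈ HalfSpace (m + 1) := mem_hs.2 (by simp only [w]; positivity)
  have hwV : (⟨w, hw⟩ : HalfSpace (m + 1)) ∈ V := by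
    refine hball ?_
    rw [Metric.mem_ball, Subtype.dist_eq, dist_pi_lt_iff hε]
    intro i
    simp only [w, Real.dist_eq, add_sub_cancel_left, abs_of_pos (half_pos hε)]
    linarith
  refine ⟨ι ⟨_, hwV⟩, fun h => ?_⟩
  have := (hb _).1 h
  simp only [w] at this
  linarith

/-- local push into the boundary -/
theorem push_loc (N : OCCManifold (m + 1)) (x : N.carrier) (hx : x ∈ N.boundary) :
    ∃ (F : C(N.carrier × 𝕀, N.carrier)) (O : Set N.carrier), IsOpen O ∧ x ∈ O ∧
      (∀ y, F (y, 0) = y) ∧ (∀ y ∈ N.boundary, ∀ t, F (y, t) = y) ∧ ∀ y ∈ O, F (y, 1) ∈ N.boundary := by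
  have := N.t2
  obtain ⟨V, ι, v, hV, hι, rfl, hb⟩ := chart N x
  have hv0 : v.1.1 0 = 0 := (hb v).1 hx
  obtain ⟨ε, hε, hball⟩ := Metric.nhds_basis_closedBall.mem_iff.1 (hV.mem_nhds v.2)
  let q : V × 𝕀 → ℝ := fun p => max 0 (p.1.1.1 0 - (p.2 : ℝ) * max 0 (ε - dist p.1.1.1 v.1.1))
  have hval : Continuous fun p : V × 𝕀 => p.1.1.1 :=
    continuous_subtype_val.comp (continuous_subtype_val.comp continuous_fst)
  have hq : Continuous q := by
    have h0 : Continuous fun p : V × 𝕀 => p.1.1.1 0 := (continuous_apply 0).comp hval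
    have h1 : Continuous fun p : V × 𝕀 => dist p.1.1.1 v.1.1 := hval.dist continuous_const
    have h2 : Continuous fun p : V × 𝕀 => (p.2 : ℝ) := continuous_subtype_val.comp continuous_snd
    exact continuous_const.max (h0.sub (h2.mul (continuous_const.max (continuous_const.sub h1))))
  have hq1 : ∀ p, 0 ≤ q p := fun p => le_max_left _ _
  have hq2 : ∀ p, q p ≤ p.1.1.1 0 := fun p => max_le (mem_hs.1 p.1.1.2) (by
    have : 0 ≤ (p.2 : ℝ) * max 0 (ε - dist p.1.1.1 v.1.1) := mul_nonneg p.2.2.1 (le_max_left _ _)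
    linarith)
  have hq3 : ∀ p, ε ≤ dist p.1.1.1 v.1.1 → q p = p.1.1.1 0 := fun p hp => by
    simp only [q]
    rw [max_eq_left (sub_nonpos.2 hp), mul_zero, sub_zero, max_eq_right (mem_hs.1 p.1.1.2)]
  let g : V × 𝕀 → Fin (m + 1) → ℝ := fun p => Function.update p.1.1.1 0 (q p)
  have hg : Continuous g := by
    exact hval.update 0 hq
  have hgH : ∀ p, g p ∈ HalfSpace (m + 1) := fun p => mem_hs.2 (by simp [g, hq1])
  have hgs : ∀ p, q p = p.1.1.1 0 → g p = p.1.1.1 := fun p hp => by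
    simp only [g]; rw [hp, Function.update_eq_self]
  have hgV : ∀ p, (⟨g p, hgH p⟩ : HalfSpace (m + 1)) ∈ V := by
    intro p
    by_cases hp : ε ≤ dist p.1.1.1 v.1.1
    · have : (⟨g p, hgH p⟩ : HalfSpace (m + 1)) = p.1.1 := Subtype.ext (hgs p (hq3 p hp))
      rw [this]; exact p.1.2
    · refine hball ?_
      rw [not_le] at hp
      rw [Metric.mem_closedBall, Subtype.dist_eq, dist_pi_le_iff hε.le]
      intro i
      have hi : ∀ i, dist (p.1.1.1 i) (v.1.1 i) ≤ ε := fun i => (dist_le_pi_dist _ _ i).trans hp.le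
      by_cases h0 : i = 0
      · subst h0
        have := hi 0
        simp only [g, Function.update_self, hv0, Real.dist_eq, sub_zero] at this ⊢
        rw [abs_of_nonneg (hq1 p)]
        exact (hq2 p).trans ((le_abs_self _).trans this)
      · simp only [g, Function.update_of_ne h0]
        exact hi i
  let h : C(V × 𝕀, V) := ⟨fun p => ⟨⟨g p, hgH p⟩, hgV p⟩, by fun_prop⟩
  let K : Set V := {z | dist z.1.1 v.1.1 ≤ ε}
  have hK : IsCompact K := by
    rw [Subtype.isCompact_iff, Subtype.isCompact_iff]
    have : (Subtype.val '' (Subtype.val '' K) : Set (Fin (m + 1) → ℝ)) =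
        Metric.closedBall v.1.1 ε ∩ HalfSpace (m + 1) := by
      ext y
      constructor
      · rintro ⟨_, ⟨z, hz, rfl⟩, rfl⟩
        exact ⟨hz, z.1.2⟩
      · rintro ⟨h1, h2⟩
        exact ⟨⟨y, h2⟩, ⟨⟨⟨y, h2⟩, hball h1⟩, h1, rfl⟩, rfl⟩
    rw [this]
    exact (isCompact_closedBall _ _).inter_right (closed_hs m)
  have hs : ∀ z t, q (z, t) = z.1.1 0 → h (z, t) = z := fun z t hz =>
    Subtype.ext (Subtype.ext (hgs (z, t) hz))
  obtain ⟨F, hF1, hF2⟩ := loc_homotopy ι hι hK h (fun z hz t => hs z t (hq3 (z, t) (not_le.1 hz).le))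
  have hfix : ∀ y t, (∀ z, ι z = y → q (z, t) = z.1.1 0) → F (y, t) = y := by
    intro y t hy
    by_cases hr : y ∈ Set.range ι
    · obtain ⟨z, rfl⟩ := hr
      rw [hF1, hs z t (hy z rfl)]
    · exact hF2 y (fun ⟨z, _, hz⟩ => hr ⟨z, hz⟩) t
  refine ⟨F, ι '' {z : V | dist z.1.1 v.1.1 < ε / 2}, hι.isOpenMap _ ?_, ⟨v, ?_, rfl⟩, ?_, ?_, ?_⟩
  · exact isOpen_lt ((continuous_subtype_val.comp continuous_subtype_val).dist continuous_const)
      continuous_const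
  · change dist v.1.1 v.1.1 < ε / 2
    rw [dist_self]; exact half_pos hε
  · intro y
    refine hfix y 0 fun z _ => ?_
    simp only [q]
    simpa using mem_hs.1 z.1.2
  · intro y hy t
    refine hfix y t fun z hz => ?_
    have : z.1.1 0 = 0 := (hb z).1 (hz ▸ hy)
    exact le_antisymm (hq2 (z, t)) (this ▸ hq1 (z, t))
  · rintro _ ⟨z, hz, rfl⟩
    rw [hF1, hb]
    change Function.update z.1.1 0 (q (z, 1)) 0 = 0
    rw [Function.update_self]
    simp only [Set.mem_ofPred_eq] at hz
    have h1 := dist_le_pi_dist z.1.1 v.1.1 0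
    rw [hv0, Real.dist_eq, sub_zero] at h1
    have h2 := le_abs_self (z.1.1 0)
    refine max_eq_left ?_
    have h3 : ε - dist z.1.1 v.1.1 ≤ max 0 (ε - dist z.1.1 v.1.1) := le_max_right _ _
    change z.1.1 0 - ((1 : 𝕀) : ℝ) * max 0 (ε - dist z.1.1 v.1.1) ≤ 0
    rw [Set.Icc.coe_one, one_mul]
    linarith

/-- there is a homotopy rel boundary pushing a neighbourhood of the boundary into the boundary -/
theorem exists_push (N : OCCManifold (m + 1)) :
    ∃ (F : C(N.carrier × 𝕀, N.carrier)) (O : Set N.carrier), IsOpen O ∧ N.boundary ⊆ O ∧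
      (∀ y, F (y, 0) = y) ∧ (∀ y ∈ N.boundary, ∀ t, F (y, t) = y) ∧ ∀ y ∈ O, F (y, 1) ∈ N.boundary := by
  have := N.compact
  have hc : IsCompact N.boundary := (closed_bdry N).isCompact
  have hl : ∀ x : N.boundary, _ := fun x => push_loc N x.1 x.2
  choose G O hO hx hG0 hGb hG1 using hl
  obtain ⟨t, ht⟩ := hc.elim_finite_subcover O hO (fun x hx' => Set.mem_iUnion.2 ⟨⟨x, hx'⟩, hx _⟩)
  have hfin : ∀ t : Finset N.boundary, ∃ (F : C(N.carrier × 𝕀, N.carrier)) (U : Set N.carrier),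
      IsOpen U ∧ N.boundary ∩ (⋃ i ∈ t, O i) ⊆ U ∧
      (∀ y, F (y, 0) = y) ∧ (∀ y ∈ N.boundary, ∀ t, F (y, t) = y) ∧ ∀ y ∈ U, F (y, 1) ∈ N.boundary := by
    classical
    intro t
    induction t using Finset.induction_on with
    | empty =>
      exact ⟨ContinuousMap.fst, ∅, isOpen_empty, by simp, fun y => rfl, fun y _ t => rfl, by simp⟩
    | insert a t _ ih =>
      obtain ⟨F, U, h1, h2, h3, h4, h5⟩ := ih
      refine ⟨(G a).comp (F.prodMk ContinuousMap.snd), U ∪ (fun y => F (y, 1)) ⁻¹' O a,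
        h1.union ((hO a).preimage (by fun_prop)), ?_, ?_, ?_, ?_⟩
      · rw [Finset.set_biUnion_insert]
        rintro y ⟨hy, h | h⟩
        · refine Or.inr ?_
          change F (y, 1) ∈ O a
          rwa [h4 y hy]
        · exact Or.inl (h2 ⟨hy, h⟩)
      · intro y
        change G a (F (y, 0), 0) = y
        rw [h3, hG0]
      · intro y hy t
        change G a (F (y, t), t) = y
        rw [h4 y hy, hGb a y hy]
      · intro y hy
        change G a (F (y, 1), 1) ∈ N.boundary
        rcases hy with hy | hy
        · rw [hGb a _ (h5 y hy)]
          exact h5 y hy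
        · exact hG1 a _ hy
  obtain ⟨F, U, h1, h2, h3⟩ := hfin t
  exact ⟨F, U, h1, fun y hy => h2 ⟨hy, ht hy⟩, h3⟩

end push

/-! ### The boundary of a manifold; the boundary cycle of `W` -/

section bdry

theorem bdry_chart {m : ℕ} (N : OCCManifold (m + 1)) : EChart m N.boundary := by
  rintro ⟨a, ha⟩
  obtain ⟨V, ι, v, hV, hι, rfl, hb⟩ := chart N a
  have hv0 : v.1.1 0 = 0 := (hb v).1 ha
  obtain ⟨ε, hε, hball⟩ := Metric.isOpen_iff.1 hV v.1 v.2
  let β := OpenPartialHomeomorph.univBall (E := Fin m → ℝ) (Fin.tail v.1.1) ε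
  have hβe : Topology.IsOpenEmbedding β := β.isOpenEmbedding (OpenPartialHomeomorph.univBall_source _ _)
  have hβr : Set.range β = Metric.ball (Fin.tail v.1.1) ε := by
    rw [← OpenPartialHomeomorph.univBall_target (E := Fin m → ℝ) (Fin.tail v.1.1) hε,
      ← β.image_source_eq_target, OpenPartialHomeomorph.univBall_source, Set.image_univ]
  have hβ0 : β 0 = Fin.tail v.1.1 := OpenPartialHomeomorph.univBall_apply_zero _ _
  let co : (Fin m → ℝ) → Fin (m + 1) → ℝ := fun z => Fin.cons 0 z
  have hco : Continuous co := continuous_pi fun i => by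
    refine Fin.cases ?_ (fun i => ?_) i
    · exact continuous_const
    · exact continuous_apply i
  have hcoe : Topology.IsEmbedding co := by
    let tl : (Fin (m + 1) → ℝ) → Fin m → ℝ := Fin.tail
    have h1 : Continuous tl := continuous_pi fun i => continuous_apply i.succ
    have h2 : Function.LeftInverse tl co := fun z => rfl
    exact Topology.IsEmbedding.of_leftInverse h2 h1 hco
  have h1 : ∀ z, co z ∈ HalfSpace (m + 1) := fun z => mem_hs.2 (le_of_eq rfl)
  have hdist : ∀ x : Fin (m + 1) → ℝ, x 0 = 0 → (dist x v.1.1 < ε ↔ dist (Fin.tail x) (Fin.tail v.1.1) < ε) := by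
    intro x hx
    rw [dist_pi_lt_iff hε, dist_pi_lt_iff hε, Fin.forall_fin_succ, hx, hv0, dist_self]
    exact ⟨fun h => h.2, fun h => ⟨hε, h⟩⟩
  have hV' : ∀ z, (⟨co (β z), h1 _⟩ : HalfSpace (m + 1)) ∈ V := by
    intro z
    refine hball ?_
    rw [Metric.mem_ball, Subtype.dist_eq, hdist _ rfl]
    change dist (Fin.tail (Fin.cons 0 (β z) : Fin (m + 1) → ℝ)) _ < ε
    rw [Fin.tail_cons, ← Metric.mem_ball, ← hβr]
    exact ⟨z, rfl⟩
  let j : (Fin m → ℝ) → V := fun z => ⟨⟨co (β z), h1 _⟩, hV' z⟩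
  have hj : Continuous j := ((hco.comp hβe.continuous).subtype_mk _).subtype_mk _
  have hje : Topology.IsEmbedding j := by
    refine Topology.IsEmbedding.of_comp hj (continuous_subtype_val.comp continuous_subtype_val) ?_
    exact hcoe.comp hβe.isEmbedding
  have hmem : ∀ z, ι (j z) ∈ N.boundary := fun z => (hb _).2 rfl
  let χ : C(Fin m → ℝ, N.boundary) := ⟨fun z => ⟨ι (j z), hmem z⟩, (ι.continuous.comp hj).subtype_mk _⟩
  have hj0 : j 0 = v := by
    refine Subtype.ext (Subtype.ext ?_)
    change (Fin.cons 0 (β 0) : Fin (m + 1) → ℝ) = v.1.1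
    rw [hβ0, ← hv0]
    exact Fin.cons_self_tail _
  refine ⟨χ, ⟨Topology.IsEmbedding.of_comp χ.continuous continuous_subtype_val
    (hι.isEmbedding.comp hje), ?_⟩, Subtype.ext (congrArg ι hj0)⟩
  have ho : IsOpen {z : V | dist z.1.1 v.1.1 < ε} :=
    isOpen_lt ((continuous_subtype_val.comp continuous_subtype_val).dist continuous_const)
      continuous_const
  have : Set.range χ = Subtype.val ⁻¹' (ι '' {z : V | dist z.1.1 v.1.1 < ε}) := by
    ext ⟨y, hy⟩
    constructor
    · rintro ⟨z, hz⟩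
      refine ⟨j z, ?_, congrArg Subtype.val hz⟩
      change dist (co (β z)) v.1.1 < ε
      rw [hdist _ rfl]
      change dist (Fin.tail (Fin.cons 0 (β z) : Fin (m + 1) → ℝ)) _ < ε
      rw [Fin.tail_cons, ← Metric.mem_ball, ← hβr]
      exact ⟨z, rfl⟩
    · rintro ⟨z, hz, rfl⟩
      have hz0 : z.1.1 0 = 0 := (hb z).1 hy
      have : Fin.tail z.1.1 ∈ Metric.ball (Fin.tail v.1.1) ε := (hdist _ hz0).1 hz
      rw [← hβr] at this
      obtain ⟨w, hw⟩ := this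
      refine ⟨w, Subtype.ext ?_⟩
      change ι (j w) = ι z
      congr 1
      refine Subtype.ext (Subtype.ext ?_)
      change (Fin.cons 0 (β w) : Fin (m + 1) → ℝ) = z.1.1
      rw [hw, ← hz0]
      exact Fin.cons_self_tail _
  rw [this]
  exact (hι.isOpenMap _ ho).preimage continuous_subtype_val

theorem echart_pc {m : ℕ} (hX : EChart m X) [ConnectedSpace X] : PathConnectedSpace X := by
  choose χ hχ hχ0 using hX
  obtain ⟨a⟩ : Nonempty X := inferInstance
  have hj : ∀ b c, c ∈ Set.range (χ b) → Joined c b := by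
    rintro b _ ⟨z, rfl⟩
    have : Joined (χ b z) (χ b 0) := ((PathConnectedSpace.joined z 0).somePath.map (χ b).continuous) |> Nonempty.intro
    rwa [hχ0] at this
  have hn : ∀ b, Set.range (χ b) ∈ 𝓝 b := fun b => (hχ b).isOpen_range.mem_nhds ⟨0, hχ0 b⟩
  have ho : IsOpen {b | Joined a b} := isOpen_iff_mem_nhds.2 fun b hb =>
    Filter.mem_of_superset (hn b) fun c hc => Joined.trans hb (hj b c hc).symm
  have hc : IsOpen {b | Joined a b}ᶜ := isOpen_iff_mem_nhds.2 fun b hb =>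
    Filter.mem_of_superset (hn b) fun c hc hac => hb (Joined.trans hac (hj b c hc))
  have := IsClopen.eq_univ ⟨isOpen_compl_iff.1 hc, ho⟩ ⟨a, Joined.refl a⟩
  have h : ∀ b, Joined a b := fun b => by
    have : b ∈ {b | Joined a b} := this ▸ Set.mem_univ b
    exact this
  exact ⟨inferInstance, fun x y => (h x).symm.trans (h y)⟩

theorem pf_con_inv {f : C(X, Y)} (hf : Function.Injective f) {B : Set Y} {n : ℕ}
    {c : SingularChain R X n} (hc : pf f c ∈ con R B n) : c ∈ con R (f ⁻¹' B) n := by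
  refine mem_con.2 fun σ hσ t => ?_
  refine mem_con.1 hc (f.comp σ) ?_ t
  rw [Finsupp.mem_support_iff] at hσ ⊢
  have : pf f c (f.comp σ) = c σ := Finsupp.mapDomain_apply (fun σ τ h => by
    ext t; exact hf (DFunLike.congr_fun h t)) c σ
  rwa [this]

theorem glue_push {M : Type} [TopologicalSpace M] [CompactSpace M] [T2Space X] {A : Set M}
    {ep em : C(M, X)} (hs : ∀ a, (∃ x, ep x = a) ∨ ∃ x, em x = a) (hp : Function.Injective ep)
    (hm : Function.Injective em) (hpm : ∀ x y, ep x = em y → x = y ∧ x ∈ A) (F : C(M × 𝕀, M)) (hF : ∀ y ∈ A, ∀ t, F (y, t) = y) :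
    ∃ G : C(X × 𝕀, X), (∀ x t, G (ep x, t) = ep (F (x, t))) ∧ ∀ x t, G (em x, t) = em (F (x, t)) := by
  let q : C((M × 𝕀) ⊕ (M × 𝕀), X × 𝕀) :=
    ⟨Sum.elim (fun p => (ep p.1, p.2)) (fun p => (em p.1, p.2)), by fun_prop⟩
  have hsur : Function.Surjective q := by
    rintro ⟨a, t⟩
    rcases hs a with ⟨x, rfl⟩ | ⟨x, rfl⟩
    · exact ⟨Sum.inl (x, t), rfl⟩
    · exact ⟨Sum.inr (x, t), rfl⟩
  have hq : Topology.IsQuotientMap q := q.continuous.isClosedMap.isQuotientMap q.continuous hsur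
  let g : C((M × 𝕀) ⊕ (M × 𝕀), X) := ⟨Sum.elim (fun p => ep (F p)) (fun p => em (F p)), by fun_prop⟩
  have hg : Function.FactorsThrough g q := by
    have key : ∀ x y t, ep x = em y → ep (F (x, t)) = em (F (y, t)) := by
      intro x y t h
      obtain ⟨rfl, hx⟩ := hpm x y h
      rw [hF x hx, h]
    rintro (⟨x, t⟩ | ⟨x, t⟩) (⟨y, s⟩ | ⟨y, s⟩) h
    · obtain ⟨h1, rfl⟩ := Prod.ext_iff.1 h
      obtain rfl := hp h1
      rfl
    · obtain ⟨h1, h2⟩ := Prod.ext_iff.1 h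
      change ep x = em y at h1
      change t = s at h2
      subst h2
      exact key x y t h1
    · obtain ⟨h1, h2⟩ := Prod.ext_iff.1 h
      change em x = ep y at h1
      change t = s at h2
      subst h2
      exact (key y x t h1.symm).symm
    · obtain ⟨h1, rfl⟩ := Prod.ext_iff.1 h
      obtain rfl := hm h1
      rfl
  have hl : ∀ p, hq.lift g hg (q p) = g p := fun p =>
    DFunLike.congr_fun (hq.lift_comp g hg) p
  exact ⟨hq.lift g hg, fun x t => hl (Sum.inl (x, t)), fun x t => hl (Sum.inr (x, t))⟩

theorem conn_glue {M : Type} [TopologicalSpace M] [ConnectedSpace M]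
    {ep em : C(M, X)} (hs : ∀ a, (∃ x, ep x = a) ∨ ∃ x, em x = a) (h : ∃ x, ep x = em x) :
    ConnectedSpace X := by
  obtain ⟨x, hx⟩ := h
  rw [connectedSpace_iff_univ]
  have : (Set.univ : Set X) = Set.range ep ∪ Set.range em := by
    ext a; simpa using (hs a)
  rw [this]
  exact IsConnected.union ⟨ep x, ⟨x, rfl⟩, ⟨x, hx.symm⟩⟩ (isConnected_range ep.continuous)
    (isConnected_range em.continuous)

/-- every cycle on the double of `M` of top degree is a multiple of the double of `z0` -/
theorem double_cycle {k : ℕ} (M : OCCManifold (k + 2)) [T2Space X] [CompactSpace X] (hX : EChart (k + 2) X)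
    {ep em : C(M.carrier, X)} (hs : ∀ a, (∃ x, ep x = a) ∨ ∃ x, em x = a) (hp : Function.Injective ep)
    (hm : Function.Injective em) (hpm : ∀ x y, ep x = em y → x = y ∧ x ∈ M.boundary)
    (hA : ∀ x ∈ M.boundary, ep x = em x) (hne : M.boundary.Nonempty)
    (ω : SingularChain ℤ X (k + 2)) (hω : bd ω = 0) :
    ∃ (r : ℤ) (b : SingularChain ℤ X (k + 3)),
      ω - bd b = r • (pf ep M.fundClass - pf em M.fundClass) := by
  have := M.t2
  have := M.compact
  have := M.connected
  have : ConnectedSpace X := by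
    obtain ⟨x, hx⟩ := hne
    exact conn_glue hs ⟨x, hA x hx⟩
  have cep : Topology.IsEmbedding ep := (ep.continuous.isClosedEmbedding hp).isEmbedding
  have cem : Topology.IsEmbedding em := (em.continuous.isClosedEmbedding hm).isEmbedding
  obtain ⟨F, O, hO, hbO, hF0, hFb, hF1⟩ := exists_push M
  obtain ⟨G, hGp, hGm⟩ := glue_push hs hp hm hpm F hFb
  have hcl : ∀ e : C(M.carrier, X), IsOpen (e '' Oᶜ)ᶜ := fun e =>
    (hO.isClosed_compl.isCompact.image e.continuous).isClosed.isOpen_compl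
  have hcov : ω ∈ con ℤ ((em '' Oᶜ)ᶜ ∪ (ep '' Oᶜ)ᶜ) (k + 2) := by
    refine con_mono (fun a _ => ?_) (con_univ ω)
    by_contra h
    rw [← Set.compl_inter, Set.notMem_compl_iff] at h
    obtain ⟨⟨y, hy, rfl⟩, x, hx, hxy⟩ := h
    exact hx (hbO (hpm x y hxy).2)
  obtain ⟨N, hN⟩ := small (hcl em) (hcl ep) hcov
  obtain ⟨sp, hsp, sm, hsm, hss⟩ := Submodule.mem_sup.1 (hN N le_rfl)
  have him : ∀ a ∈ (em '' Oᶜ)ᶜ, G (a, 1) ∈ ep '' Set.univ := by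
    intro a ha
    rcases hs a with ⟨x, rfl⟩ | ⟨x, rfl⟩
    · exact ⟨F (x, 1), trivial, (hGp x 1).symm⟩
    · have hx : x ∈ O := by
        by_contra hx
        exact ha ⟨x, hx, rfl⟩
      exact ⟨F (x, 1), trivial, by rw [hGm, hA _ (hF1 x hx)]⟩
  have hip : ∀ a ∈ (ep '' Oᶜ)ᶜ, G (a, 1) ∈ em '' Set.univ := by
    intro a ha
    rcases hs a with ⟨x, rfl⟩ | ⟨x, rfl⟩
    · have hx : x ∈ O := by
        by_contra hx
        exact ha ⟨x, hx, rfl⟩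
      exact ⟨F (x, 1), trivial, by rw [hGp, hA _ (hF1 x hx)]⟩
    · exact ⟨F (x, 1), trivial, (hGm x 1).symm⟩
  obtain ⟨pp, -, hpp⟩ := lift_emb cep (pf_con (f := slice G 1) him hsp)
  obtain ⟨pm, -, hpm'⟩ := lift_emb cem (pf_con (f := slice G 1) hip hsm)
  have hcyc : bd (sdN N ω) = 0 := by rw [bd_sdN, hω, map_zero]
  have hsum : pf ep pp + pf em pm = pf (slice G 1) (sdN N ω) := by
    rw [hpp, hpm', ← map_add, hss]
  have hbsum : pf ep (bd pp) + pf em (bd pm) = 0 := by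
    rw [← bd_pf, ← bd_pf, ← map_add, hsum, bd_pf, hcyc, map_zero]
  have hbp : bd pp ∈ con ℤ M.boundary (k + 1) := by
    have h1 : pf ep (bd pp) ∈ con ℤ (Set.range em) (k + 1) := by
      rw [eq_neg_of_add_eq_zero_left hbsum]
      exact Submodule.neg_mem _ (pf_con (A := Set.univ) (B := Set.range em) (fun x _ => ⟨x, rfl⟩) (con_univ _))
    refine con_mono ?_ (pf_con_inv hp h1)
    rintro x ⟨y, hy⟩
    exact (hpm x y hy.symm).2
  have hbm : bd pm ∈ con ℤ M.boundary (k + 1) := by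
    have h1 : pf em (bd pm) ∈ con ℤ (Set.range ep) (k + 1) := by
      rw [eq_neg_of_add_eq_zero_right hbsum]
      exact Submodule.neg_mem _ (pf_con (A := Set.univ) (B := Set.range ep) (fun x _ => ⟨x, rfl⟩) (con_univ _))
    refine con_mono ?_ (pf_con_inv hm h1)
    rintro x ⟨y, hy⟩
    obtain ⟨rfl, h⟩ := hpm y x hy
    exact h
  have hrel : ∀ c : SingularChain ℤ M.carrier (k + 2), bd c ∈ con ℤ M.boundary (k + 1) →
      ∃ (r : ℤ) (u : SingularChain ℤ M.carrier (k + 3)), ∃ v ∈ con ℤ M.boundary (k + 2),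
        c = r • M.fundClass + (bd u + v) := by
    intro c hc
    obtain ⟨r, u, v, hv, h⟩ := M.fundClass_gen c (by
      change chainBoundary c ∈ chainsOn M.boundary (k + 1)
      rw [chainBoundary_eq]
      exact mem_chainsOn_iff.2 hc)
    rw [chainBoundary_eq] at h
    exact ⟨r, u, v, mem_chainsOn_iff.1 hv, eq_add_of_sub_eq' h⟩
  obtain ⟨r, u, v, hv, hr⟩ := hrel pp hbp
  obtain ⟨r', u', v', hv', hr'⟩ := hrel pm hbm
  have hz0 : bd M.fundClass ∈ con ℤ M.boundary (k + 1) := by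
    have := M.fundClass_cycle
    change chainBoundary M.fundClass ∈ chainsOn M.boundary (k + 1) at this
    rw [chainBoundary_eq] at this
    exact mem_chainsOn_iff.1 this
  have hzz : pf ep (bd M.fundClass) = pf em (bd M.fundClass) := pf_congr hA hz0
  have hvv : pf ep v = pf em v := pf_congr hA hv
  set z0 := M.fundClass with hz0def
  let y : SingularChain ℤ X (k + 2) := pf em ((r + r') • z0 + v + v')
  have hP : pf (slice G 1) (sdN N ω) = r • (pf ep z0 - pf em z0) + bd (pf ep u + pf em u') + y := by
    rw [← hsum, hr, hr']
    simp only [y, map_add, map_zsmul, bd_pf, hvv, add_smul, smul_sub]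
    abel
  have hyc : bd y = 0 := by
    have h1 : bd (pf (slice G 1) (sdN N ω)) = 0 := by rw [bd_pf, hcyc, map_zero]
    rw [hP, map_add, map_add, bd_bd, add_zero, map_zsmul, map_sub, bd_pf, bd_pf, hzz, sub_self,
      smul_zero, zero_add] at h1
    exact h1
  obtain ⟨x0, hx0⟩ := interior_pt M
  obtain ⟨e, he⟩ := thmL hX hyc (p := ep x0) (pf_con (A := Set.univ) (fun x _ => by
    intro h
    exact hx0 (hpm x0 x h.symm).2) (con_univ _))
  have hid : slice G 0 = ContinuousMap.id X := by
    ext a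
    change G (a, 0) = a
    rcases hs a with ⟨x, rfl⟩ | ⟨x, rfl⟩
    · rw [hGp, hF0]
    · rw [hGm, hF0]
  have hh := bd_hop G (sdN N ω)
  rw [hid, pf_id, hcyc, map_zero, sub_zero] at hh
  refine ⟨r, pf ep u + pf em u' + e - hop G (sdN N ω) - sdD N ω, ?_⟩
  have h3 : ω = sdN N ω - bd (sdD N ω) := sd_hom N ω hω
  rw [map_sub, map_sub, hh, hP, map_add _ (pf ep u + pf em u') e, he]
  nth_rewrite 1 [h3]
  abel

end bdry

/-! ### The glued cycle does not bound -/

section glued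

theorem sx_preconn (k : ℕ) : PreconnectedSpace (Sx k) :=
  isPreconnected_iff_preconnectedSpace.1 (convex_stdSimplex ℝ (Fin (k + 1))).isPreconnected

/-- lifting through a closed map with unique preimages -/
theorem lift_closed {Z : Type} [TopologicalSpace Z] {Q : Z → X} (hQ : IsClosedMap Q) {k : ℕ}
    (σ : C(Sx k, X)) (hs : ∀ t, ∃ z, Q z = σ t) (hu : ∀ t z z', Q z = σ t → Q z' = σ t → z = z') :
    ∃ g : C(Sx k, Z), ∀ t, Q (g t) = σ t := by
  choose g hg using hs
  refine ⟨⟨g, continuous_iff_isClosed.2 fun C hC => ?_⟩, hg⟩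
  have : g ⁻¹' C = σ ⁻¹' (Q '' C) := by
    ext t
    constructor
    · intro h
      exact ⟨g t, h, hg t⟩
    · rintro ⟨p, hp, hpt⟩
      have := hu t p (g t) hpt (hg t)
      change g t ∈ C
      rwa [← this]
  rw [this]
  exact (hQ C hC).preimage σ.continuous

variable {m d : ℕ} (W : OCCManifold (m + 1)) [T2Space X] (emb : Fin d → C(W.carrier, X))

open scoped Classical in
/-- the transfer to the interior of the `j`-th piece -/
def trf (j : Fin d) {k : ℕ} : SingularChain ℤ X k →ₗ[ℤ] SingularChain ℤ W.carrier k :=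
  Finsupp.linearCombination ℤ fun σ : C(Sx k, X) =>
    if h : ∃ τ : C(Sx k, W.carrier), (∀ t, τ t ∈ W.boundaryᶜ) ∧ (emb j).comp τ = σ then
      Finsupp.single h.choose (1 : ℤ) else 0

variable {W emb}

theorem trf_same (hinj : ∀ i j a b, emb i a = emb j b → (i = j ∧ a = b) ∨ (a ∈ W.boundary ∧ b ∈ W.boundary))
    (j : Fin d) {k : ℕ} (c : SingularChain ℤ W.carrier k) (hc : c ∈ con ℤ W.boundaryᶜ k) :
    trf W emb j (pf (emb j) c) = c := by
  have := map_con (trf W emb j ∘ₗ pf (emb j) - LinearMap.id) (⊥ : Submodule ℤ _) (fun σ hσ => ?_) hc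
  · simpa [sub_eq_zero] using this
  · rw [Submodule.mem_bot, LinearMap.sub_apply, LinearMap.comp_apply, pf_single, trf,
      Finsupp.linearCombination_single, one_smul]
    have h : ∃ τ : C(Sx k, W.carrier), (∀ t, τ t ∈ W.boundaryᶜ) ∧ (emb j).comp τ = (emb j).comp σ :=
      ⟨σ, hσ, rfl⟩
    rw [dif_pos h]
    have : h.choose = σ := by
      ext t
      rcases hinj j j _ _ (DFunLike.congr_fun h.choose_spec.2 t) with h1 | h1
      · exact h1.2
      · exact (hσ t h1.2).elim
    rw [this]
    exact sub_self _

theorem trf_other (hinj : ∀ i j a b, emb i a = emb j b → (i = j ∧ a = b) ∨ (a ∈ W.boundary ∧ b ∈ W.boundary))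
    {i j : Fin d} (hij : j ≠ i) {k : ℕ} (c : SingularChain ℤ W.carrier k) (hc : c ∈ con ℤ W.boundaryᶜ k) :
    trf W emb j (pf (emb i) c) = 0 := by
  have := map_con (trf W emb j ∘ₗ pf (emb i)) (⊥ : Submodule ℤ _) (fun σ hσ => ?_) hc
  · simpa using this
  · rw [Submodule.mem_bot, LinearMap.comp_apply, pf_single, trf,
      Finsupp.linearCombination_single, one_smul]
    refine dif_neg ?_
    rintro ⟨τ, h1, h2⟩
    rcases hinj j i _ _ (DFunLike.congr_fun h2 (bary k)) with h | h
    · exact hij h.1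
    · exact hσ _ h.2

theorem trf_con {j : Fin d} {O : Set W.carrier} {k : ℕ} (c : SingularChain ℤ X k)
    (hc : c ∈ con ℤ (⋃ i, emb i '' Oᶜ)ᶜ k) : trf W emb j c ∈ con ℤ O k := by
  refine map_con (trf W emb j) _ (fun σ hσ => ?_) hc
  rw [trf, Finsupp.linearCombination_single, one_smul]
  split_ifs with h
  · refine single_mem_con (fun t => ?_) _
    by_contra ht
    refine hσ t (Set.mem_iUnion.2 ⟨j, h.choose t, ht, ?_⟩)
    exact DFunLike.congr_fun h.choose_spec.2 t
  · exact Submodule.zero_mem _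

theorem trf_bd (hinj : ∀ i j a b, emb i a = emb j b → (i = j ∧ a = b) ∨ (a ∈ W.boundary ∧ b ∈ W.boundary))
    (hsur : ∀ x, ∃ j w, emb j w = x) (j : Fin d) {k : ℕ} (c : SingularChain ℤ X (k + 1))
    (hc : c ∈ con ℤ (⋃ i, emb i '' W.boundary)ᶜ (k + 1)) :
    trf W emb j (bd c) = bd (trf W emb j c) := by
  have := W.compact
  have := map_con (trf W emb j ∘ₗ bd - bd ∘ₗ trf W emb j) (⊥ : Submodule ℤ _) (fun σ hσ => ?_) hc
  · simpa [sub_eq_zero] using this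
  · rw [Submodule.mem_bot, LinearMap.sub_apply, LinearMap.comp_apply, LinearMap.comp_apply]
    let Q : Fin d × W.carrier → X := fun p => emb p.1 p.2
    have hQc : Continuous Q := continuous_prod_of_discrete_left.2 fun i => (emb i).continuous
    have hb : ∀ t i a, emb i a = σ t → a ∈ W.boundaryᶜ := fun t i a h ha =>
      hσ t (Set.mem_iUnion.2 ⟨i, a, ha, h⟩)
    obtain ⟨g, hg⟩ := lift_closed (Q := Q) hQc.isClosedMap σ
      (fun t => by obtain ⟨i, w, h⟩ := hsur (σ t); exact ⟨(i, w), h⟩)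
      (fun t z z' h h' => by
        rcases hinj _ _ _ _ (h.trans h'.symm) with h1 | h1
        · exact Prod.ext h1.1 h1.2
        · exact (hb t _ _ h h1.1).elim)
    have := sx_preconn (k + 1)
    have hconst : ∀ t, (g t).1 = (g (bary _)).1 := fun t =>
      PreconnectedSpace.constant this (f := fun t => (g t).1) (by fun_prop)
    let i := (g (bary _)).1
    let τ : C(Sx (k + 1), W.carrier) := ⟨fun t => (g t).2, by fun_prop⟩
    have hτ : (emb i).comp τ = σ := by
      ext t
      change emb i (g t).2 = σ t
      rw [← hg t]
      change emb i (g t).2 = emb (g t).1 (g t).2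
      rw [hconst t]
    have hτb : Finsupp.single τ (1 : ℤ) ∈ con ℤ W.boundaryᶜ (k + 1) :=
      single_mem_con (fun t => hb t i _ (DFunLike.congr_fun hτ t)) _
    rw [← hτ, ← pf_single, bd_pf]
    by_cases hij : j = i
    · rw [hij, trf_same hinj i _ hτb, trf_same hinj i _ (bd_con hτb), sub_self]
    · rw [trf_other hinj hij _ hτb, trf_other hinj hij _ (bd_con hτb), map_zero, sub_self]

theorem glued_ne {d : ℕ} [NeZero d] {emb : Fin d → C(W.carrier, X)}
    (hinj : ∀ i j a b, emb i a = emb j b → (i = j ∧ a = b) ∨ (a ∈ W.boundary ∧ b ∈ W.boundary))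
    (hsur : ∀ x, ∃ j w, emb j w = x) (c : SingularChain ℤ W.carrier (m + 1))
    (hc : bd c ∈ con ℤ W.boundary m) (e : SingularChain ℤ X (m + 2))
    (he : ∑ j, pf (emb j) c = bd e) :
    ∃ (b : SingularChain ℤ W.carrier (m + 2)), ∃ a ∈ con ℤ W.boundary (m + 1), c = bd b + a := by
  have := W.t2
  have := W.compact
  obtain ⟨F, O, hO, hbO, hF0, hFb, hF1⟩ := exists_push W
  have hcl := closed_bdry W
  have hXI : IsOpen (⋃ i, emb i '' W.boundary)ᶜ := isOpen_compl_iff.2 (isClosed_iUnion_of_finite fun i =>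
    (hcl.isCompact.image (emb i).continuous).isClosed)
  have hXN : IsOpen (⋃ i, emb i '' Oᶜ)ᶜ := isOpen_compl_iff.2 (isClosed_iUnion_of_finite fun i =>
    (hO.isClosed_compl.isCompact.image (emb i).continuous).isClosed)
  have hecov : e ∈ con ℤ ((⋃ i, emb i '' W.boundary)ᶜ ∪ (⋃ i, emb i '' Oᶜ)ᶜ) (m + 2) := by
    refine con_mono (fun x _ => ?_) (con_univ e)
    by_contra h
    rw [← Set.compl_inter, Set.notMem_compl_iff] at h
    obtain ⟨h1, h2⟩ := h
    obtain ⟨i, a, ha, rfl⟩ := Set.mem_iUnion.1 h1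
    obtain ⟨j, b, hb, hab⟩ := Set.mem_iUnion.1 h2
    rcases hinj _ _ _ _ hab with h3 | h3
    · exact hb (hbO (h3.2 ▸ ha))
    · exact hb (hbO h3.1)
  have hccov : c ∈ con ℤ (W.boundaryᶜ ∪ O) (m + 1) := by
    refine con_mono (fun x _ => ?_) (con_univ c)
    by_cases hx : x ∈ W.boundary
    · exact Or.inr (hbO hx)
    · exact Or.inl hx
  obtain ⟨N1, hN1⟩ := small hXI hXN hecov
  obtain ⟨N2, hN2⟩ := small hcl.isOpen_compl hO hccov
  let N := max N1 N2
  obtain ⟨eI, heI, eN, heN, hee⟩ := Submodule.mem_sup.1 (hN1 N (le_max_left _ _))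
  obtain ⟨ci, hci, cu, hcu, hcc⟩ := Submodule.mem_sup.1 (hN2 N (le_max_right _ _))
  have h1 : bd eI + bd eN = ∑ i, (pf (emb i) ci + pf (emb i) cu) := by
    rw [← map_add, hee, bd_sdN, ← he, map_sum]
    refine Finset.sum_congr rfl fun i _ => ?_
    rw [← map_add, hcc, sdN_pf]
  let j : Fin d := 0
  have h2 := congrArg (trf W emb j) h1
  have h3 : ∀ i, pf (emb i) cu ∈ con ℤ (⋃ i, emb i '' Oᶜ)ᶜ (m + 1) := by
    intro i
    refine pf_con (fun a ha => ?_) hcu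
    intro h
    obtain ⟨l, b, hb, hab⟩ := Set.mem_iUnion.1 h
    rcases hinj _ _ _ _ hab with h3 | h3
    · exact hb (h3.2 ▸ ha)
    · exact hb (hbO h3.1)
  rw [map_add, trf_bd hinj hsur j eI heI, map_sum] at h2
  simp only [map_add] at h2
  rw [Finset.sum_add_distrib, Finset.sum_eq_single j (fun i _ hij => trf_other hinj hij.symm ci hci)
    (fun h => (h (Finset.mem_univ _)).elim), trf_same hinj j ci hci] at h2
  let o : SingularChain ℤ W.carrier (m + 1) :=
    trf W emb j (bd eN) - ∑ i, trf W emb j (pf (emb i) cu) + cu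
  have ho : o ∈ con ℤ O (m + 1) := Submodule.add_mem _ (Submodule.sub_mem _ (trf_con _ (bd_con heN))
    (Submodule.sum_mem _ fun i _ => trf_con _ (h3 i))) hcu
  have h4 : sdN N c = bd (trf W emb j eI) + o := by
    rw [← hcc]
    have : ci = bd (trf W emb j eI) + trf W emb j (bd eN) - ∑ i, trf W emb j (pf (emb i) cu) := by
      rw [h2]; abel
    rw [this]
    simp only [o]
    abel
  have hbs : bd (sdN N c) ∈ con ℤ W.boundary m := by
    rw [bd_sdN]; exact sdN_con N hc
  have h5 := bd_hop F (sdN N c)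
  have h0 : slice F 0 = ContinuousMap.id _ := by
    ext x
    exact hF0 x
  rw [h0, pf_id] at h5
  have h6 := sdN_homotopy N c
  refine ⟨pf (slice F 1) (trf W emb j eI) - hop F (sdN N c) - sdD N c,
    pf (slice F 1) o - hop F (bd (sdN N c)) - sdD N (bd c), ?_, ?_⟩
  · refine Submodule.sub_mem _ (Submodule.sub_mem _ (pf_con hF1 ho) (hop_con ?_ hbs)) (sdD_con N hc)
    intro x hx s
    rw [hFb x hx]; exact hx
  · have h7 : pf (slice F 1) (sdN N c) = bd (pf (slice F 1) (trf W emb j eI)) + pf (slice F 1) o := by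
      rw [bd_pf, ← map_add, ← h4]
    have h8 : sdN N c = pf (slice F 1) (sdN N c) - hop F (bd (sdN N c)) - bd (hop F (sdN N c)) := by
      rw [h5]; abel
    have h9 : c = sdN N c - bd (sdD N c) - sdD N (bd c) := by rw [h6]; abel
    rw [map_sub, map_sub]
    generalize bd (hop F (sdN N c)) = A1 at *
    generalize hop F (bd (sdN N c)) = A2 at *
    generalize pf (slice F 1) (sdN N c) = A3 at *
    generalize bd (sdD N c) = A4 at *
    generalize sdD N (bd c) = A5 at *
    rw [h9, h8, h7]
    abel

end glued

/-! ## Hahn–Banach duality for the `ℓ¹`-norm -/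

theorem norm_sum {n : ℕ} (c : SingularChain ℝ X n) (s : Finset C(Sx n, X)) (hs : c.support ⊆ s) :
    chainNorm c = ∑ σ ∈ s, |c σ| :=
  Finsupp.sum_of_support_subset c hs (fun _ r => |r|) (by simp)

theorem norm_add {n : ℕ} (c d : SingularChain ℝ X n) : chainNorm (c + d) ≤ chainNorm c + chainNorm d := by
  classical
  rw [norm_sum c (c.support ∪ d.support) Finset.subset_union_left,
    norm_sum d (c.support ∪ d.support) Finset.subset_union_right,
    norm_sum (c + d) (c.support ∪ d.support) Finsupp.support_add, ← Finset.sum_add_distrib]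
  exact Finset.sum_le_sum fun σ _ => abs_add_le _ _

theorem norm_smul' {n : ℕ} (t : ℝ) (c : SingularChain ℝ X n) : chainNorm (t • c) = |t| * chainNorm c := by
  rw [norm_sum (t • c) c.support Finsupp.support_smul, norm_sum c c.support subset_rfl, Finset.mul_sum]
  simp [abs_mul]

theorem norm_nonneg' {n : ℕ} (c : SingularChain ℝ X n) : 0 ≤ chainNorm c :=
  Finset.sum_nonneg fun _ _ => abs_nonneg _

theorem norm_single' {n : ℕ} (σ : C(Sx n, X)) (r : ℝ) : chainNorm (Finsupp.single σ r) = |r| :=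
  Finsupp.sum_single_index (by simp)

/-- the quotient seminorm modulo boundaries -/
def qn {n : ℕ} (v : SingularChain ℝ X n) : ℝ := ⨅ b : SingularChain ℝ X (n + 1), chainNorm (v + bd b)

theorem qn_le {n : ℕ} (v : SingularChain ℝ X n) (b : SingularChain ℝ X (n + 1)) :
    qn v ≤ chainNorm (v + bd b) :=
  ciInf_le ⟨0, by rintro _ ⟨b, rfl⟩; exact norm_nonneg' _⟩ b

theorem hahn {n : ℕ} (F : SingularChain ℝ X n) (N : ℝ)
    (hN : ∀ b, N ≤ chainNorm (F + bd b)) :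
    N ≤ 0 ∨ ∃ φ : SingularChain ℝ X n →ₗ[ℝ] ℝ, (∀ b, φ (bd b) = 0) ∧
      (∀ σ, |φ (Finsupp.single σ 1)| ≤ 1) ∧ φ F = N := by
  by_cases hF : F = 0
  · left
    have := hN 0
    simpa [hF, chainNorm] using this
  by_cases hN0 : N ≤ 0
  · exact Or.inl hN0
  right
  push Not at hN0
  have hle : ∀ (v : SingularChain ℝ X n) (t : ℝ), (∀ b, t ≤ chainNorm (v + bd b)) → t ≤ qn v :=
    fun v t h => le_ciInf h
  obtain ⟨g, hg1, hg2⟩ := exists_extension_of_le_sublinear (LinearPMap.mkSpanSingleton F N hF) qn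
    (fun c hc x => by
      apply le_antisymm
      · rw [← div_le_iff₀' hc]
        refine hle _ _ fun b => ?_
        rw [div_le_iff₀' hc]
        have := qn_le (c • x) (c • b)
        rwa [map_smul, ← smul_add, norm_smul', abs_of_pos hc] at this
      · refine hle _ _ fun b => ?_
        have := qn_le x (c⁻¹ • b)
        have h2 : c • x + bd b = c • (x + bd (c⁻¹ • b)) := by
          rw [smul_add, map_smul, smul_inv_smul₀ hc.ne']
        rw [h2, norm_smul', abs_of_pos hc]
        gcongr)
    (fun x y => by
      rw [← sub_le_iff_le_add]
      refine hle _ _ fun b => ?_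
      rw [sub_le_comm]
      refine hle _ _ fun b' => ?_
      rw [sub_le_iff_le_add']
      have := qn_le (x + y) (b + b')
      rw [map_add, add_add_add_comm] at this
      exact this.trans (norm_add _ _))
    (fun x => by
      obtain ⟨x, hx⟩ := x
      obtain ⟨t, rfl⟩ := Submodule.mem_span_singleton.1 hx
      have hval : LinearPMap.mkSpanSingleton (σ := RingHom.id ℝ) F N hF ⟨t • F, hx⟩ = t • N :=
        LinearPMap.mkSpanSingleton'_apply _ _ _ _ _
      rw [hval]
      refine hle _ _ fun b => ?_
      rcases le_or_gt t 0 with ht | ht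
      · exact (mul_nonpos_of_nonpos_of_nonneg ht hN0.le).trans (norm_nonneg' _)
      · have h2 : t • F + bd b = t • (F + bd (t⁻¹ • b)) := by
          rw [smul_add, map_smul, smul_inv_smul₀ ht.ne']
        change t * N ≤ chainNorm (t • F + bd b)
        rw [h2, norm_smul', abs_of_pos ht]
        have := hN (t⁻¹ • b)
        gcongr)
  have hb : ∀ b, g (bd b) ≤ 0 := fun b => by
    refine (hg2 _).trans ((qn_le _ (-b)).trans ?_)
    simp [chainNorm]
  have hs : ∀ v, g v ≤ chainNorm v := fun v => by
    refine (hg2 _).trans ((qn_le _ 0).trans ?_)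
    simp
  refine ⟨g, fun b => le_antisymm (hb b) ?_, fun σ => abs_le.2 ⟨?_, ?_⟩, ?_⟩
  · have := hb (-b)
    simpa using this
  · have := hs (-Finsupp.single σ 1)
    rw [map_neg, ← Finsupp.single_neg, norm_single'] at this
    simp at this
    linarith
  · have := hs (Finsupp.single σ 1)
    rw [norm_single'] at this
    simpa using this
  · have := hg1 ⟨F, Submodule.mem_span_singleton_self F⟩
    rw [this]
    have h2 := LinearPMap.mkSpanSingleton_apply ℝ ℝ (σ := RingHom.id ℝ) hF N
    exact h2

/-! ## Analysis of the gluing relations -/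

theorem glue_double {M : Type} {Bd : Set M} {a b : M ⊕ M}
    (h : Relation.EqvGen (fun p q : M ⊕ M => ∃ x ∈ Bd, p = Sum.inl x ∧ q = Sum.inr x) a b) :
    Sum.elim id id a = Sum.elim id id b ∧ (a = b ∨ Sum.elim id id a ∈ Bd) := by
  induction h with
  | rel a b h =>
    obtain ⟨x, hx, rfl, rfl⟩ := h
    exact ⟨rfl, Or.inr hx⟩
  | refl a => exact ⟨rfl, Or.inl rfl⟩
  | symm a b _ ih => exact ⟨ih.1.symm, ih.2.imp Eq.symm fun h => ih.1 ▸ h⟩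
  | trans a b c _ _ ih1 ih2 =>
    refine ⟨ih1.1.trans ih2.1, ?_⟩
    rcases ih1.2 with h | h
    · subst h
      exact ih2.2
    · exact Or.inr h

theorem glue_cyc {P : Type} {r : P → P → Prop} {S : Set P} (hr : ∀ p q, r p q → p ∈ S ∧ q ∈ S) {a b : P}
    (h : Relation.EqvGen r a b) : a = b ∨ (a ∈ S ∧ b ∈ S) := by
  induction h with
  | rel a b h => exact Or.inr (hr _ _ h)
  | refl a => exact Or.inl rfl
  | symm a b _ ih => exact ih.imp Eq.symm And.symm
  | trans a b c _ _ ih1 ih2 =>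
    rcases ih1 with h | h
    · subst h
      exact ih2
    · rcases ih2 with h2 | h2
      · subst h2
        exact Or.inr h
      · exact Or.inr ⟨h.1, h2.2⟩

/-- the telescoping identity around the cyclic gluing -/
theorem telescope {M W : Type} [TopologicalSpace M] [TopologicalSpace W] {d : ℕ} [NeZero d]
    {emb : Fin d → C(W, X)} {ip im : C(M, W)} (h : ∀ j x, emb j (im x) = emb (j + 1) (ip x)) {n : ℕ}
    (z : SingularChain R M n) : ∑ j, pf (emb j) (pf ip z - pf im z) = 0 := by
  have h1 : ∀ j, (emb j).comp im = (emb (j + 1)).comp ip := fun j => ContinuousMap.ext (h j)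
  simp only [map_sub, Finset.sum_sub_distrib, pf_pf]
  simp only [h1]
  rw [sub_eq_zero]
  exact (Equiv.sum_comp (Equiv.addRight (1 : Fin d)) (fun j => pf ((emb j).comp ip) z)).symm

/-! ## Final assembly -/

theorem simVol_set {n : ℕ} (M : OCCManifold n) (ε : ℝ) (hε : 0 < ε) :
    ∃ c, IsFundamentalCycle M c ∧ chainNorm c < simVol M + ε := by
  have hcyc : IsRelCycle M.boundary n (chainExt M.fundClass) := by
    have := M.fundClass_cycle
    match n, M, this with
    | 0, _, _ => trivial
    | n + 1, M, h =>
      change chainBoundary _ ∈ _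
      have h' : chainBoundary M.fundClass ∈ chainsOn M.boundary n := h
      rw [chainBoundary_eq, mem_chainsOn_iff] at h' ⊢
      rw [chainExt_eq, ← cext_bd]
      exact cext_con h'
  have hne : {r : ℝ | ∃ c : SingularChain ℝ M.carrier n, IsFundamentalCycle M c ∧ r = chainNorm c}.Nonempty := by
    refine ⟨_, chainExt M.fundClass, ⟨hcyc, 0, 0, ?_, ?_⟩, rfl⟩
    · rw [mem_chainsOn_iff]
      exact zero_mem _
    · rw [chainBoundary_eq]
      simp
  obtain ⟨_, ⟨c, hc, rfl⟩, hlt⟩ := exists_lt_of_csInf_lt hne (lt_add_of_pos_right (simVol M) hε)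
  exact ⟨c, hc, hlt⟩

theorem simVol_le {n : ℕ} {M : OCCManifold n} {c} (hc : IsFundamentalCycle M c) : simVol M ≤ chainNorm c :=
  csInf_le ⟨0, by rintro _ ⟨c, _, rfl⟩; exact norm_nonneg' _⟩ ⟨c, hc, rfl⟩

theorem simVol_nonneg {n : ℕ} (M : OCCManifold n) : 0 ≤ simVol M :=
  Real.sInf_nonneg (by rintro _ ⟨c, _, rfl⟩; exact norm_nonneg' _)

/-- the estimate on a single bounded cocycle of the total space -/
theorem key_est {k d : ℕ} [NeZero d] {M : OCCManifold (k + 2)} {W : OCCManifold (k + 3)}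
    (hAm : Amen W.boundary) {embp embm : C(M.carrier, W.boundary)}
    (hAA : ∀ x ∈ M.boundary, embp x = embm x) {emb : Fin d → C(W.carrier, X)}
    (hcyc : ∀ j x, emb j ((subInc W.boundary).comp embm x) = emb (j + 1) ((subInc W.boundary).comp embp x))
    (hM : simVol M = 0) (r : ℤ) (c' : SingularChain ℤ W.carrier (k + 3))
    (hc1 : bd c' = r • (pf ((subInc W.boundary).comp embp) M.fundClass -
      pf ((subInc W.boundary).comp embm) M.fundClass))
    (hc2 : W.fundClass - c' ∈ con ℤ W.boundary (k + 3))
    (φ : SingularChain ℝ X (k + 3) →ₗ[ℝ] ℝ) (hφ : ∀ c, φ (bd c) = 0)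
    (h1 : ∀ σ, |φ (Finsupp.single σ 1)| ≤ 1) :
    |φ (cext (∑ j, pf (emb j) c'))| ≤ d * simVol W := by
  set ip := (subInc W.boundary).comp embp with hip
  set im := (subInc W.boundary).comp embm with him
  have hB : ∀ j : Fin d, ∃ (ψ : SingularChain ℝ W.carrier (k + 2) →ₗ[ℝ] ℝ) (K : ℝ),
      (∀ σ, |ψ (Finsupp.single σ 1)| ≤ K) ∧
      (∀ c, |φ (pf (emb j) c) - ψ (bd c)| ≤ chainNorm c) ∧
      (∀ a ∈ con ℝ W.boundary (k + 3), φ (pf (emb j) a) - ψ (bd a) = 0) := by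
    intro j
    obtain ⟨ψ, K, hK, hn, hz⟩ := thmB hAm (φ ∘ₗ pf (emb j)) (fun c => by
      rw [LinearMap.comp_apply, ← bd_pf, hφ]) (fun σ => by
      rw [LinearMap.comp_apply, pf_single]
      exact h1 _)
    refine ⟨ψ, K, hK, fun c => ?_, fun a ha => ?_⟩
    · have := chain_bound (φ ∘ₗ pf (emb j) - ψ ∘ₗ bd) hn c
      simpa using this
    · have := map_con (φ ∘ₗ pf (emb j) - ψ ∘ₗ bd) (⊥ : Submodule ℝ ℝ) (fun σ hσ => ?_) ha
      · simpa using this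
      · exact hz σ hσ
  choose ψ K hK hn hz using hB
  have hest : ∀ c z, IsFundamentalCycle W c → IsFundamentalCycle M z →
      |φ (cext (∑ j, pf (emb j) c'))| ≤ d * chainNorm c + (∑ j, K j * (2 * |(r : ℝ)|)) * chainNorm z := by
    rintro c z ⟨-, b, a, ha, hcb⟩ ⟨-, u, v, hv, hzu⟩
    rw [mem_chainsOn_iff] at ha hv
    rw [chainBoundary_eq, chainExt_eq] at hcb hzu
    set c'' : SingularChain ℝ W.carrier (k + 3) := cext c' + (r : ℝ) • (pf ip u - pf im u) with hc''
    have hvv : pf ip v = pf im v := pf_congr (fun x hx => by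
      simp only [hip, him, ContinuousMap.comp_apply, hAA x hx]) hv
    have hz' : z = cext M.fundClass + bd u + v := by rw [add_assoc]; exact sub_eq_iff_eq_add'.1 hzu
    have hbd : bd c'' = (r : ℝ) • (pf ip z - pf im z) := by
      rw [hc'', map_add, map_smul, map_sub, bd_pf, bd_pf, ← cext_bd, hc1, cext_zsmul, map_sub, cext_pf,
        cext_pf, hz']
      simp only [map_add, hvv]
      module
    have hE : cext (∑ j, pf (emb j) c') = ∑ j, pf (emb j) c'' := by
      simp only [hc'', map_add, map_smul, Finset.sum_add_distrib, ← Finset.smul_sum]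
      rw [telescope hcyc, smul_zero, add_zero, map_sum]
      simp only [cext_pf]
    have hcc : ∃ a' ∈ con ℝ W.boundary (k + 3), c'' = c - bd b + a' := by
      refine ⟨(r : ℝ) • (pf ip u - pf im u) - cext (W.fundClass - c') - a, ?_, ?_⟩
      · refine sub_mem (sub_mem (Submodule.smul_mem _ _ (sub_mem ?_ ?_)) (cext_con hc2)) ha
        · exact pf_con (A := Set.univ) (fun x _ => (embp x).2) (con_univ u)
        · exact pf_con (A := Set.univ) (fun x _ => (embm x).2) (con_univ u)
      · have : c = cext W.fundClass + (bd b + a) := sub_eq_iff_eq_add'.1 hcb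
        rw [hc'', this, map_sub]
        abel
    obtain ⟨a', ha', hca⟩ := hcc
    have hz1 : ∀ j, |ψ j (bd c'')| ≤ (K j * (2 * |(r : ℝ)|)) * chainNorm z := by
      intro j
      have e1 := chain_bound (ψ j ∘ₗ pf ip) (B := K j) (fun σ => by
        rw [LinearMap.comp_apply, pf_single]; exact hK j _) z
      have e2 := chain_bound (ψ j ∘ₗ pf im) (B := K j) (fun σ => by
        rw [LinearMap.comp_apply, pf_single]; exact hK j _) z
      rw [hbd, map_smul, map_sub, smul_eq_mul, abs_mul]
      have e3 := abs_sub (ψ j (pf ip z)) (ψ j (pf im z))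
      simp only [LinearMap.comp_apply] at e1 e2
      calc |(r : ℝ)| * |ψ j (pf ip z) - ψ j (pf im z)| ≤ |(r : ℝ)| * (K j * chainNorm z + K j * chainNorm z) := by
            gcongr
            linarith
        _ = _ := by ring
    have hj : ∀ j, |φ (pf (emb j) c'')| ≤ chainNorm c + (K j * (2 * |(r : ℝ)|)) * chainNorm z := by
      intro j
      have e1 : φ (pf (emb j) c'') - ψ j (bd c'') = φ (pf (emb j) c) - ψ j (bd c) := by
        have e0 := hz j a' ha'
        have e4 : φ (pf (emb j) (bd b)) = 0 := by rw [← bd_pf, hφ]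
        rw [hca]
        simp only [map_add, map_sub, bd_bd, map_zero]
        rw [e4]
        linarith
      have e2 := hn j c
      rw [← e1] at e2
      have e3 := hz1 j
      rw [abs_le] at *
      constructor <;> linarith [e2.1, e2.2, e3.1, e3.2]
    rw [hE, map_sum]
    refine (Finset.abs_sum_le_sum_abs _ _).trans ((Finset.sum_le_sum fun j _ => hj j).trans ?_)
    rw [Finset.sum_add_distrib, ← Finset.sum_mul]
    simp
  set S := ∑ j, K j * (2 * |(r : ℝ)|) with hS
  have hS0 : 0 ≤ S := by
    refine Finset.sum_nonneg fun j _ => mul_nonneg ?_ (by positivity)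
    obtain ⟨w⟩ := W.connected.toNonempty
    exact (abs_nonneg _).trans (hK j (ContinuousMap.const _ w))
  refine le_of_forall_pos_le_add fun ε hε => ?_
  have hd0 : (0 : ℝ) ≤ d := Nat.cast_nonneg d
  obtain ⟨c, hc, hcl⟩ := simVol_set W (ε / (d + S + 1)) (by positivity)
  obtain ⟨z, hz', hzl⟩ := simVol_set M (ε / (d + S + 1)) (by positivity)
  rw [hM, zero_add] at hzl
  have hδ : ε / (d + S + 1) * (d + S + 1) = ε := div_mul_cancel₀ _ (by positivity)
  have hδ0 : 0 < ε / (d + S + 1) := by positivity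
  have := hest c z hc hz'
  have q1 := mul_le_mul_of_nonneg_left hcl.le hd0
  have q2 := mul_le_mul_of_nonneg_left hzl.le hS0
  nlinarith

theorem main_est {k d : ℕ} [NeZero d] {M : OCCManifold (k + 2)} {W T : OCCManifold (k + 3)}
    (hT : T.boundary = ∅) (ham : ∀ x : W.boundary, IsAmenable (FundamentalGroup W.boundary x))
    {ep em : C(M.carrier, W.boundary)} (hs : ∀ a, (∃ x, ep x = a) ∨ ∃ x, em x = a)
    (hp : Function.Injective ep) (hm : Function.Injective em)
    (hpm : ∀ x y, ep x = em y → x = y ∧ x ∈ M.boundary)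
    (hAA : ∀ x ∈ M.boundary, ep x = em x) (hne : M.boundary.Nonempty)
    {emb : Fin d → C(W.carrier, T.carrier)}
    (hinj : ∀ i j a b, emb i a = emb j b → (i = j ∧ a = b) ∨ (a ∈ W.boundary ∧ b ∈ W.boundary))
    (hsur : ∀ x, ∃ j w, emb j w = x)
    (hcyc : ∀ j x, emb j ((subInc W.boundary).comp em x) = emb (j + 1) ((subInc W.boundary).comp ep x))
    (hM : simVol M = 0) : simVol T ≤ d * simVol W := by
  have := W.t2
  have := W.compact
  have := T.t2
  have := M.connected
  have hcomp : CompactSpace W.boundary := isCompact_iff_compactSpace.1 (closed_bdry W).isCompact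
  have hconn : ConnectedSpace W.boundary := conn_glue hs (by
    obtain ⟨x, hx⟩ := hne
    exact ⟨x, hAA x hx⟩)
  have hEC : EChart (k + 2) W.boundary := bdry_chart W
  have hAm : Amen W.boundary := ⟨echart_pc hEC, ham⟩
  have hFW : bd W.fundClass ∈ con ℤ W.boundary (k + 2) := by
    have h : chainBoundary W.fundClass ∈ chainsOn W.boundary (k + 2) := W.fundClass_cycle
    rwa [chainBoundary_eq, mem_chainsOn_iff] at h
  obtain ⟨ω, hω⟩ := exists_sub hFW
  have hω0 : bd ω = 0 := by
    apply pf_inj (f := subInc W.boundary) Subtype.val_injective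
    rw [← bd_pf, hω, bd_bd, map_zero]
  obtain ⟨r, b, hrb⟩ := double_cycle M hEC hs hp hm hpm hAA hne ω hω0
  set c' := W.fundClass - pf (subInc W.boundary) b with hc'
  have hc2 : W.fundClass - c' ∈ con ℤ W.boundary (k + 3) := by
    rw [hc', sub_sub_cancel]
    exact pf_con (A := Set.univ) (fun x _ => x.2) (con_univ b)
  have hc1 : bd c' = r • (pf ((subInc W.boundary).comp ep) M.fundClass -
      pf ((subInc W.boundary).comp em) M.fundClass) := by
    rw [hc', map_sub, bd_pf, ← hω, ← map_sub, hrb, map_smul, map_sub, pf_pf, pf_pf]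
  have hc3 : bd c' ∈ con ℤ W.boundary (k + 2) := by
    have : c' = W.fundClass - (W.fundClass - c') := by abel
    rw [this, map_sub]
    exact sub_mem hFW (bd_con hc2)
  have hEcyc : bd (∑ j, pf (emb j) c') = 0 := by
    rw [map_sum]
    simp only [bd_pf, hc1, map_smul, ← Finset.smul_sum]
    rw [telescope hcyc, smul_zero]
  obtain ⟨kX, e, a, ha, hE⟩ := T.fundClass_gen (∑ j, pf (emb j) c') (by
    change chainBoundary _ ∈ _
    rw [chainBoundary_eq, hEcyc, mem_chainsOn_iff]
    exact zero_mem _)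
  rw [mem_chainsOn_iff, hT] at ha
  rw [con_empty ha, add_zero, chainBoundary_eq] at hE
  have hk : kX ≠ 0 := by
    rintro rfl
    rw [zero_smul, sub_zero] at hE
    obtain ⟨b', a', ha', hca⟩ := glued_ne hinj hsur c' hc3 e hE
    have := W.fundClass_ord 1 ⟨b', a' + (W.fundClass - c'), by
      rw [mem_chainsOn_iff]
      exact add_mem ha' hc2, by
      rw [chainBoundary_eq, one_smul, sub_zero, ← add_assoc, ← hca]
      abel⟩
    exact one_ne_zero this
  have hW0 := simVol_nonneg W
  rcases hahn (cext T.fundClass) (simVol T) (fun b => simVol_le ⟨by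
      change chainBoundary _ ∈ _
      have h : chainBoundary T.fundClass ∈ chainsOn T.boundary (k + 2) := T.fundClass_cycle
      rw [chainBoundary_eq, mem_chainsOn_iff] at h ⊢
      rw [map_add, bd_bd, add_zero, ← cext_bd]
      exact cext_con h, b, 0, by
        rw [mem_chainsOn_iff]
        exact zero_mem _, by
        rw [chainBoundary_eq, chainExt_eq]
        abel⟩) with h0 | ⟨φ, hφ, hφ1, hφN⟩
  · exact h0.trans (by positivity)
  have hest := key_est hAm hAA hcyc hM r c' hc1 hc2 φ hφ hφ1
  have hE2 : φ (cext (∑ j, pf (emb j) c')) = kX * simVol T := by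
    rw [sub_eq_iff_eq_add.1 hE, map_add, cext_bd, cext_zsmul, map_add, hφ, map_smul, hφN, zero_add, smul_eq_mul]
  rw [hE2, abs_mul, abs_of_nonneg (simVol_nonneg T)] at hest
  have hk1 : (1 : ℝ) ≤ |(kX : ℝ)| := by exact_mod_cast Int.one_le_abs hk
  nlinarith [simVol_nonneg T]

theorem main_thm {k : ℕ} (B : BranchSetup (k + 3))
    (ham : ∀ x : B.W.boundary, IsAmenable (FundamentalGroup B.W.boundary x))
    (hM : simVol B.M = 0) (d : ℕ) [NeZero d] (C : CyclicGluing B d) :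
    simVol C.total ≤ (d : ℝ) * simVol B.W := by
  refine main_est (M := (B.M : OCCManifold (k + 2))) (ep := B.embp) (em := B.embm) (emb := C.emb) C.closed ham
    ?_ ?_ ?_ ?_ ?_ B.bd_nonempty ?_ ?_ ?_ hM
  · intro a
    obtain ⟨x | x, hx⟩ := B.quotient.surjective a
    · exact Or.inl ⟨x, hx⟩
    · exact Or.inr ⟨x, hx⟩
  · intro x y h
    exact (glue_double ((B.identifications (Sum.inl x) (Sum.inl y)).1 h)).1
  · intro x y h
    exact (glue_double ((B.identifications (Sum.inr x) (Sum.inr y)).1 h)).1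
  · intro x y h
    have := glue_double ((B.identifications (Sum.inl x) (Sum.inr y)).1 h)
    refine ⟨this.1, this.2.resolve_left (by simp)⟩
  · intro x hx
    exact (B.identifications (Sum.inl x) (Sum.inr x)).2 (Relation.EqvGen.rel _ _ ⟨x, hx, rfl, rfl⟩)
  · intro i j a b h
    have := glue_cyc (S := {p : Fin d × B.W.carrier | p.2 ∈ B.W.boundary}) (by
      rintro p q ⟨j, x, rfl, rfl⟩
      exact ⟨(B.embm x).2, (B.embp x).2⟩) ((C.identifications (i, a) (j, b)).1 h)
    rcases this with h | h
    · exact Or.inl (Prod.mk.inj h)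
    · exact Or.inr h
  · intro x
    obtain ⟨p, hp⟩ := C.quotient.surjective x
    exact ⟨p.1, p.2, hp⟩
  · intro j x
    exact (C.identifications (j, _) (j + 1, _)).2 (Relation.EqvGen.rel _ _ ⟨j, x, rfl, rfl⟩)


end SV

/-- **Subadditivity of simplicial volume for cyclic branched coverings.**
In the branching setup, suppose that `π₁(∂W)` is amenable and `‖M, ∂M‖ = 0`.  Then for every
`d ≥ 1` the cyclic branched covering satisfies `‖W⁽ᵈ⁾‖ ≤ d · ‖W, ∂W‖`; in particular, if
`‖W, ∂W‖ = 0` then `‖W⁽ᵈ⁾‖ = 0`. -/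
theorem simVol_branched_cover (n : ℕ) (B : BranchSetup n)
    (ham : ∀ x : B.W.boundary, IsAmenable (FundamentalGroup B.W.boundary x))
    (hM : simVol B.M = 0) (d : ℕ) (hd : 1 ≤ d) [NeZero d] (C : CyclicGluing B d) :
    simVol C.total ≤ (d : ℝ) * simVol B.W ∧ (simVol B.W = 0 → simVol C.total = 0) := by
  have hn := B.n_ge
  obtain ⟨k, rfl⟩ : ∃ k, n = k + 3 := ⟨n - 3, by omega⟩
  have h := SV.main_thm B ham hM d C
  refine ⟨h, fun h0 => le_antisymm ?_ (SV.simVol_nonneg _)⟩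
  rw [h0, mul_zero] at h
  exact h

end
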